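/- Let f : J̃ → ℝ be Hölder continuous with P(f) > sup f + log N. Then for every x ∈ J̃ the limit lim_{n→∞} (1/n) log (L_f^n 1)(x) = lim_{n→∞} (1/n) log Σ_{T^n(y)=x} e^{f^n(y)} exists and equals P(f); in particular the limsup in the definition of P(f) is a genuine limit and its value is independent of the point x ∈ J̃. -/

import Mathlib

open MeasureTheory Filter Topology Polynomial
open scoped OnePoint Classical ENNReal

noncomputable section

namespace SkewRational

/-- The Riemann sphere, modelled as the one-point compactification of `ℂ`. -/
abbrev Sphere : Type := OnePoint ℂ

/-- The product space `X = Σ_N⁺ × ℂ̂`. -/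
abbrev SymX (N : ℕ) : Type := (ℕ → Fin N) × Sphere

variable {N : ℕ}

/-- The left shift on `Σ_N⁺`. -/
def shiftW (w : ℕ → Fin N) : ℕ → Fin N := fun n => w (n + 1)

/-- Prepending a letter to an infinite word. -/
def consW (v : Fin N) (w : ℕ → Fin N) : ℕ → Fin N := fun n => if n = 0 then v else w (n - 1)

/-- Evaluation of the rational map `P/Q` (in irreducible form) on the Riemann sphere. -/
def ratEval (P Q : ℂ[X]) : Sphere → Sphere := fun z =>
  OnePoint.elim z
    (if Q.natDegree < P.natDegree then (OnePoint.infty : Sphere)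
     else if P.natDegree < Q.natDegree then ((0 : ℂ) : Sphere)
     else ((P.leadingCoeff / Q.leadingCoeff : ℂ) : Sphere))
    (fun a => if Q.eval a = 0 then (OnePoint.infty : Sphere) else ((P.eval a / Q.eval a : ℂ) : Sphere))

/-- The multiset of preimages (with multiplicity) of a point of the sphere under `P/Q`. -/
def fiber (P Q : ℂ[X]) (a : Sphere) : Multiset Sphere :=
  OnePoint.elim a
    ((Q.roots.map fun z => (z : Sphere)) +
      Multiset.replicate (max P.natDegree Q.natDegree - Q.natDegree) (OnePoint.infty : Sphere))
    (fun b =>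
      (((P - Polynomial.C b * Q).roots.map fun z => (z : Sphere)) +
        Multiset.replicate
          (max P.natDegree Q.natDegree - (P - Polynomial.C b * Q).natDegree) (OnePoint.infty : Sphere)))

variable (p q : Fin N → ℂ[X])

/-- The degree `d_i` of the rational map `R_i = p i / q i`. -/
def degR (i : Fin N) : ℕ := max (p i).natDegree (q i).natDegree

/-- `D = d₁ + ⋯ + d_N`. -/
def Dtot : ℕ := ∑ i, degR p q i

/-- Standing assumptions: `N ≥ 1`, each `R_i = p i / q i` in irreducible form, all degrees
at least `1`, and at least one degree at least `2`. -/
def Good : Prop :=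
  1 ≤ N ∧ (∀ i, IsCoprime (p i) (q i)) ∧ (∀ i, 1 ≤ degR p q i) ∧ (∃ i, 2 ≤ degR p q i)

/-- The skew-product map `T(w, z) = (σ w, R_{w 0} z)`. -/
def Tmap : SymX N → SymX N := fun x => (shiftW x.1, ratEval (p (x.1 0)) (q (x.1 0)) x.2)

/-- The multiset of preimages of a point under `T`, counted with multiplicity. -/
def preimT (x : SymX N) : Multiset (SymX N) :=
  ∑ v : Fin N, (fiber (p v) (q v) x.2).map fun z => (consW v x.1, z)

/-- The multiset of `n`-th order preimages under `T^n`, counted with multiplicity. -/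
def preimTn : ℕ → SymX N → Multiset (SymX N)
  | 0, x => {x}
  | n + 1, x => (preimT p q x).bind fun y => preimTn n y

/-- The chordal (spherical) metric on the Riemann sphere. -/
def sphDist : Sphere → Sphere → ℝ := fun z w =>
  OnePoint.elim z
    (OnePoint.elim w 0 fun b => 2 / Real.sqrt (1 + ‖b‖ ^ 2))
    (fun a =>
      OnePoint.elim w (2 / Real.sqrt (1 + ‖a‖ ^ 2))
        (fun b => 2 * dist a b / (Real.sqrt (1 + ‖a‖ ^ 2) * Real.sqrt (1 + ‖b‖ ^ 2))))

/-- The metric `d(w, w') = 2^{-n(w,w')}` on `Σ_N⁺`. -/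
def shiftDist (w w' : ℕ → Fin N) : ℝ :=
  if h : ∃ n, w n ≠ w' n then (2 : ℝ)⁻¹ ^ (Nat.find h + 1) else 0

/-- The metric on `X`: maximum of the two coordinate metrics. -/
def dX : SymX N → SymX N → ℝ := fun x y => max (shiftDist x.1 y.1) (sphDist x.2 y.2)

/-- Montel normality of a family of self-maps of the sphere on a set `U`. -/
def NormalOn (F : Set (Sphere → Sphere)) (U : Set Sphere) : Prop :=
  ∀ s : ℕ → Sphere → Sphere, (∀ n, s n ∈ F) →
    ∃ φ : ℕ → ℕ, StrictMono φ ∧ ∃ g : Sphere → Sphere,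
      ∀ K : Set Sphere, K ⊆ U → IsCompact K → ∀ ε : ℝ, 0 < ε →
        ∀ᶠ n in atTop, ∀ z ∈ K, sphDist (s (φ n) z) (g z) < ε

/-- The compositions `R_{w (n-1)} ∘ ⋯ ∘ R_{w 0}`. -/
def itComp (w : ℕ → Fin N) : ℕ → Sphere → Sphere
  | 0 => id
  | n + 1 => ratEval (p (w n)) (q (w n)) ∘ itComp w n

/-- The fibrewise Fatou set `F_w`. -/
def fatouW (w : ℕ → Fin N) : Set Sphere :=
  {z | ∃ U : Set Sphere, IsOpen U ∧ z ∈ U ∧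
    NormalOn {g | ∃ n, 1 ≤ n ∧ g = itComp p q w n} U}

/-- The fibrewise Julia set `J_w`. -/
def juliaW (w : ℕ → Fin N) : Set Sphere := (fatouW p q w)ᶜ

/-- The Julia set `J̃` of the skew-product map `T`. -/
def juliaSet : Set (SymX N) :=
  closure (⋃ w : ℕ → Fin N, {w} ×ˢ juliaW p q w)

/-- The critical points of `T`: `(w, z)` with `z` a critical point of `R_{w 0}`. -/
def critSet : Set (SymX N) :=
  {x | 2 ≤ (fiber (p (x.1 0)) (q (x.1 0))
        (ratEval (p (x.1 0)) (q (x.1 0)) x.2)).count x.2}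

/-- Assumption (A1): no super-attracting periodic point of `T` lies in the Julia set
(a periodic point is super-attracting exactly when its orbit meets the critical set,
i.e. the derivative of the return composition vanishes). -/
def NoSuperAttract : Prop :=
  ∀ x ∈ juliaSet p q, ∀ m : ℕ, 1 ≤ m → (Tmap p q)^[m] x = x →
    ∀ k < m, (Tmap p q)^[k] x ∉ critSet p q

instance : MeasurableSpace (SymX N) := borel _
instance : BorelSpace (SymX N) := ⟨rfl⟩

instance : MeasurableSpace ↥(juliaSet p q) := borel _
instance : BorelSpace ↥(juliaSet p q) := ⟨rfl⟩

/-! ### Fixed points counted with multiplicity -/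

/-- Formal composition of rational maps as pairs of polynomials: `compPair a b = a ∘ b`. -/
def compPair (a b : ℂ[X] × ℂ[X]) : ℂ[X] × ℂ[X] :=
  (∑ i ∈ Finset.range (max a.1.natDegree a.2.natDegree + 1),
      Polynomial.C (a.1.coeff i) * b.1 ^ i * b.2 ^ (max a.1.natDegree a.2.natDegree - i),
   ∑ i ∈ Finset.range (max a.1.natDegree a.2.natDegree + 1),
      Polynomial.C (a.2.coeff i) * b.1 ^ i * b.2 ^ (max a.1.natDegree a.2.natDegree - i))

/-- For a word `[v₁, …, v_m]`, the composite `R_{v_m} ∘ ⋯ ∘ R_{v₁}` as a pair of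
polynomials. -/
def wordPair : List (Fin N) → ℂ[X] × ℂ[X]
  | [] => (Polynomial.X, 1)
  | v :: t => compPair (wordPair t) (p v, q v)

/-- The multiset of fixed points (with multiplicity) on the sphere of the rational map given
by a pair of polynomials; a degree-`k` map has `k + 1` fixed points with multiplicity. -/
def fixMul (a : ℂ[X] × ℂ[X]) : Multiset Sphere :=
  ((a.1 - Polynomial.X * a.2).roots.map fun z => (z : Sphere)) +
    Multiset.replicate
      (max a.1.natDegree a.2.natDegree + 1 - (a.1 - Polynomial.X * a.2).natDegree) (OnePoint.infty : Sphere)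

/-- The periodic word `(v₁ ⋯ v_m v₁ ⋯ v_m ⋯)`. -/
def perW {m : ℕ} (hm : 0 < m) (v : Fin m → Fin N) : ℕ → Fin N :=
  fun n => v ⟨n % m, Nat.mod_lt n hm⟩

/-- The multiset `Fix_m(T)` of fixed points of `T^m`, counted with multiplicity. -/
def fixMultiset (m : ℕ) : Multiset (SymX N) :=
  if hm : 0 < m then
    ∑ v : Fin m → Fin N, (fixMul (wordPair p q (List.ofFn v))).map fun z => (perW hm v, z)
  else 0

/-! ### Thermodynamic formalism -/

/-- The ergodic (Birkhoff) sum `f^n`. -/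
def birk (f : SymX N → ℝ) (n : ℕ) (y : SymX N) : ℝ :=
  ∑ k ∈ Finset.range n, f ((Tmap p q)^[k] y)

/-- `(L_f^n 1)(x) = Σ_{T^n y = x} e^{f^n(y)}`. -/
def LSum (f : SymX N → ℝ) (n : ℕ) (x : SymX N) : ℝ :=
  ((preimTn p q n x).map fun y => Real.exp (birk p q f n y)).sum

/-- The pressure `P(f) = sup_{x ∈ J̃} limsup (1/n) log (L_f^n 1)(x)`. -/
def pressure (f : SymX N → ℝ) : ℝ :=
  ⨆ x : ↥(juliaSet p q), limsup (fun n : ℕ => (n : ℝ)⁻¹ * Real.log (LSum p q f n ↑x)) atTop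

/-- Extension by zero of a function on `J̃` to all of `X`; since `T⁻¹ J̃ = J̃`, the values
outside `J̃` are irrelevant in all expressions below. -/
def jextend (f : ↥(juliaSet p q) → ℝ) : SymX N → ℝ :=
  fun x => if hx : x ∈ juliaSet p q then f ⟨x, hx⟩ else 0

/-- Hölder continuity on `J̃` with respect to the metric `d_X`. -/
def HolderOnJ (f : ↥(juliaSet p q) → ℝ) : Prop :=
  ∃ C : ℝ, 0 < C ∧ ∃ α : ℝ, α ∈ Set.Ioc (0 : ℝ) 1 ∧
    ∀ x y : ↥(juliaSet p q), |f x - f y| ≤ C * dX (x : SymX N) (y : SymX N) ^ α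

/-- `Q(g) = P(f + g) − P(f)`. -/
def Qfun (f g : ↥(juliaSet p q) → ℝ) : ℝ :=
  pressure p q (jextend p q fun x => f x + g x) - pressure p q (jextend p q f)

/-- The Legendre transform `L(m) = sup_g (∫ g dm − Q(g)) ∈ [0, (OnePoint.infty : Sphere)]`. -/
def LLfun (f : ↥(juliaSet p q) → ℝ) (m : ProbabilityMeasure ↥(juliaSet p q)) : EReal :=
  ⨆ g : C(↥(juliaSet p q), ℝ),
    (((∫ x, g x ∂(m : Measure ↥(juliaSet p q))) - Qfun p q f g : ℝ) : EReal)

/-- `ρ(K) = inf_{m ∈ K} L(m)`. -/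
def rho (f : ↥(juliaSet p q) → ℝ) (K : Set (ProbabilityMeasure ↥(juliaSet p q))) : EReal :=
  ⨅ m ∈ K, LLfun p q f m

/-- Membership in `M_T`: `T`-invariance of a probability measure on `J̃`. -/
def MTinv (m : ProbabilityMeasure ↥(juliaSet p q)) : Prop :=
  ∀ A : Set (SymX N), MeasurableSet A →
    ((m : Measure ↥(juliaSet p q)).map Subtype.val) (Tmap p q ⁻¹' A) =
      ((m : Measure ↥(juliaSet p q)).map Subtype.val) A

/-- The orbital measure `μ_{y,n} = (1/n)(δ_y + δ_{Ty} + ⋯ + δ_{T^{n-1}y})`, viewed as a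
measure on `J̃`. -/
def orbMeas (y : SymX N) (n : ℕ) : Measure ↥(juliaSet p q) :=
  Measure.comap Subtype.val
    ((n : ℝ≥0∞)⁻¹ • ∑ k ∈ Finset.range n, Measure.dirac ((Tmap p q)^[k] y))

/-- The (unique, if it exists) probability-measure avatar of `μ` lies in `K`. -/
def inK (μ : Measure ↥(juliaSet p q)) (K : Set (ProbabilityMeasure ↥(juliaSet p q))) : Prop :=
  ∃ ν : ProbabilityMeasure ↥(juliaSet p q), (ν : Measure ↥(juliaSet p q)) = μ ∧ ν ∈ K

/-- The sequence `(1/n) log [Σ_{T^n y = x, μ_{y,n} ∈ K} e^{f^n(y)} / Σ_{T^n y = x} e^{f^n(y)}]`,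
valued in `EReal` with the convention `log 0 = ⊥`. -/
def preimLDSeq (f : ↥(juliaSet p q) → ℝ) (x : SymX N)
    (K : Set (ProbabilityMeasure ↥(juliaSet p q))) : ℕ → EReal := fun n =>
  if (((preimTn p q n x).filter fun y => inK p q (orbMeas p q y n) K).map
        fun y => Real.exp (birk p q (jextend p q f) n y)).sum = 0 then ⊥
  else
    (((n : ℝ)⁻¹ * Real.log
      (((((preimTn p q n x).filter fun y => inK p q (orbMeas p q y n) K).map
          fun y => Real.exp (birk p q (jextend p q f) n y)).sum) /
        LSum p q (jextend p q f) n x) : ℝ) : EReal)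

/-- `Fix_m(T) ∩ J̃` as a multiset. -/
def fixJ (m : ℕ) : Multiset (SymX N) := (fixMultiset p q m).filter fun y => y ∈ juliaSet p q

/-- `Σ_{(ω,ζ) ∈ Fix_m(T) ∩ J̃} e^{f^m(ω,ζ)}`. -/
def fixSum (f : SymX N → ℝ) (m : ℕ) : ℝ :=
  ((fixJ p q m).map fun y => Real.exp (birk p q f m y)).sum

/-- The periodic-point analogue of `preimLDSeq`, with the convention `log 0 = ⊥`. -/
def fixLDSeq (f : ↥(juliaSet p q) → ℝ)
    (K : Set (ProbabilityMeasure ↥(juliaSet p q))) : ℕ → EReal := fun m =>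
  if (((fixJ p q m).filter fun y => inK p q (orbMeas p q y m) K).map
        fun y => Real.exp (birk p q (jextend p q f) m y)).sum = 0 then ⊥
  else
    (((m : ℝ)⁻¹ * Real.log
      (((((fixJ p q m).filter fun y => inK p q (orbMeas p q y m) K).map
          fun y => Real.exp (birk p q (jextend p q f) m y)).sum) /
        fixSum p q (jextend p q f) m) : ℝ) : EReal)

/-! ### Inverse branches -/

/-- Projection of a subset of `X` to the sphere coordinate. -/
def projC (E : Set (SymX N)) : Set Sphere := Prod.snd '' E

/-- For a word `[v₁, …, v_m]`, the composite map `R_{v₁} ∘ R_{v₂} ∘ ⋯ ∘ R_{v_m}`. -/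
def mapWord (l : List (Fin N)) : Sphere → Sphere :=
  l.foldr (fun i f => ratEval (p i) (q i) ∘ f) id

/-- `γ_m(U)`: the total number of analytic inverse branches of `T^m` on `U`, counted over
all `m`-strings.  (A continuous section of a rational map off its critical values is
automatically holomorphic.) -/
def gammaCount (U : Set (SymX N)) (m : ℕ) : ℕ :=
  Nat.card ((v : Fin m → Fin N) ×
    { s : C(↥(projC U), Sphere) // ∀ z : ↥(projC U), mapWord p q (List.ofFn v) (s z) = ↑z })

/-- `C_n = ⋃_{k=1}^n T^k(C)`, the critical values of `T` of order up to `n`. -/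
def critValSet (n : ℕ) : Set (SymX N) :=
  ⋃ k ∈ Finset.Icc 1 n, (Tmap p q)^[k] '' critSet p q

/-- `τ`: the number of distinct critical values of `T` in `U` (projected to the sphere). -/
def tauCount (U : Set (SymX N)) : ℕ := (Prod.snd '' (Tmap p q '' critSet p q ∩ U)).ncard

/-! ### The averaging operator `G` -/

/-- `(G^m h)(x) = D^{-m} Σ_{T^m y = x} h(y)`. -/
def GmFun (h : SymX N → ℝ) (m : ℕ) (x : SymX N) : ℝ :=
  ((Dtot p q : ℝ) ^ m)⁻¹ * ((preimTn p q m x).map h).sum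

/-- The supremum norm on functions on `J̃`. -/
def supJ (f : ↥(juliaSet p q) → ℝ) : ℝ := ⨆ x, |f x|

def fibPoly (d : ℕ) (G : ℂ[X]) : Multiset Sphere :=
  (G.roots.map (fun z : ℂ => (z : Sphere))) +
      Multiset.replicate (d - G.natDegree) (OnePoint.infty : Sphere)

lemma fiber_infty (P Q : ℂ[X]) :
    fiber P Q OnePoint.infty = fibPoly (max P.natDegree Q.natDegree) Q := by
  simp [fiber, fibPoly, Multiset.bind_def, Multiset.pure_def, Multiset.bind_singleton]
lemma fiber_coe (P Q : ℂ[X]) (b : ℂ) :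
    fiber P Q (b : Sphere) = fibPoly (max P.natDegree Q.natDegree) (P - C b * Q) := by
  simp [fiber, fibPoly, Multiset.bind_def, Multiset.pure_def, Multiset.bind_singleton]
lemma ratEval_infty (P Q : ℂ[X]) : ratEval P Q OnePoint.infty =
    (if Q.natDegree < P.natDegree then (OnePoint.infty : Sphere)
     else if P.natDegree < Q.natDegree then ((0 : ℂ) : Sphere)
     else ((P.leadingCoeff / Q.leadingCoeff : ℂ) : Sphere)) := rfl
lemma ratEval_coe (P Q : ℂ[X]) (a : ℂ) : ratEval P Q (a : Sphere) =
    if Q.eval a = 0 then (OnePoint.infty : Sphere) else ((P.eval a / Q.eval a : ℂ) : Sphere) := rfl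

lemma mem_fibPoly_coe {d : ℕ} {G : ℂ[X]} (hG : G ≠ 0) (a : ℂ) :
    (a : Sphere) ∈ fibPoly d G ↔ G.eval a = 0 := by
  simp only [fibPoly, Multiset.mem_add, Multiset.mem_map, Multiset.mem_replicate,
    OnePoint.coe_ne_infty, and_false, or_false, OnePoint.coe_eq_coe, exists_eq_right,
    Polynomial.mem_roots hG, Polynomial.IsRoot.def]

lemma mem_fibPoly_infty {d : ℕ} {G : ℂ[X]} :
    (OnePoint.infty : Sphere) ∈ fibPoly d G ↔ G.natDegree < d := by
  simp [fibPoly, Multiset.mem_replicate, Nat.sub_eq_zero_iff_le]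

lemma card_fibPoly {d : ℕ} {G : ℂ[X]} (h : G.natDegree ≤ d) : (fibPoly d G).card = d := by
  have : Multiset.card G.roots = G.natDegree :=
    (Polynomial.splits_iff_card_roots).1 (IsAlgClosed.splits G)
  simp only [fibPoly, Multiset.card_add, Multiset.card_map, Multiset.card_replicate, this]
  omega


lemma Q_ne_zero {P Q : ℂ[X]} (hc : IsCoprime P Q) (hd : 1 ≤ max P.natDegree Q.natDegree) : Q ≠ 0 := by
  rintro rfl
  rw [isCoprime_zero_right] at hc
  have := Polynomial.natDegree_eq_zero_of_isUnit hc
  simp at hd; omega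

lemma PQ_ne_zero {P Q : ℂ[X]} (hc : IsCoprime P Q) (hd : 1 ≤ max P.natDegree Q.natDegree) (c : ℂ) : P - C c * Q ≠ 0 := by
  intro h
  have h1 : P = Q * C c := by rw [mul_comm]; exact sub_eq_zero.1 h
  have h2 : IsUnit Q := hc.isUnit_of_dvd' (h1 ▸ dvd_mul_right _ _) dvd_rfl
  have h3 := Polynomial.natDegree_eq_zero_of_isUnit h2
  have h4 : P.natDegree ≤ Q.natDegree + (C c).natDegree := h1 ▸ Polynomial.natDegree_mul_le
  simp at h4
  omega

lemma not_both_zero {P Q : ℂ[X]} (hc : IsCoprime P Q) (a : ℂ) (h1 : P.eval a = 0) (h2 : Q.eval a = 0) : False := by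
  obtain ⟨u, v, h⟩ := hc
  have := congrArg (Polynomial.eval a) h
  simp [h1, h2] at this

lemma natDegree_PQ_le {P Q : ℂ[X]} (c : ℂ) : (P - C c * Q).natDegree ≤ max P.natDegree Q.natDegree :=
  (Polynomial.natDegree_sub_le _ _).trans
    (max_le_max le_rfl (Polynomial.natDegree_C_mul_le _ _))

lemma natDegree_lt_iff_coeff {d : ℕ} (hd1 : 1 ≤ d) {G : ℂ[X]} (h : G.natDegree ≤ d) :
    G.natDegree < d ↔ G.coeff d = 0 := by
  constructor
  · exact Polynomial.coeff_eq_zero_of_natDegree_lt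
  · intro h0
    rcases h.lt_or_eq with h | h
    · exact h
    · rw [← h, Polynomial.coeff_natDegree, Polynomial.leadingCoeff_eq_zero] at h0
      rw [h0] at h ⊢; simp at h ⊢; omega

lemma mem_fiber {P Q : ℂ[X]} (hc : IsCoprime P Q) (hd : 1 ≤ max P.natDegree Q.natDegree) (b ζ : Sphere) : ζ ∈ fiber P Q b ↔ ratEval P Q ζ = b := by
  have hQ := Q_ne_zero hc hd
  have hQl : Q.leadingCoeff ≠ 0 := by simpa using hQ
  induction b using OnePoint.rec with
  | infty =>
    rw [fiber_infty]
    induction ζ using OnePoint.rec with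
    | infty =>
      rw [mem_fibPoly_infty, ratEval_infty]
      split_ifs with h1 h2 <;> simp <;> omega
    | coe a =>
      rw [mem_fibPoly_coe hQ, ratEval_coe]
      split_ifs with h <;> simp [h]
  | coe c =>
    rw [fiber_coe]
    induction ζ using OnePoint.rec with
    | infty =>
      rw [mem_fibPoly_infty, natDegree_lt_iff_coeff hd (natDegree_PQ_le c), ratEval_infty]
      rw [Polynomial.coeff_sub, Polynomial.coeff_C_mul]
      split_ifs with h1 h2
      · rw [max_eq_left h1.le, Polynomial.coeff_eq_zero_of_natDegree_lt h1]
        have : P ≠ 0 := by rintro rfl; simp at h1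
        simpa using this
      · rw [max_eq_right h2.le, Polynomial.coeff_eq_zero_of_natDegree_lt h2]
        simp only [zero_sub, neg_eq_zero, mul_eq_zero, Polynomial.coeff_natDegree, hQl, or_false, OnePoint.coe_eq_coe]
        exact eq_comm
      · have h3 : P.natDegree = Q.natDegree := by omega
        rw [OnePoint.coe_eq_coe, div_eq_iff hQl, h3, max_self, sub_eq_zero]
        rw [Polynomial.leadingCoeff, Polynomial.leadingCoeff, h3]
    | coe a =>
      rw [mem_fibPoly_coe (PQ_ne_zero hc hd c), ratEval_coe]
      simp only [Polynomial.eval_sub, Polynomial.eval_mul, Polynomial.eval_C]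
      split_ifs with h
      · simp only [h, mul_zero, sub_zero]
        constructor
        · intro h'; exact (not_both_zero hc a h' h).elim
        · intro h'; exact (OnePoint.infty_ne_coe _ h').elim
      · rw [OnePoint.coe_eq_coe, div_eq_iff h, sub_eq_zero]

lemma card_fiber {P Q : ℂ[X]} (b : Sphere) : (fiber P Q b).card = max P.natDegree Q.natDegree := by
  induction b using OnePoint.rec with
  | infty => rw [fiber_infty]; exact card_fibPoly (le_max_right _ _)
  | coe c => rw [fiber_coe]; exact card_fibPoly (natDegree_PQ_le c)

abbrev S3 : Type := ↥(Metric.sphere (0 : ℂ × ℂ) 1)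

def hopf (v : S3) : Sphere := if v.1.2 = 0 then OnePoint.infty else ((v.1.1 / v.1.2 : ℂ) : Sphere)

lemma S3_ne (v : S3) (h : v.1.2 = 0) : v.1.1 ≠ 0 := by
  intro h1
  have := v.2
  have h2 : v.1 = 0 := Prod.ext h1 h
  rw [h2] at this
  simp at this

lemma cont_S3_1 : Continuous (fun u : S3 => u.1.1) := by fun_prop
lemma cont_S3_2 : Continuous (fun u : S3 => u.1.2) := by fun_prop

lemma continuous_hopf : Continuous hopf := by
  rw [continuous_iff_continuousAt]
  intro v
  by_cases hv : v.1.2 = 0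
  · have h1 := S3_ne v hv
    have hv' : hopf v = OnePoint.infty := by simp [hopf, hv]
    rw [ContinuousAt, hv']
    have key : Tendsto (fun u : S3 => u.1.2 / u.1.1) (𝓝 v) (𝓝 0) := by
      have : ContinuousAt (fun u : S3 => u.1.2 / u.1.1) v :=
        cont_S3_2.continuousAt.div cont_S3_1.continuousAt h1
      simpa [ContinuousAt, hv] using this
    rw [Tendsto, OnePoint.le_nhds_infty]
    intro s _ hs
    obtain ⟨R, hR⟩ := hs.isBounded.exists_norm_le
    rw [mem_map]
    have key2 := (Metric.tendsto_nhds.1 key) (1 / (|R| + 1)) (by positivity)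
    filter_upwards [key2, cont_S3_1.continuousAt.eventually_ne h1] with u hu hu1
    rw [Set.mem_preimage, ← OnePoint.compl_image_coe]
    rintro ⟨x, hx, hxe⟩
    by_cases hu2 : u.1.2 = 0
    · simp [hopf, hu2] at hxe
    · simp only [hopf, hu2, if_false, OnePoint.coe_eq_coe] at hxe
      have hxR := hR x hx
      rw [dist_zero_right, ← inv_div, ← hxe, norm_inv] at hu
      have hx0 : 0 < ‖x‖ ∨ ‖x‖ = 0 := by
        rcases (norm_nonneg x).lt_or_eq with h | h
        · exact Or.inl h
        · exact Or.inr h.symm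
      rcases hx0 with hx0 | hx0
      · rw [one_div, inv_lt_inv₀ hx0 (by positivity)] at hu
        linarith [le_abs_self R]
      · rw [norm_eq_zero] at hx0
        rw [hx0, eq_comm, div_eq_zero_iff] at hxe
        rcases hxe with h | h
        · exact hu1 h
        · exact hu2 h
  · have : ContinuousAt (fun u : S3 => ((u.1.1 / u.1.2 : ℂ) : Sphere)) v :=
      OnePoint.continuous_coe.continuousAt.comp
        (cont_S3_1.continuousAt.div cont_S3_2.continuousAt hv)
    apply this.congr
    have : ∀ᶠ u : S3 in 𝓝 v, u.1.2 ≠ 0 := cont_S3_2.continuousAt.eventually_ne hv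
    filter_upwards [this] with u hu
    simp [hopf, hu]

lemma hopf_surj : Function.Surjective hopf := by
  intro z
  induction z using OnePoint.rec with
  | infty => exact ⟨⟨(1, 0), by simp⟩, by simp [hopf]⟩
  | coe c =>
    have h : 0 < ‖((c, 1) : ℂ × ℂ)‖ := by simp
    have h' : ((‖((c, 1) : ℂ × ℂ)‖ : ℝ) : ℂ) ≠ 0 := by exact_mod_cast h.ne'
    refine ⟨⟨((‖((c, 1) : ℂ × ℂ)‖⁻¹ : ℝ) : ℂ) • (c, 1), ?_⟩, ?_⟩
    · rw [mem_sphere_zero_iff_norm, norm_smul, Complex.norm_real, norm_inv, norm_norm,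
        inv_mul_cancel₀ h.ne']
    · simp only [hopf, Prod.smul_mk, smul_eq_mul, mul_one, Complex.ofReal_inv, inv_eq_zero, h', if_false]
      congr 1
      field_simp

lemma roots_prop {A B : ℂ[X]} (hA : A ≠ 0) (hB : B ≠ 0)
    (h : ∀ s t : ℂ, A.eval s * B.eval t = A.eval t * B.eval s) (d : ℕ) :
    fibPoly d A = fibPoly d B := by
  obtain ⟨t, ht⟩ : ∃ t, A.eval t ≠ 0 := by
    by_contra! hh
    exact hA (Polynomial.funext (by simpa using hh))
  have h1 : C (B.eval t) * A = C (A.eval t) * B := by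
    apply Polynomial.funext
    intro s
    simp only [Polynomial.eval_mul, Polynomial.eval_C]
    rw [mul_comm, h s t]
  have ht' : B.eval t ≠ 0 := by
    intro h0
    rw [h0, C_0, zero_mul, eq_comm, mul_eq_zero, C_eq_zero] at h1
    tauto
  have h2 := congrArg Polynomial.roots h1
  have h3 := congrArg Polynomial.natDegree h1
  rw [Polynomial.roots_C_mul _ ht, Polynomial.roots_C_mul _ ht'] at h2
  rw [Polynomial.natDegree_C_mul ht, Polynomial.natDegree_C_mul ht'] at h3
  rw [fibPoly, fibPoly, h2, h3]

lemma fibPoly_mul {d e : ℕ} {A B : ℂ[X]} (hA : A ≠ 0) (hB : B ≠ 0) (h1 : A.natDegree ≤ d)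
    (h2 : B.natDegree ≤ e) : fibPoly (d + e) (A * B) = fibPoly d A + fibPoly e B := by
  rw [fibPoly, fibPoly, fibPoly, Polynomial.roots_mul (mul_ne_zero hA hB),
    Polynomial.natDegree_mul hA hB, Multiset.map_add,
    show d + e - (A.natDegree + B.natDegree) = (d - A.natDegree) + (e - B.natDegree) by omega,
    Multiset.replicate_add]
  abel

def linP (v : S3) : ℂ[X] := C v.1.2 * X - C v.1.1

lemma linP_ne (v : S3) : linP v ≠ 0 := by
  intro h
  by_cases hv : v.1.2 = 0
  · have := congrArg (fun G => Polynomial.coeff G 0) h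
    simp [linP, S3_ne v hv] at this
  · have := congrArg (fun G => Polynomial.coeff G 1) h
    simp [linP, hv, Polynomial.coeff_C] at this

lemma linP_deg (v : S3) : (linP v).natDegree ≤ 1 := by
  rw [linP, sub_eq_add_neg, ← C_neg]
  exact Polynomial.natDegree_linear_le

lemma fibPoly_linP (v : S3) : fibPoly 1 (linP v) = {hopf v} := by
  obtain ⟨a, ha⟩ := Multiset.card_eq_one.1 (card_fibPoly (linP_deg v))
  rw [ha]
  have hm : hopf v ∈ fibPoly 1 (linP v) := by
    by_cases hv : v.1.2 = 0
    · simp only [hopf, hv, if_true]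
      rw [mem_fibPoly_infty]
      simp [linP, hv]
    · simp only [hopf, hv, if_false]
      rw [mem_fibPoly_coe (linP_ne v)]
      simp [linP]
      field_simp
      simp
  rw [ha] at hm
  rw [Multiset.mem_singleton.1 hm]

lemma fibPoly_prod {ι : Type*} (s : Finset ι) (r : ι → S3) :
    (∏ i ∈ s, linP (r i)).natDegree ≤ s.card ∧
    fibPoly s.card (∏ i ∈ s, linP (r i)) = s.val.map (fun i => hopf (r i)) := by
  induction s using Finset.induction_on with
  | empty => simp [fibPoly]
  | insert a s ha ih =>
    have hne : (∏ i ∈ s, linP (r i)) ≠ 0 := Finset.prod_ne_zero_iff.2 fun i _ => linP_ne _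
    rw [Finset.prod_insert ha, Finset.card_insert_of_notMem ha]
    constructor
    · have := Polynomial.natDegree_mul_le (p := linP (r a)) (q := ∏ i ∈ s, linP (r i))
      have := linP_deg (r a)
      omega
    · rw [add_comm s.card 1, fibPoly_mul (linP_ne _) hne (linP_deg _) ih.1, ih.2, fibPoly_linP,
        Finset.insert_val_of_notMem ha, Multiset.map_cons, Multiset.singleton_add]

def homP (P Q : ℂ[X]) (v : S3) : ℂ[X] := C v.1.2 * P - C v.1.1 * Q

lemma homP_deg (P Q : ℂ[X]) (v : S3) : (homP P Q v).natDegree ≤ max P.natDegree Q.natDegree :=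
  (Polynomial.natDegree_sub_le _ _).trans
    (max_le_max (Polynomial.natDegree_C_mul_le _ _) (Polynomial.natDegree_C_mul_le _ _))

lemma fibPoly_C_mul (d : ℕ) (A : ℂ[X]) {c : ℂ} (hc : c ≠ 0) : fibPoly d (C c * A) = fibPoly d A := by
  rw [fibPoly, fibPoly, Polynomial.roots_C_mul _ hc, Polynomial.natDegree_C_mul hc]

lemma homP_fiber {P Q : ℂ[X]} (hc : IsCoprime P Q) (hd : 1 ≤ max P.natDegree Q.natDegree)
    (v : S3) : homP P Q v ≠ 0 ∧
      fibPoly (max P.natDegree Q.natDegree) (homP P Q v) = fiber P Q (hopf v) := by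
  by_cases hv : v.1.2 = 0
  · have h1 : homP P Q v = C (-v.1.1) * Q := by simp [homP, hv]
    have h2 : -v.1.1 ≠ 0 := neg_ne_zero.2 (S3_ne v hv)
    refine ⟨?_, ?_⟩
    · rw [h1]; exact mul_ne_zero (by simpa using S3_ne v hv) (Q_ne_zero hc hd)
    · rw [h1, fibPoly_C_mul _ _ h2]; simp only [hopf, hv, if_true]; rw [fiber_infty]
  · have h1 : homP P Q v = C v.1.2 * (P - C (v.1.1 / v.1.2) * Q) := by
      rw [homP, mul_sub, ← mul_assoc, ← C_mul, mul_div_cancel₀ _ hv]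
    refine ⟨?_, ?_⟩
    · rw [h1]; exact mul_ne_zero (by simpa using hv) (PQ_ne_zero hc hd _)
    · rw [h1, fibPoly_C_mul _ _ hv]; simp only [hopf, hv, if_false]; rw [fiber_coe]

lemma prop_of_fib {d : ℕ} {A B : ℂ[X]} (h : fibPoly d A = fibPoly d B) (s t : ℂ) :
    A.eval s * B.eval t = A.eval t * B.eval s := by
  have hr : A.roots = B.roots := by
    ext a
    have h1 : ∀ G : ℂ[X], (fibPoly d G).count (a : Sphere) = G.roots.count a := by
      intro G
      rw [fibPoly, Multiset.count_add, Multiset.count_map_eq_count' _ _ OnePoint.coe_injective,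
        Multiset.count_replicate, if_neg (OnePoint.infty_ne_coe a), add_zero]
    rw [← h1, ← h1, h]
  have hA := (IsAlgClosed.splits A).eq_prod_roots
  have hB := (IsAlgClosed.splits B).eq_prod_roots
  rw [hr] at hA
  rw [hA, hB]
  simp only [Polynomial.eval_mul, Polynomial.eval_C]
  rw [← hB]
  ring

theorem continuous_fiber_sum {P Q : ℂ[X]} (hc : IsCoprime P Q)
    (hd : 1 ≤ max P.natDegree Q.natDegree) {φ : Sphere → ℝ} (hφ : Continuous φ) :
    Continuous fun z => ((fiber P Q z).map φ).sum := by
  set d := max P.natDegree Q.natDegree with hdd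
  have hcard : (Finset.univ : Finset (Fin d)).card = d := by simp
  let Rel : Set (S3 × (Fin d → S3)) := {x | ∀ s t : ℂ,
    (x.1.1.2 * P.eval s - x.1.1.1 * Q.eval s) * (∏ i, ((x.2 i).1.2 * t - (x.2 i).1.1)) =
    (x.1.1.2 * P.eval t - x.1.1.1 * Q.eval t) * (∏ i, ((x.2 i).1.2 * s - (x.2 i).1.1))}
  have hRel : IsClosed Rel := by
    simp only [Rel, Set.ofPred_forall]
    refine isClosed_iInter fun s => isClosed_iInter fun t => isClosed_eq ?_ ?_ <;> fun_prop
  have hev : ∀ (v : S3) (s : ℂ), (homP P Q v).eval s = v.1.2 * P.eval s - v.1.1 * Q.eval s := by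
    intro v s; simp [homP]
  have hev2 : ∀ (r : Fin d → S3) (s : ℂ),
      (∏ i, linP (r i)).eval s = ∏ i, ((r i).1.2 * s - (r i).1.1) := by
    intro r s; simp [linP, Polynomial.eval_prod]
  have hne : ∀ (r : Fin d → S3), (∏ i, linP (r i)) ≠ 0 :=
    fun r => Finset.prod_ne_zero_iff.2 fun i _ => linP_ne _
  have hsum : ∀ x ∈ Rel, ((fiber P Q (hopf x.1)).map φ).sum = ∑ i, φ (hopf (x.2 i)) := by
    intro x hx
    have h1 := roots_prop (homP_fiber hc hd x.1).1 (hne x.2)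
      (by intro s t; rw [hev, hev, hev2, hev2]; exact hx s t) d
    have h2 := (fibPoly_prod Finset.univ x.2).2
    rw [hcard] at h2
    rw [← (homP_fiber hc hd x.1).2, h1, h2, Multiset.map_map]
    rfl
  have hex : ∀ z : Sphere, ∃ x ∈ Rel, hopf x.1 = z := by
    intro z
    obtain ⟨v, rfl⟩ := hopf_surj z
    obtain ⟨l, hl⟩ : ∃ l : List Sphere, (l : Multiset Sphere) = fiber P Q (hopf v) :=
      ⟨_, Multiset.coe_toList _⟩
    have hlen : l.length = d := by
      rw [hdd, ← card_fiber (P := P) (Q := Q) (hopf v), ← hl]; simp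
    choose r hr using fun i : Fin d => hopf_surj (l.get (i.cast hlen.symm))
    refine ⟨(v, r), ?_, rfl⟩
    intro s t
    have h2 := (fibPoly_prod Finset.univ r).2
    rw [hcard] at h2
    rw [← hev, ← hev, ← hev2, ← hev2]
    apply prop_of_fib (d := d)
    rw [(homP_fiber hc hd v).2, h2, ← hl]
    simp only [hr]
    rw [Fin.univ_val_map]
    congr 1
    apply List.ext_get
    · simp [hlen]
    · intro n h1 h2
      simp
  rw [continuous_iff_isClosed]
  intro K hK
  have : (fun z => ((fiber P Q z).map φ).sum) ⁻¹' K =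
      (fun x : S3 × (Fin d → S3) => hopf x.1) ''
        (Rel ∩ (fun x => ∑ i, φ (hopf (x.2 i))) ⁻¹' K) := by
    ext z
    simp only [Set.mem_preimage, Set.mem_image, Set.mem_inter_iff]
    constructor
    · intro hz
      obtain ⟨x, hx, rfl⟩ := hex z
      exact ⟨x, ⟨hx, by rw [← hsum x hx]; exact hz⟩, rfl⟩
    · rintro ⟨x, ⟨hx, hxK⟩, rfl⟩
      rw [hsum x hx]; exact hxK
  rw [this]
  have hch := continuous_hopf
  apply IsCompact.isClosed
  apply IsCompact.image _ (by fun_prop)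
  apply IsClosed.isCompact
  exact hRel.inter (hK.preimage (by fun_prop))

theorem isOpenMap_ratEval {P Q : ℂ[X]} (hc : IsCoprime P Q)
    (hd : 1 ≤ max P.natDegree Q.natDegree) : IsOpenMap (ratEval P Q) := by
  intro U hU
  rw [isOpen_iff_mem_nhds]
  rintro _ ⟨ζ, hζ, rfl⟩
  obtain ⟨φ, h1, h2, h3⟩ := exists_continuous_zero_one_of_isClosed (s := Uᶜ) (t := {ζ})
    hU.isClosed_compl isClosed_singleton (by simpa using hζ)
  have hc1 := continuous_fiber_sum hc hd φ.continuous
  have h0 : 0 < ((fiber P Q (ratEval P Q ζ)).map φ).sum := by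
    have hm : ζ ∈ fiber P Q (ratEval P Q ζ) := (mem_fiber hc hd _ _).2 rfl
    have h4 : (1 : ℝ) ∈ (fiber P Q (ratEval P Q ζ)).map φ :=
      Multiset.mem_map.2 ⟨ζ, hm, h2 (by simp)⟩
    have := Multiset.single_le_sum (by
      intro x hx
      obtain ⟨y, _, rfl⟩ := Multiset.mem_map.1 hx
      exact (h3 y).1) _ h4
    linarith
  filter_upwards [hc1.continuousAt.eventually_const_lt h0] with b hb
  by_contra hcon
  have : ((fiber P Q b).map φ).sum = 0 := by
    apply Multiset.sum_eq_zero
    intro x hx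
    obtain ⟨y, hy, rfl⟩ := Multiset.mem_map.1 hx
    apply h1
    intro hyU
    exact hcon ⟨y, hyU, (mem_fiber hc hd _ _).1 hy⟩
  linarith

@[simp] lemma consW_zero (v : Fin N) (w : ℕ → Fin N) : consW v w 0 = v := rfl
@[simp] lemma consW_succ (v : Fin N) (w : ℕ → Fin N) (n : ℕ) : consW v w (n + 1) = w n := rfl
@[simp] lemma shiftW_consW (v : Fin N) (w : ℕ → Fin N) : shiftW (consW v w) = w := rfl
lemma consW_shiftW (w : ℕ → Fin N) : consW (w 0) (shiftW w) = w := by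
  funext n
  cases n <;> rfl

lemma itComp_cons (v : Fin N) (w : ℕ → Fin N) (n : ℕ) :
    itComp p q (consW v w) (n + 1) = itComp p q w n ∘ ratEval (p v) (q v) := by
  induction n with
  | zero => rfl
  | succ n ih => rw [itComp, ih]; rfl

variable {p q} in
lemma fatou_forward (hg : Good p q) (v : Fin N) (w : ℕ → Fin N) (ζ : Sphere)
    (h : ζ ∈ fatouW p q (consW v w)) : ratEval (p v) (q v) ζ ∈ fatouW p q w := by
  obtain ⟨U, hU, hζ, hN⟩ := h
  obtain ⟨K0, hK0, hK0U, hK0c⟩ := local_compact_nhds (hU.mem_nhds hζ)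
  have hop := isOpenMap_ratEval (hg.2.1 v) (hg.2.2.1 v)
  set R := ratEval (p v) (q v) with hR
  refine ⟨interior (R '' K0), isOpen_interior, ?_, ?_⟩
  · rw [mem_interior_iff_mem_nhds]
    exact hop.image_mem_nhds hK0
  · intro s hs
    choose k hk1 hk2 using hs
    obtain ⟨φ, hφ, g, hgg⟩ := hN (fun n => itComp p q (consW v w) (k n + 1))
      (fun n => ⟨k n + 1, by omega, rfl⟩)
    have hsec : ∀ b : Sphere, ∃ a : Sphere, b ∈ R '' K0 → a ∈ K0 ∧ R a = b := by
      intro b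
      by_cases hb : b ∈ R '' K0
      · obtain ⟨a, ha, hab⟩ := hb
        exact ⟨a, fun _ => ⟨ha, hab⟩⟩
      · exact ⟨b, fun h => (hb h).elim⟩
    choose sec hsec using hsec
    refine ⟨φ, hφ, g ∘ sec, ?_⟩
    intro K hK _ ε hε
    filter_upwards [hgg K0 hK0U hK0c ε hε] with n hn z hz
    obtain ⟨h1, h2⟩ := hsec z (interior_subset (hK hz))
    have := hn _ h1
    rw [itComp_cons] at this
    rw [hk2]
    simpa [← hR, h2] using this

variable {p q} in
lemma julia_back (hg : Good p q) (v : Fin N) (w : ℕ → Fin N) (ζ : Sphere)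
    (h : (w, ratEval (p v) (q v) ζ) ∈ juliaSet p q) : (consW v w, ζ) ∈ juliaSet p q := by
  have hop := isOpenMap_ratEval (hg.2.1 v) (hg.2.2.1 v)
  have hcc : Continuous (fun w : ℕ → Fin N => consW v w) := by
    apply continuous_pi
    intro n
    cases n with
    | zero => exact continuous_const
    | succ n => exact continuous_apply n
  rw [juliaSet, mem_closure_iff_nhds] at h ⊢
  intro t ht
  rw [nhds_prod_eq, Filter.mem_prod_iff] at ht
  obtain ⟨A, hA, B, hB, hAB⟩ := ht
  have h1 : (fun w : ℕ → Fin N => consW v w) ⁻¹' A ∈ 𝓝 w := hcc.continuousAt hA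
  have h2 := hop.image_mem_nhds hB
  obtain ⟨⟨w1, z1⟩, ⟨hw1, ζ1, hζ1, hz1⟩, hm⟩ := h _ (prod_mem_nhds h1 h2)
  refine ⟨(consW v w1, ζ1), hAB ⟨hw1, hζ1⟩, ?_⟩
  simp only [Set.mem_iUnion, Set.mem_prod, Set.mem_singleton_iff, exists_eq_left',
    juliaW, Set.mem_compl_iff] at hm ⊢
  intro hcon
  apply hm
  have := fatou_forward hg v w1 ζ1 hcon
  simp only at hz1
  rwa [hz1] at this

lemma mem_preimT (hg : Good p q) (x y : SymX N) : y ∈ preimT p q x ↔ Tmap p q y = x := by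
  simp only [preimT, Multiset.mem_sum, Finset.mem_univ, true_and, Multiset.mem_map]
  constructor
  · rintro ⟨v, z, hz, rfl⟩
    have := (mem_fiber (hg.2.1 v) (hg.2.2.1 v) _ _).1 hz
    simp [Tmap, this]
  · rintro rfl
    refine ⟨y.1 0, y.2, (mem_fiber (hg.2.1 _) (hg.2.2.1 _) _ _).2 rfl, ?_⟩
    simp [Tmap, consW_shiftW]

variable {p q} in
lemma julia_preimT (hg : Good p q) {x y : SymX N} (hx : x ∈ juliaSet p q)
    (hy : y ∈ preimT p q x) : y ∈ juliaSet p q := by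
  rw [mem_preimT p q hg] at hy
  subst hy
  have := julia_back hg (y.1 0) (shiftW y.1) y.2 hx
  rwa [consW_shiftW] at this

variable {p q} in
lemma julia_preimTn (hg : Good p q) {n : ℕ} {x y : SymX N} (hx : x ∈ juliaSet p q)
    (hy : y ∈ preimTn p q n x) : y ∈ juliaSet p q := by
  induction n generalizing x with
  | zero => simp [preimTn] at hy; exact hy ▸ hx
  | succ n ih =>
    simp only [preimTn, Multiset.mem_bind] at hy
    obtain ⟨a, ha, hb⟩ := hy
    exact ih (julia_preimT hg hx ha) hb

variable {p q} in
lemma mem_preimTn (hg : Good p q) {n : ℕ} {x y : SymX N} :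
    y ∈ preimTn p q n x ↔ (Tmap p q)^[n] y = x := by
  induction n generalizing x with
  | zero => simp [preimTn]
  | succ n ih =>
    simp only [preimTn, Multiset.mem_bind, Function.iterate_succ', Function.comp]
    constructor
    · rintro ⟨a, ha, hb⟩
      rw [ih.1 hb, (mem_preimT p q hg _ _).1 ha]
    · intro h
      exact ⟨_, (mem_preimT p q hg _ _).2 h, ih.2 rfl⟩

lemma card_preimT (x : SymX N) : (preimT p q x).card = Dtot p q := by
  simp [preimT, Dtot, degR, card_fiber]

lemma card_preimTn (n : ℕ) (x : SymX N) : (preimTn p q n x).card = (Dtot p q) ^ n := by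
  induction n generalizing x with
  | zero => simp [preimTn]
  | succ n ih =>
    simp [preimTn, Multiset.card_bind, Function.comp_def, ih, card_preimT, pow_succ, mul_comm]

lemma preimTn_add (m n : ℕ) (x : SymX N) :
    preimTn p q (m + n) x = (preimTn p q m x).bind (preimTn p q n) := by
  induction m generalizing x with
  | zero => simp [preimTn]
  | succ m ih =>
    rw [show m + 1 + n = (m + n) + 1 by ring]
    simp only [preimTn]
    rw [Multiset.bind_assoc]
    simp only [ih]

lemma birk_add (F : SymX N → ℝ) (m n : ℕ) (y : SymX N) :
    birk p q F (m + n) y = birk p q F n y + birk p q F m ((Tmap p q)^[n] y) := by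
  rw [add_comm m n, birk, Finset.sum_range_add]
  simp only [birk]
  congr 1
  apply Finset.sum_congr rfl
  intro i _
  rw [← Function.iterate_add_apply, add_comm]

lemma LSum_add (hg : Good p q) (F : SymX N → ℝ) (m n : ℕ) (x : SymX N) :
    LSum p q F (m + n) x =
      ((preimTn p q m x).map fun y => Real.exp (birk p q F m y) * LSum p q F n y).sum := by
  rw [LSum, preimTn_add, Multiset.map_bind, Multiset.sum_bind]
  congr 1
  apply Multiset.map_congr rfl
  intro y _
  rw [LSum, ← Multiset.sum_map_mul_left]
  congr 1
  apply Multiset.map_congr rfl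
  intro z hz
  rw [birk_add, (mem_preimTn hg).1 hz, Real.exp_add, mul_comm]

lemma LSum_succ (hg : Good p q) (F : SymX N → ℝ) (n : ℕ) (x : SymX N) :
    LSum p q F (n + 1) x =
      ((preimT p q x).map fun y => Real.exp (F y) * LSum p q F n y).sum := by
  rw [add_comm, LSum_add p q hg]
  have : preimTn p q 1 x = preimT p q x := by
    simp only [preimTn]
    exact (Multiset.bind_singleton _ _).trans (Multiset.map_id' _)
  rw [this]
  simp [birk]

lemma LSum_zero (F : SymX N → ℝ) (x : SymX N) : LSum p q F 0 x = 1 := by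
  simp [LSum, preimTn, birk]

lemma LSum_nonneg (F : SymX N → ℝ) (n : ℕ) (x : SymX N) : 0 ≤ LSum p q F n x := by
  apply Multiset.sum_nonneg
  intro a ha
  obtain ⟨y, _, rfl⟩ := Multiset.mem_map.1 ha
  exact (Real.exp_pos _).le

lemma exists_preimT (hg : Good p q) (x : SymX N) : ∃ y, y ∈ preimT p q x := by
  apply Multiset.exists_mem_of_ne_zero
  intro h
  have h1 := card_preimT p q x
  rw [h, Multiset.card_zero, Dtot] at h1
  obtain ⟨i, hi⟩ := hg.2.2.2
  have := Finset.sum_eq_zero_iff.1 h1.symm i (Finset.mem_univ _)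
  omega

lemma Dtot_ge (hg : Good p q) : N + 1 ≤ Dtot p q := by
  obtain ⟨i, hi⟩ := hg.2.2.2
  have : ∑ j : Fin N, 1 < ∑ j : Fin N, degR p q j :=
    Finset.sum_lt_sum (fun j _ => hg.2.2.1 j) ⟨i, Finset.mem_univ _, by omega⟩
  simp at this
  exact this

lemma sum_le_card_mul {α : Type*} (s : Multiset α) (g : α → ℝ) (c : ℝ) (h : ∀ a ∈ s, g a ≤ c) :
    (s.map g).sum ≤ s.card * c := by
  induction s using Multiset.induction_on with
  | empty => simp
  | cons a s ih =>
    have h1 := ih fun b hb => h b (Multiset.mem_cons_of_mem hb)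
    have h2 := h a (Multiset.mem_cons_self a s)
    simp only [Multiset.map_cons, Multiset.sum_cons, Multiset.card_cons]
    push_cast
    linarith

lemma le_card_mul {α : Type*} (s : Multiset α) (g : α → ℝ) (c : ℝ) (h : ∀ a ∈ s, c ≤ g a) :
    s.card * c ≤ (s.map g).sum := by
  have := sum_le_card_mul s (fun a => - g a) (-c) (fun a ha => neg_le_neg (h a ha))
  rw [Multiset.sum_map_neg] at this
  linarith

def mult (x : SymX N) : ℕ :=
  (fiber (p (x.1 0)) (q (x.1 0)) (ratEval (p (x.1 0)) (q (x.1 0)) x.2)).count x.2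

def critPts (a : Fin N) : Set Sphere :=
  {ζ | 2 ≤ (fiber (p a) (q a) (ratEval (p a) (q a) ζ)).count ζ}

lemma count_fibPoly_coe (d : ℕ) (G : ℂ[X]) (a : ℂ) :
    (fibPoly d G).count (a : Sphere) = G.rootMultiplicity a := by
  rw [fibPoly, Multiset.count_add, Multiset.count_map_eq_count' _ _ OnePoint.coe_injective,
        Multiset.count_replicate, if_neg (OnePoint.infty_ne_coe a), add_zero, Polynomial.count_roots]

lemma wronskian_root {P Q : ℂ[X]} (hc : IsCoprime P Q) (hd : 1 ≤ max P.natDegree Q.natDegree)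
    (z : ℂ) (h : 2 ≤ (fiber P Q (ratEval P Q (z : Sphere))).count (z : Sphere)) :
    (wronskian P Q).eval z = 0 := by
  have h1 : ratEval P Q (z : Sphere) = ratEval P Q (z : Sphere) := rfl
  generalize hb : ratEval P Q (z : Sphere) = b at h
  induction b using OnePoint.rec with
  | infty =>
    rw [fiber_infty, count_fibPoly_coe] at h
    have h2 := (Polynomial.one_lt_rootMultiplicity_iff_isRoot (Q_ne_zero hc hd)).1 h
    simp only [Polynomial.IsRoot.def] at h2
    simp [wronskian, h2.1, h2.2]
  | coe c =>
    rw [fiber_coe, count_fibPoly_coe] at h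
    have h2 := (Polynomial.one_lt_rootMultiplicity_iff_isRoot (PQ_ne_zero hc hd c)).1 h
    simp only [Polynomial.IsRoot.def, Polynomial.derivative_sub, Polynomial.derivative_C_mul,
      Polynomial.eval_sub, Polynomial.eval_mul, Polynomial.eval_C, sub_eq_zero] at h2
    simp only [wronskian, Polynomial.eval_sub, Polynomial.eval_mul, h2.1, h2.2]
    ring

lemma critPts_finite (hg : Good p q) (a : Fin N) : (critPts p q a).Finite := by
  have hc := hg.2.1 a
  have hd := hg.2.2.1 a
  have hW : wronskian (p a) (q a) ≠ 0 := by
    intro h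
    have h2 := hc.wronskian_eq_zero_iff.1 h
    have h3 := Polynomial.derivative_eq_zero.1 h2.1
    have h4 := Polynomial.derivative_eq_zero.1 h2.2
    simp [degR, h3, h4] at hd
  apply Set.Finite.subset (s := insert OnePoint.infty
    ((fun z : ℂ => (z : Sphere)) '' {z | (wronskian (p a) (q a)).IsRoot z}))
  · exact ((Polynomial.finite_setOfPred_isRoot hW).image _).insert _
  · intro ζ hζ
    induction ζ using OnePoint.rec with
    | infty => exact Set.mem_insert _ _
    | coe z => exact Set.mem_insert_of_mem _ ⟨z, wronskian_root hc hd z hζ, rfl⟩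

def critFin (hg : Good p q) : Finset Sphere :=
  Finset.univ.biUnion fun a => (critPts_finite p q hg a).toFinset

lemma mult_le (x : SymX N) : mult p q x ≤ Dtot p q := by
  refine (Multiset.count_le_card _ _).trans ?_
  rw [card_fiber]
  exact Finset.single_le_sum (f := degR p q) (fun _ _ => Nat.zero_le _) (Finset.mem_univ (x.1 0))

lemma count_preimT (x y : SymX N) (h : Tmap p q y = x) : (preimT p q x).count y = mult p q y := by
  rw [preimT, Multiset.count_sum', Finset.sum_eq_single (y.1 0)]
  · have hx : x.1 = shiftW y.1 := by rw [← h]; rfl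
    have hx2 : x.2 = ratEval (p (y.1 0)) (q (y.1 0)) y.2 := by rw [← h]; rfl
    have : y = (consW (y.1 0) x.1, y.2) := by
      rw [hx, consW_shiftW]
    have inj : Function.Injective (fun z : Sphere => ((consW (y.1 0) x.1, z) : SymX N)) := by
      intro a b hab; exact (Prod.ext_iff.1 hab).2
    have h3 := Multiset.count_map_eq_count' _ (fiber (p (y.1 0)) (q (y.1 0)) x.2) inj y.2
    rw [← this] at h3
    rw [h3, mult, hx2]
  · intro v _ hv
    apply Multiset.count_eq_zero_of_notMem
    intro hm
    obtain ⟨z, _, hz⟩ := Multiset.mem_map.1 hm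
    apply hv
    rw [← hz]; rfl
  · simp

lemma count_preimTn (hg : Good p q) (k : ℕ) (x y : SymX N) (h : (Tmap p q)^[k] y = x) :
    (preimTn p q k x).count y = ∏ i ∈ Finset.range k, mult p q ((Tmap p q)^[i] y) := by
  induction k generalizing x with
  | zero => simp at h; simp [preimTn, h]
  | succ k ih =>
    rw [Function.iterate_succ', Function.comp] at h
    rw [preimTn, Multiset.count_bind, Finset.prod_range_succ, ← ih _ rfl, ← count_preimT p q x _ h]
    have : ∀ s : Multiset (SymX N), (s.map fun b => Multiset.count y (preimTn p q k b)).sum =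
        (preimTn p q k ((Tmap p q)^[k] y)).count y * s.count ((Tmap p q)^[k] y) := by
      intro s
      induction s using Multiset.induction_on with
      | empty => simp
      | cons a s ihs =>
        rw [Multiset.map_cons, Multiset.sum_cons, ihs, Multiset.count_cons]
        split_ifs with hh
        · rw [← hh]; ring
        · rw [Multiset.count_eq_zero_of_notMem]
          · ring
          · intro hm
            exact hh ((mem_preimTn hg).1 hm)
    exact this _

lemma Tmap_iter (l : ℕ) (w : ℕ → Fin N) (z : Sphere) :
    (Tmap p q)^[l] (w, z) = (fun n => w (n + l), itComp p q w l z) := by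
  induction l with
  | zero => rfl
  | succ l ih =>
    rw [Function.iterate_succ', Function.comp, ih]
    simp only [Tmap, shiftW, itComp, Function.comp, zero_add]
    congr 1
    funext n
    change w (n + 1 + l) = w (n + (l + 1))
    congr 1; ring

lemma itComp_congr (l : ℕ) (w w' : ℕ → Fin N) (h : ∀ n < l, w n = w' n) :
    itComp p q w l = itComp p q w' l := by
  induction l with
  | zero => rfl
  | succ l ih => rw [itComp, itComp, ih (fun n hn => h n (by omega)), h l (by omega)]

lemma no_repeat (hg : Good p q) (hA1 : NoSuperAttract p q) (w : ℕ → Fin N) (z : Sphere)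
    (l : ℕ) (hl : 1 ≤ l) (hT : ((Tmap p q)^[l] (w, z)).2 = z)
    (hJ : (Tmap p q)^[l] (w, z) ∈ juliaSet p q) (hm : 2 ≤ mult p q (w, z)) : False := by
  have hit : itComp p q w l z = z := by rw [Tmap_iter] at hT; exact hT
  let c : ℕ → ℕ → Fin N := fun r => Nat.rec (fun n => w (n + l))
    (fun _ c n => if n < l then w n else c (n - l)) r
  have hc0 : c 0 = fun n => w (n + l) := rfl
  have hcs : ∀ r, c (r + 1) = fun n => if n < l then w n else c r (n - l) := fun r => rfl
  have hcJ : ∀ r, (c r, z) ∈ juliaSet p q := by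
    intro r
    induction r with
    | zero => rw [hc0]; rw [Tmap_iter, hit] at hJ; exact hJ
    | succ r ih =>
      apply julia_preimTn hg (n := l) ih
      rw [mem_preimTn hg, Tmap_iter, hcs]
      congr 1
      · funext n; simp
      · rw [← hit]
        conv_rhs => rw [← hit]
        rw [hit, itComp_congr p q l _ w]
        intro n hn; simp [hn]
  have hcw : ∀ r n, n < r * l → c r n = w (n % l) := by
    intro r
    induction r with
    | zero => intro n hn; simp at hn
    | succ r ih =>
      intro n hn
      rw [hcs]
      by_cases h : n < l
      · simp [h, Nat.mod_eq_of_lt h]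
      · simp only [h, if_false]
        rw [ih (n - l) (by rw [add_mul] at hn; omega)]
        congr 1
        exact (Nat.mod_eq_sub_mod (by omega)).symm
  have hlim : Tendsto (fun r => (c r, z)) atTop (𝓝 ((fun n => w (n % l), z) : SymX N)) := by
    apply Tendsto.prodMk_nhds _ tendsto_const_nhds
    rw [tendsto_pi_nhds]
    intro n
    apply tendsto_const_nhds.congr'
    filter_upwards [eventually_gt_atTop n] with r hr
    rw [hcw]
    nlinarith
  have hperJ : ((fun n => w (n % l), z) : SymX N) ∈ juliaSet p q :=
    isClosed_closure.mem_of_tendsto hlim (Eventually.of_forall hcJ)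
  refine hA1 _ hperJ l hl ?_ 0 (by omega) ?_
  · rw [Tmap_iter]
    congr 1
    · funext n; simp
    · rw [itComp_congr p q l _ w, hit]
      intro n hn; simp [Nat.mod_eq_of_lt hn]
  · simpa [critSet, mult] using hm

lemma count_le_K (hg : Good p q) (hA1 : NoSuperAttract p q) (k : ℕ) (x y : SymX N)
    (hx : x ∈ juliaSet p q) :
    (preimTn p q k x).count y ≤ (Dtot p q) ^ (critFin p q hg).card := by
  have hD : 1 ≤ Dtot p q := by have := Dtot_ge p q hg; omega
  by_cases h : (Tmap p q)^[k] y = x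
  swap
  · rw [Multiset.count_eq_zero_of_notMem]
    · exact Nat.zero_le _
    · rwa [mem_preimTn hg]
  rw [count_preimTn p q hg k x y h]
  set Cr := (Finset.range k).filter fun i => 2 ≤ mult p q ((Tmap p q)^[i] y) with hCr
  have hJ : ∀ j ≤ k, (Tmap p q)^[j] y ∈ juliaSet p q := by
    intro j hj
    apply julia_preimTn hg (n := k - j) hx
    rw [mem_preimTn hg, ← Function.iterate_add_apply, Nat.sub_add_cancel hj, h]
  have h1 : ∏ i ∈ Finset.range k, mult p q ((Tmap p q)^[i] y) ≤ Dtot p q ^ Cr.card := by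
    rw [← Finset.prod_filter_mul_prod_filter_not (Finset.range k)
      (fun i => 2 ≤ mult p q ((Tmap p q)^[i] y)), ← hCr]
    calc _ ≤ (Dtot p q ^ Cr.card) * 1 := by
          apply Nat.mul_le_mul
          · exact Finset.prod_le_pow_card _ _ _ fun i _ => mult_le p q _
          · apply Finset.prod_le_one'
            intro i hi
            have := (Finset.mem_filter.1 hi).2
            omega
      _ = _ := mul_one _
  refine h1.trans (Nat.pow_le_pow_right hD ?_)
  apply Finset.card_le_card_of_injOn (fun i => ((Tmap p q)^[i] y).2)
  · intro i hi
    have hi := (Finset.mem_filter.1 (Finset.mem_coe.1 hi)).2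
    simp only [critFin, Finset.coe_biUnion, Set.mem_iUnion, Set.Finite.coe_toFinset]
    exact ⟨((Tmap p q)^[i] y).1 0, by simp, hi⟩
  · have key : ∀ i j, i < j → i ∈ Cr → j ∈ Cr → ((Tmap p q)^[i] y).2 = ((Tmap p q)^[j] y).2 →
        False := by
      intro i j hij hi hj he
      have hi := Finset.mem_filter.1 hi
      have hj := Finset.mem_filter.1 hj
      have e1 : (Tmap p q)^[j - i] ((Tmap p q)^[i] y) = (Tmap p q)^[j] y := by
        rw [← Function.iterate_add_apply, Nat.sub_add_cancel hij.le]
      refine no_repeat p q hg hA1 ((Tmap p q)^[i] y).1 ((Tmap p q)^[i] y).2 (j - i) (by omega) ?_ ?_ hi.2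
      · rw [Prod.mk.eta, e1, he]
      · rw [Prod.mk.eta, e1]
        exact hJ j (Finset.mem_range.1 hj.1).le
    intro i hi j hj he
    rcases lt_trichotomy i j with h' | h' | h'
    · exact (key i j h' hi hj he).elim
    · exact h'
    · exact (key j i h' hj hi he.symm).elim

def KK (hg : Good p q) : ℕ := (Dtot p q) ^ (critFin p q hg).card

lemma card_filter_le (hg : Good p q) (hA1 : NoSuperAttract p q) (F : Finset Sphere) (k : ℕ)
    (x : SymX N) (hx : x ∈ juliaSet p q) :
    ((preimTn p q k x).filter fun y => y.2 ∈ F).card ≤ N ^ k * F.card * KK p q hg := by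
  set s := (preimTn p q k x).filter fun y => y.2 ∈ F with hs
  have h1 : s.card ≤ s.toFinset.card * KK p q hg := by
    rw [← Multiset.toFinset_sum_count_eq, ← smul_eq_mul]
    apply Finset.sum_le_card_nsmul
    intro y _
    exact (Multiset.count_le_of_le _ (Multiset.filter_le _ _)).trans (count_le_K p q hg hA1 k x y hx)
  refine h1.trans (Nat.mul_le_mul_right _ ?_)
  have : N ^ k * F.card = ((Finset.univ : Finset (Fin k → Fin N)) ×ˢ F).card := by simp
  rw [this]
  apply Finset.card_le_card_of_injOn (fun y => (fun i : Fin k => y.1 i, y.2))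
  · intro y hy
    have hy := Finset.mem_coe.1 hy
    rw [Multiset.mem_toFinset, hs, Multiset.mem_filter] at hy
    simpa using hy.2
  · intro y hy y' hy' he
    have hy := Finset.mem_coe.1 hy
    have hy' := Finset.mem_coe.1 hy'
    rw [Multiset.mem_toFinset, hs, Multiset.mem_filter, mem_preimTn hg, ← Prod.mk.eta (p := y), Tmap_iter] at hy
    rw [Multiset.mem_toFinset, hs, Multiset.mem_filter, mem_preimTn hg, ← Prod.mk.eta (p := y'), Tmap_iter] at hy'
    have e1 := congrArg Prod.fst hy.1
    have e2 := congrArg Prod.fst hy'.1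
    simp only [Prod.mk.injEq] at he
    refine Prod.ext ?_ he.2
    funext n
    by_cases hn : n < k
    · exact congrFun he.1 ⟨n, hn⟩
    · have := congrFun (e1.trans e2.symm) (n - k)
      simpa [Nat.sub_add_cancel (not_lt.1 hn)] using this

def avgA (φ : Sphere → ℝ) : ℕ → Sphere → ℝ
  | 0 => φ
  | k + 1 => fun z => ∑ v, ((fiber (p v) (q v) z).map (avgA φ k)).sum

lemma avgA_cont (hg : Good p q) {φ : Sphere → ℝ} (hφ : Continuous φ) (k : ℕ) :
    Continuous (avgA p q φ k) := by
  induction k with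
  | zero => exact hφ
  | succ k ih =>
    exact continuous_finsetSum _ fun v _ => continuous_fiber_sum (hg.2.1 v) (hg.2.2.1 v) ih

lemma avgA_eq (φ : Sphere → ℝ) (k : ℕ) (x : SymX N) :
    avgA p q φ k x.2 = ((preimTn p q k x).map fun y => φ y.2).sum := by
  induction k generalizing x with
  | zero => simp [preimTn, avgA]
  | succ k ih =>
    rw [preimTn, Multiset.map_bind, Multiset.sum_bind, avgA, preimT]
    simp only [← ih]
    rw [show (Multiset.map (fun a : SymX N => avgA p q φ k a.2)
      (∑ v : Fin N, Multiset.map (fun z => (consW v x.1, z)) (fiber (p v) (q v) x.2))).sum =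
      (Multiset.sumAddMonoidHom.comp (Multiset.mapAddMonoidHom (fun a : SymX N => avgA p q φ k a.2)))
        (∑ v : Fin N, Multiset.map (fun z => (consW v x.1, z)) (fiber (p v) (q v) x.2)) from rfl, map_sum]
    apply Finset.sum_congr rfl
    intro v _
    simp [Multiset.map_map, Function.comp_def]

lemma exists_O (hg : Good p q) (hA1 : NoSuperAttract p q) (F : Finset Sphere) (k : ℕ) :
    ∃ O : Set Sphere, IsOpen O ∧ (∀ z ∈ F, z ∈ O) ∧ ∀ x ∈ juliaSet p q,
      ((preimTn p q k x).filter fun y => y.2 ∈ O).card ≤ N ^ k * F.card * KK p q hg := by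
  set Mx := N ^ k * F.card * KK p q hg with hMx
  have hcomp : IsCompact (Prod.snd '' juliaSet p q) :=
    (isClosed_closure.isCompact).image continuous_snd
  have hcard : ∀ (x : SymX N) (O : Set Sphere) (φ : Sphere → ℝ), (∀ z, 0 ≤ φ z) →
      (∀ z ∈ O, φ z = 1) → (((preimTn p q k x).filter fun y => y.2 ∈ O).card : ℝ) ≤
        avgA p q φ k x.2 := by
    intro x O φ h0 h1
    rw [avgA_eq]
    generalize preimTn p q k x = s
    induction s using Multiset.induction_on with
    | empty => simp
    | cons a s ih =>
      rw [Multiset.map_cons, Multiset.sum_cons, Multiset.filter_cons]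
      split_ifs with h
      · rw [Multiset.card_add, Multiset.card_singleton, h1 _ h]; push_cast; linarith
      · rw [zero_add]; linarith [h0 a.2]
  have hloc : ∀ z ∈ Prod.snd '' juliaSet p q, ∃ O : Set Sphere, IsOpen O ∧ (∀ z ∈ F, z ∈ O) ∧
      ∃ U ∈ 𝓝 z, ∀ x : SymX N, x.2 ∈ U →
        ((preimTn p q k x).filter fun y => y.2 ∈ O).card ≤ Mx := by
    rintro _ ⟨x0, hx0, rfl⟩
    set Z : Set Sphere := {z | z ∉ F ∧ ∃ y ∈ preimTn p q k x0, y.2 = z} with hZ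
    have hZf : Z.Finite := by
      apply ((preimTn p q k x0).toFinset.image Prod.snd).finite_toSet.subset
      rintro z ⟨_, y, hy, rfl⟩
      simp only [Finset.coe_image, Set.mem_image, Finset.mem_coe, Multiset.mem_toFinset]
      exact ⟨y, hy, rfl⟩
    have hFc : IsClosed (F : Set Sphere) := F.finite_toSet.isClosed
    obtain ⟨O, hO, hFO, hOZ⟩ := normal_exists_closure_subset hFc hZf.isClosed.isOpen_compl
      (by intro z hz hz'; exact hz'.1 hz)
    obtain ⟨φ, h1, h2, h3⟩ := exists_continuous_zero_one_of_isClosed (s := Z) (t := closure O)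
      hZf.isClosed isClosed_closure (by
        rw [Set.disjoint_left]; intro z hz hz'; exact hOZ hz' hz)
    refine ⟨O, hO, fun z hz => hFO hz, {z | avgA p q φ k z < Mx + 1}, ?_, ?_⟩
    · apply (avgA_cont p q hg φ.continuous k).continuousAt.eventually_lt_const
      have h4 : avgA p q φ k x0.2 ≤ (((preimTn p q k x0).filter fun y => y.2 ∈ F).card : ℝ) := by
        rw [avgA_eq]
        have : ∀ s : Multiset (SymX N), (∀ y ∈ s, y ∈ preimTn p q k x0) →
            (s.map fun y => φ y.2).sum ≤ ((s.filter fun y => y.2 ∈ F).card : ℝ) := by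
          intro s
          induction s using Multiset.induction_on with
          | empty => simp
          | cons a s ih =>
            intro hs
            have ih := ih fun y hy => hs y (Multiset.mem_cons_of_mem hy)
            have ha := hs a (Multiset.mem_cons_self _ _)
            rw [Multiset.map_cons, Multiset.sum_cons, Multiset.filter_cons]
            split_ifs with h
            · rw [Multiset.card_add, Multiset.card_singleton]; push_cast; linarith [(h3 a.2).2]
            · rw [zero_add, h1 ⟨h, a, ha, rfl⟩]; simpa using ih
        exact this _ fun _ h => h
      have h5 := card_filter_le p q hg hA1 F k x0 hx0
      have h6 : (((preimTn p q k x0).filter fun y => y.2 ∈ F).card : ℝ) ≤ Mx := by exact_mod_cast h5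
      linarith
    · intro x hx
      have := hcard x O φ (fun z => (h3 z).1) (fun z hz => h2 (subset_closure hz))
      have h7 : (((preimTn p q k x).filter fun y => y.2 ∈ O).card : ℝ) < Mx + 1 := this.trans_lt hx
      have h8 : ((preimTn p q k x).filter fun y => y.2 ∈ O).card < Mx + 1 := by exact_mod_cast h7
      omega
  choose! O hO hFO U hU hUc using hloc
  obtain ⟨t, ht, htc⟩ := hcomp.elim_nhds_subcover U hU
  refine ⟨⋂ z ∈ t, O z, isOpen_biInter_finset fun z hz => hO z (ht z hz), ?_, ?_⟩
  · intro z hz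
    simp only [Set.mem_iInter]
    exact fun z' hz' => hFO z' (ht z' hz') z hz
  · intro x hx
    have := htc ⟨x, hx, rfl⟩
    simp only [Set.mem_iUnion] at this
    obtain ⟨z, hz, hxz⟩ := this
    refine le_trans ?_ (hUc z (ht z hz) x hxz)
    apply Multiset.card_le_card
    apply Multiset.monotone_filter_right
    intro y hy
    simp only [Set.mem_iInter] at hy
    exact hy z hz

lemma continuous_ratEval {P Q : ℂ[X]} (hc : IsCoprime P Q)
    (hd : 1 ≤ max P.natDegree Q.natDegree) : Continuous (ratEval P Q) := by
  rw [continuous_iff_isClosed]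
  intro K hK
  rw [← isOpen_compl_iff, isOpen_iff_mem_nhds]
  intro ζ hζ
  have hloc : ∀ b ∈ K, ∃ U ∈ 𝓝 b, ∃ W ∈ 𝓝 ζ, ∀ z ∈ W, ratEval P Q z ∉ U := by
    intro b hb
    have hZf : {z | z ∈ fiber P Q b}.Finite := by
      apply (fiber P Q b).toFinset.finite_toSet.subset
      intro z hz; simpa using hz
    have hζb : ζ ∉ {z | z ∈ fiber P Q b} := by
      intro h
      have := (mem_fiber hc hd _ _).1 h
      apply hζ; rw [Set.mem_preimage, this]; exact hb
    obtain ⟨φ, h1, h2, h3⟩ := exists_continuous_zero_one_of_isClosed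
      (s := {z | z ∈ fiber P Q b}) (t := {ζ})
      hZf.isClosed isClosed_singleton (by simpa using hζb)
    have hc1 := continuous_fiber_sum hc hd φ.continuous
    refine ⟨{b | ((fiber P Q b).map φ).sum < 1/2}, ?_, {z | 1/2 < φ z}, ?_, ?_⟩
    · apply hc1.continuousAt.eventually_lt_const
      have : ((fiber P Q b).map φ).sum = 0 := by
        apply Multiset.sum_eq_zero
        intro x hx
        obtain ⟨y, hy, rfl⟩ := Multiset.mem_map.1 hx
        exact h1 hy
      change ((fiber P Q b).map φ).sum < 1/2
      rw [this]; norm_num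
    · apply φ.continuous.continuousAt.eventually_const_lt
      rw [h2 (by simp)]; norm_num
    · intro z hz hz'
      have hm : z ∈ fiber P Q (ratEval P Q z) := (mem_fiber hc hd _ _).2 rfl
      have h4 : φ z ∈ (fiber P Q (ratEval P Q z)).map φ := Multiset.mem_map.2 ⟨z, hm, rfl⟩
      have := Multiset.single_le_sum (by
        intro x hx
        obtain ⟨y, _, rfl⟩ := Multiset.mem_map.1 hx
        exact (h3 y).1) _ h4
      have h5 : 1/2 < φ z := hz
      have h6 : ((fiber P Q (ratEval P Q z)).map φ).sum < 1/2 := hz'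
      linarith
  choose! U hU W hW hUW using hloc
  obtain ⟨t, ht, htc⟩ := hK.isCompact.elim_nhds_subcover U hU
  have : ⋂ b ∈ t, W b ∈ 𝓝 ζ := (Filter.biInter_finset_mem t).2 fun b hb => hW b (ht b hb)
  filter_upwards [this] with z hz hzK
  have := htc hzK
  simp only [Set.mem_iUnion] at this
  obtain ⟨b, hb, hzb⟩ := this
  exact hUW b (ht b hb) z (Set.mem_iInter₂.1 hz b hb) hzb

def Vset : Set Sphere :=
  ⋃ a, ratEval (p a) (q a) '' (critPts p q a ∪
      {((0 : ℂ) : Sphere), ((1 : ℂ) : Sphere), ((2 : ℂ) : Sphere), OnePoint.infty})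

lemma Vset_finite (hg : Good p q) : (Vset p q).Finite := by
  apply Set.finite_iUnion
  intro a
  apply Set.Finite.image
  exact (critPts_finite p q hg a).union (by simp)

lemma hasStrictDerivAt_quot {P Q : ℂ[X]} (z : ℂ) (hz : Q.eval z ≠ 0) :
    HasStrictDerivAt (fun x => P.eval x / Q.eval x)
      (-(wronskian P Q).eval z / (Q.eval z) ^ 2) z := by
  have := (P.hasStrictDerivAt z).fun_div (Q.hasStrictDerivAt z) hz
  refine this.congr_deriv ?_
  rw [Polynomial.wronskian, Polynomial.eval_sub, Polynomial.eval_mul, Polynomial.eval_mul]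
  congr 1
  ring

lemma wronskian_ne {P Q : ℂ[X]} (hc : IsCoprime P Q) (hd : 1 ≤ max P.natDegree Q.natDegree)
    (z : ℂ) (hz : Q.eval z ≠ 0)
    (h : ¬ 2 ≤ (fiber P Q (ratEval P Q (z : Sphere))).count (z : Sphere)) :
    (wronskian P Q).eval z ≠ 0 := by
  contrapose! h
  rw [ratEval_coe, if_neg hz, fiber_coe, count_fibPoly_coe]
  apply (Polynomial.one_lt_rootMultiplicity_iff_isRoot (PQ_ne_zero hc hd _)).2
  simp only [wronskian, Polynomial.eval_sub, Polynomial.eval_mul] at h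
  simp only [Polynomial.IsRoot.def, Polynomial.derivative_sub, Polynomial.derivative_C_mul,
      Polynomial.eval_sub, Polynomial.eval_mul, Polynomial.eval_C, sub_eq_zero]
  constructor <;> field_simp
  linear_combination -h

lemma covering_ratEval {P Q : ℂ[X]} (hc : IsCoprime P Q)
    (hd : 1 ≤ max P.natDegree Q.natDegree) (s : Set Sphere)
    (hs1 : ∀ ζ, ratEval P Q ζ ∈ s → ∃ z : ℂ, ζ = z ∧ Q.eval z ≠ 0 ∧ (wronskian P Q).eval z ≠ 0) :
    IsCoveringMapOn (ratEval P Q) s := by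
  apply IsCoveringMapOn.of_isLocalHomeomorphOn (continuous_ratEval hc hd)
  apply IsLocalHomeomorphOn.mk
  intro ζ hζ
  obtain ⟨z, rfl, hQ, hW⟩ := hs1 ζ hζ
  have hsd := (hasStrictDerivAt_quot (P := P) z hQ).hasStrictFDerivAt_equiv
    (div_ne_zero (neg_ne_zero.2 hW) (pow_ne_zero 2 hQ))
  let φ := hsd.toOpenPartialHomeomorph
  have hφ : ∀ x, φ x = P.eval x / Q.eval x := fun x => rfl
  have ho : IsOpen {x : ℂ | Q.eval x ≠ 0} := isOpen_ne_fun Q.continuous continuous_const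
  let e1 : OpenPartialHomeomorph ℂ Sphere :=
    OnePoint.isOpenEmbedding_coe.toOpenPartialHomeomorph (OnePoint.some : ℂ → Sphere)
  have he1 : ∀ x : ℂ, e1 x = (x : Sphere) := fun x => rfl
  have he1s : ∀ x : ℂ, e1.symm (x : Sphere) = x := fun x => by
    rw [← he1]; exact e1.left_inv (by simp [e1])
  refine ⟨(e1.symm.trans (φ.restrOpen _ ho)).trans e1, ?_, ?_⟩
  · have hz := hsd.mem_toOpenPartialHomeomorph_source
    simp only [OpenPartialHomeomorph.trans_source, Set.mem_inter_iff, Set.mem_preimage,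
      OpenPartialHomeomorph.restrOpen_source, he1s]
    refine ⟨⟨?_, ?_⟩, ?_⟩
    · simp [e1]
    · exact ⟨hz, hQ⟩
    · simp [e1]
  · intro x hx
    simp only [OpenPartialHomeomorph.trans_source, Set.mem_inter_iff, Set.mem_preimage,
      OpenPartialHomeomorph.restrOpen_source] at hx
    obtain ⟨⟨h1, h2, h3⟩, h4⟩ := hx
    have h1' : x ∈ e1.target := h1
    obtain ⟨y, rfl⟩ : ∃ y : ℂ, x = (y : Sphere) := by
      refine ⟨e1.symm x, ?_⟩
      rw [← he1, e1.right_inv h1']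
    rw [he1s] at h3
    simp only [OpenPartialHomeomorph.coe_trans, Function.comp, he1s, he1]
    rw [ratEval_coe, if_neg h3]
    rfl

lemma exists_lifts (hg : Good p q) (a : Fin N) {Ω : Set ℂ} (hΩ : IsOpen Ω) (hΩc : Convex ℝ Ω)
    (hΩn : Ω.Nonempty) (b : ℂ → ℂ) (hb : DifferentiableOn ℂ b Ω)
    (hbV : ∀ t ∈ Ω, (b t : Sphere) ∉ Vset p q) :
    ∃ L : Finset (ℂ → ℂ), (∀ g ∈ L, DifferentiableOn ℂ g Ω ∧ ∀ t ∈ Ω, g t ≠ 0 ∧ g t ≠ 1 ∧ g t ≠ 2) ∧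
      ∀ t ∈ Ω, fiber (p a) (q a) (b t) = L.val.map (fun g => (g t : Sphere)) ∧
        (fiber (p a) (q a) (b t)).Nodup := by
  have hc := hg.2.1 a
  have hd := hg.2.2.1 a
  set P := p a
  set Q := q a
  have hpre : ∀ ζ, ∀ t ∈ Ω, ratEval P Q ζ = b t → ζ ∉ critPts p q a ∧ ∃ z : ℂ, ζ = z ∧
      (z ≠ 0 ∧ z ≠ 1 ∧ z ≠ 2) ∧ Q.eval z ≠ 0 ∧ (wronskian P Q).eval z ≠ 0 := by
    intro ζ t ht he
    have h1 : ∀ x ∈ critPts p q a ∪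
      {((0 : ℂ) : Sphere), ((1 : ℂ) : Sphere), ((2 : ℂ) : Sphere), OnePoint.infty}, ζ ≠ x := by
      rintro x hx rfl
      apply hbV t ht
      rw [← he]
      exact Set.mem_iUnion.2 ⟨a, _, hx, rfl⟩
    have h2 : ζ ∉ critPts p q a := fun h => h1 ζ (Or.inl h) rfl
    refine ⟨h2, ?_⟩
    induction ζ using OnePoint.rec with
    | infty => exact (h1 OnePoint.infty (by simp) rfl).elim
    | coe z =>
      have hQ : Q.eval z ≠ 0 := by
        intro h
        rw [ratEval_coe, if_pos h] at he
        exact OnePoint.infty_ne_coe _ he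
      refine ⟨z, rfl, ⟨?_, ?_, ?_⟩, hQ, wronskian_ne hc hd z hQ h2⟩
      all_goals
        rintro rfl
        exact h1 _ (by simp) rfl
  have hnd : ∀ t ∈ Ω, (fiber P Q (b t)).Nodup := by
    intro t ht
    rw [Multiset.nodup_iff_count_le_one]
    intro ζ
    by_cases hm : ζ ∈ fiber P Q (b t)
    · have he := (mem_fiber hc hd _ _).1 hm
      have h := (hpre ζ t ht he).1
      rw [← he]
      by_contra hh
      exact h (not_le.1 hh)
    · rw [Multiset.count_eq_zero_of_notMem hm]; omega
  have cov := covering_ratEval hc hd ((fun t => (b t : Sphere)) '' Ω) (by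
    rintro ζ ⟨t, ht, he⟩
    obtain ⟨_, z, h1, _, h2⟩ := hpre ζ t ht he.symm
    exact ⟨z, h1, h2⟩)
  obtain ⟨t0, ht0⟩ := hΩn
  have : ContractibleSpace Ω := hΩc.contractibleSpace ⟨t0, ht0⟩
  have : LocallyPathConnectedSpace Ω := hΩ.locallyPathConnectedSpace
  let bb : C(Ω, Sphere) := ⟨fun t => (b t : Sphere),
    OnePoint.continuous_coe.comp (continuousOn_iff_continuous_domRestrict.1 hb.continuousOn)⟩
  have hbb : ∀ t : Ω, bb t = (b t : Sphere) := fun t => rfl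
  have hlift : ∀ ζ ∈ fiber P Q (b t0), ∃ F : C(Ω, Sphere), F ⟨t0, ht0⟩ = ζ ∧
      ratEval P Q ∘ F = bb := by
    intro ζ hζ
    exact (cov.existsUnique_continuousMap_lifts bb (a₀ := ⟨t0, ht0⟩) (e₀ := ζ)
      ((mem_fiber hc hd _ _).1 hζ) (fun t => ⟨t, t.2, rfl⟩)).exists
  have huniq : ∀ F F' : C(Ω, Sphere), ratEval P Q ∘ F = bb → ratEval P Q ∘ F' = bb →
      ∀ t : Ω, F t = F' t → F = F' := by
    intro F F' h1 h2 t ht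
    exact (cov.existsUnique_continuousMap_lifts bb (a₀ := t) (e₀ := F t)
      (congrFun h1 t) (fun t => ⟨t, t.2, rfl⟩)).unique ⟨rfl, h1⟩ ⟨ht.symm, h2⟩
  choose! F hF0 hF using hlift
  have hG : ∀ ζ ∈ fiber P Q (b t0), ∃ g : ℂ → ℂ, ∀ t : Ω, F ζ t = (g t : Sphere) := by
    intro ζ hζ
    have : ∀ t : ℂ, ∃ z : ℂ, ∀ h : t ∈ Ω, F ζ ⟨t, h⟩ = (z : Sphere) := by
      intro t
      by_cases ht : t ∈ Ω
      · obtain ⟨_, z, hz, _⟩ := hpre _ t ht (congrFun (hF ζ hζ) ⟨t, ht⟩)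
        exact ⟨z, fun _ => hz⟩
      · exact ⟨0, fun h => (ht h).elim⟩
    choose g hg using this
    exact ⟨g, fun t => hg t.1 t.2⟩
  choose! G hG using hG
  have hinj : ∀ ζ ∈ fiber P Q (b t0), ∀ ζ' ∈ fiber P Q (b t0), ∀ t ∈ Ω, G ζ t = G ζ' t → ζ = ζ' := by
    intro ζ hζ ζ' hζ' t ht he
    have := huniq _ _ (hF ζ hζ) (hF ζ' hζ') ⟨t, ht⟩ (by rw [hG ζ hζ, hG ζ' hζ', he])
    rw [← hF0 ζ hζ, ← hF0 ζ' hζ', this]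
  have hRG : ∀ ζ ∈ fiber P Q (b t0), ∀ t ∈ Ω, ratEval P Q (G ζ t : Sphere) = b t := by
    intro ζ hζ t ht
    have := congrFun (hF ζ hζ) ⟨t, ht⟩
    rw [Function.comp, hG ζ hζ] at this
    exact this
  refine ⟨(fiber P Q (b t0)).toFinset.image G, ?_, ?_⟩
  · intro g hg
    obtain ⟨ζ, hζ, rfl⟩ := Finset.mem_image.1 hg
    rw [Multiset.mem_toFinset] at hζ
    have hcont : ContinuousOn (G ζ) Ω := by
      rw [continuousOn_iff_continuous_domRestrict, OnePoint.isOpenEmbedding_coe.isEmbedding.continuous_iff]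
      have : (OnePoint.some ∘ Ω.domRestrict (G ζ)) = F ζ := by
        funext t; exact (hG ζ hζ t).symm
      rw [this]
      exact (F ζ).continuous
    have hprop : ∀ t ∈ Ω, (G ζ t ≠ 0 ∧ G ζ t ≠ 1 ∧ G ζ t ≠ 2) ∧ Q.eval (G ζ t) ≠ 0 ∧ (wronskian P Q).eval (G ζ t) ≠ 0 := by
      intro t ht
      obtain ⟨_, z, hz, h⟩ := hpre _ t ht (hRG ζ hζ t ht)
      rw [OnePoint.coe_eq_coe] at hz
      rw [hz]; exact h
    refine ⟨?_, fun t ht => (hprop t ht).1⟩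
    intro t ht
    obtain ⟨_, hQ, hW⟩ := hprop t ht
    have hne := (div_ne_zero (neg_ne_zero.2 hW) (pow_ne_zero 2 hQ))
    have hsd := (hasStrictDerivAt_quot (P := P) _ hQ)
    have hli := hsd.to_localInverse hne
    have hev := (hsd.hasStrictFDerivAt_equiv hne).eventually_left_inverse
    have hca : ContinuousAt (G ζ) t := hcont.continuousAt (hΩ.mem_nhds ht)
    have hval : ∀ s ∈ Ω, P.eval (G ζ s) / Q.eval (G ζ s) = b s := by
      intro s hs
      have := hRG ζ hζ s hs
      rw [ratEval_coe, if_neg (hprop s hs).2.1, OnePoint.coe_eq_coe] at this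
      exact this
    have hbt : DifferentiableAt ℂ b t := hb.differentiableAt (hΩ.mem_nhds ht)
    rw [hval t ht] at hli
    have hcomp := (hli.hasDerivAt.differentiableAt).comp t hbt
    refine (hcomp.congr_of_eventuallyEq ?_).differentiableWithinAt
    filter_upwards [hca.eventually hev, hΩ.mem_nhds ht] with s hs hsΩ
    rw [hval s hsΩ] at hs
    exact hs.symm
  · intro t ht
    refine ⟨?_, hnd t ht⟩
    symm
    apply Multiset.eq_of_le_of_card_le
    · rw [Multiset.le_iff_subset]
      · intro x hx
        obtain ⟨g, hg, rfl⟩ := Multiset.mem_map.1 hx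
        obtain ⟨ζ, hζ, rfl⟩ := Finset.mem_image.1 hg
        rw [Multiset.mem_toFinset] at hζ
        exact (mem_fiber hc hd _ _).2 (hRG ζ hζ t ht)
      · apply Multiset.Nodup.map_on _ (Finset.nodup _)
        intro g hg g' hg' he
        obtain ⟨ζ, hζ, rfl⟩ := Finset.mem_image.1 hg
        obtain ⟨ζ', hζ', rfl⟩ := Finset.mem_image.1 hg'
        rw [Multiset.mem_toFinset] at hζ hζ'
        rw [hinj ζ hζ ζ' hζ' t ht (OnePoint.coe_injective he)]
    · rw [Multiset.card_map, card_fiber, Finset.card_val, Finset.card_image_of_injOn,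
        Multiset.toFinset_card_of_nodup (hnd t0 ht0), card_fiber]
      intro ζ hζ ζ' hζ' he
      have hζ : ζ ∈ fiber P Q (b t0) := by simpa using hζ
      have hζ' : ζ' ∈ fiber P Q (b t0) := by simpa using hζ'
      exact hinj ζ hζ ζ' hζ' t0 ht0 (congrFun he t0)

open Metric Real in
lemma mean_area {G : ℂ → ℂ} {c : ℂ} {r : ℝ} (hr : 0 < r) (hG : DifferentiableOn ℂ G (ball c r)) :
    ENNReal.ofReal (2 * π * (r ^ 2 / 4)) * ‖G c‖ₑ ≤ ∫⁻ z in ball c r, ‖G z‖ₑ := by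
  have hcirc : ∀ ρ ∈ Set.Ioo (0:ℝ) r, ENNReal.ofReal (2 * π) * ‖G c‖ₑ ≤
      ∫⁻ θ in Set.Ioo (-π) π, ‖G (circleMap c ρ θ)‖ₑ := by
    intro ρ hρ
    have hsub : closedBall c |ρ| ⊆ ball c r := by
      rw [abs_of_pos hρ.1]; exact closedBall_subset_ball hρ.2
    have h1 : Real.circleAverage G c ρ = G c := by
      apply circleAverage_of_differentiable_on_off_countable Set.countable_empty
      · exact hG.continuousOn.mono hsub
      · intro z hz
        exact hG.differentiableAt (isOpen_ball.mem_nhds (hsub (ball_subset_closedBall hz.1)))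
    have h2 : (∫ θ in (-π)..π, G (circleMap c ρ θ)) = (2 * π : ℝ) • G c := by
      rw [← h1, Real.circleAverage_def, smul_smul, mul_inv_cancel₀ (by positivity), one_smul]
      have hp : Function.Periodic (fun θ => G (circleMap c ρ θ)) (2 * π) := by
        intro θ; simp only [periodic_circleMap c ρ θ]
      have := hp.intervalIntegral_add_eq (-π) 0
      rw [show -π + 2 * π = π by ring, zero_add] at this
      exact this
    rw [intervalIntegral.integral_of_le (by linarith [pi_pos])] at h2
    have h3 : ENNReal.ofReal (2 * π) * ‖G c‖ₑ = ‖(2 * π : ℝ) • G c‖ₑ := by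
      rw [enorm_smul, Real.enorm_eq_ofReal (by positivity)]
    rw [h3, ← h2, setLIntegral_congr Ioo_ae_eq_Ioc]
    exact enorm_integral_le_lintegral_enorm _
  have e1 : ∫⁻ z in ball c r, ‖G z‖ₑ = ∫⁻ z, (ball c r).indicator (fun z => ‖G z‖ₑ) (c + z) := by
    rw [← lintegral_indicator measurableSet_ball]
    exact (lintegral_add_left_eq_self _ c).symm
  rw [e1, ← Complex.lintegral_comp_polarCoord_symm]
  have hsub : Set.Ioo (0:ℝ) r ×ˢ Set.Ioo (-π) π ⊆ polarCoord.target := by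
    rw [polarCoord_target]
    exact Set.prod_mono (fun x hx => hx.1) le_rfl
  refine le_trans ?_ (lintegral_mono_set hsub)
  have hcm : ∀ x : ℝ × ℝ, c + Complex.polarCoord.symm x = circleMap c x.1 x.2 := by
    intro x
    rw [Complex.polarCoord_symm_apply, circleMap, Complex.exp_mul_I]
    simp
  have e2 : ∫⁻ x in Set.Ioo (0:ℝ) r ×ˢ Set.Ioo (-π) π, ENNReal.ofReal x.1 •
      (ball c r).indicator (fun z => ‖G z‖ₑ) (c + Complex.polarCoord.symm x) =
      ∫⁻ x in Set.Ioo (0:ℝ) r ×ˢ Set.Ioo (-π) π, ENNReal.ofReal x.1 *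
        ‖G (circleMap c x.1 x.2)‖ₑ := by
    apply setLIntegral_congr_fun (measurableSet_Ioo.prod measurableSet_Ioo)
    intro x hx
    simp only [hcm, smul_eq_mul]
    rw [Set.indicator_of_mem]
    rw [mem_ball, dist_eq_norm, circleMap_sub_center, norm_circleMap_zero, abs_of_pos hx.1.1]
    exact hx.1.2
  rw [e2, Measure.volume_eq_prod, ← Measure.prod_restrict, lintegral_prod]
  · have : ENNReal.ofReal (2 * π * (r ^ 2 / 4)) * ‖G c‖ₑ ≤
        ∫⁻ ρ in Set.Ioo (r/2) r, ENNReal.ofReal (r/2) * (ENNReal.ofReal (2 * π) * ‖G c‖ₑ) := by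
      rw [setLIntegral_const, Real.volume_Ioo]
      rw [← mul_assoc, ← ENNReal.ofReal_mul (by positivity),
        mul_right_comm (ENNReal.ofReal _) ‖G c‖ₑ, ← ENNReal.ofReal_mul (by positivity)]
      apply le_of_eq; congr 2; ring
    refine this.trans ?_
    refine le_trans ?_ (lintegral_mono_set (Set.Ioo_subset_Ioo_left (by linarith : (0:ℝ) ≤ r/2)))
    apply setLIntegral_mono' measurableSet_Ioo
    intro ρ hρ
    have hρ' : ρ ∈ Set.Ioo 0 r := ⟨by linarith [hρ.1], hρ.2⟩
    change _ ≤ ∫⁻ y in Set.Ioo (-π) π, ENNReal.ofReal ρ * ‖G (circleMap c ρ y)‖ₑ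
    rw [lintegral_const_mul']
    · gcongr
      · exact hρ.1.le
      · exact hcirc ρ hρ'
    · exact ENNReal.ofReal_ne_top
  · rw [Measure.prod_restrict]
    have hco : ContinuousOn (fun x : ℝ × ℝ => G (circleMap c x.1 x.2))
        (Set.Ioo (0:ℝ) r ×ˢ Set.Ioo (-π) π) := by
      apply hG.continuousOn.comp
      · unfold circleMap; fun_prop
      · intro x hx
        rw [mem_ball, dist_eq_norm, circleMap_sub_center, norm_circleMap_zero, abs_of_pos hx.1.1]
        exact hx.1.2
    have := (hco.aemeasurable (μ := Measure.prod volume volume)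
      (measurableSet_Ioo.prod measurableSet_Ioo)).enorm
    exact (by fun_prop : Measurable fun x : ℝ × ℝ => ENNReal.ofReal x.1).aemeasurable.mul this

open Metric Real in
lemma finite_area : ∫⁻ z : ℂ, ENNReal.ofReal (‖z * (z - 1) * (z - 2)‖⁻¹) < ⊤ := by
  have h0 : ∫⁻ z : ℂ, ENNReal.ofReal (5 * (‖z‖ * (1 + ‖z‖ ^ 2))⁻¹) < ⊤ := by
    rw [← Complex.lintegral_comp_polarCoord_symm]
    have : ∀ x ∈ polarCoord.target, ENNReal.ofReal x.1 •
        ENNReal.ofReal (5 * (‖Complex.polarCoord.symm x‖ *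
          (1 + ‖Complex.polarCoord.symm x‖ ^ 2))⁻¹) =
        ENNReal.ofReal (5 * (1 + x.1 ^ 2)⁻¹) * 1 := by
      intro x hx
      have hx0 : 0 < x.1 := hx.1
      rw [Complex.norm_polarCoord_symm, abs_of_pos hx0, smul_eq_mul, mul_one,
        ← ENNReal.ofReal_mul hx0.le]
      congr 1
      field_simp
    rw [setLIntegral_congr_fun polarCoord.open_target.measurableSet this, polarCoord_target,
      Measure.volume_eq_prod, ← Measure.prod_restrict, lintegral_prod_mul (f := fun x : ℝ => ENNReal.ofReal (5 * (1 + x ^ 2)⁻¹))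
        (g := fun _ : ℝ => 1) (by fun_prop) (by fun_prop)]
    apply ENNReal.mul_lt_top
    · have := ((integrable_inv_one_add_sq.const_mul 5).restrict (s := Set.Ioi 0))
      exact this.lintegral_lt_top
    · simp
  have hj : ∀ j : ℂ, ∫⁻ z : ℂ, ENNReal.ofReal (5 * (‖z - j‖ * (1 + ‖z - j‖ ^ 2))⁻¹) < ⊤ := by
    intro j
    rw [lintegral_sub_right_eq_self (fun z => ENNReal.ofReal (5 * (‖z‖ * (1 + ‖z‖ ^ 2))⁻¹)) j]
    exact h0
  have key : ∀ x y z : ℝ, 0 ≤ x → x ≤ y → x ≤ z → 1/2 ≤ y → 1/2 ≤ z →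
      (x * y * z)⁻¹ ≤ 5 * (x * (1 + x ^ 2))⁻¹ := by
    intro x y z hx hy hz hy2 hz2
    rcases hx.eq_or_lt with rfl | hx
    · simp
    have hy0 : 0 < y := by linarith
    have hz0 : 0 < z := by linarith
    rw [← div_eq_mul_inv, inv_eq_one_div, div_le_div_iff₀ (by positivity) (by positivity)]
    have : 1 + x ^ 2 ≤ 5 * (y * z) := by nlinarith [mul_le_mul hy hz hx.le hy0.le]
    nlinarith
  refine lt_of_le_of_lt (lintegral_mono (g := fun z => ENNReal.ofReal (5 * (‖z - 0‖ * (1 + ‖z - 0‖ ^ 2))⁻¹)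
    + (ENNReal.ofReal (5 * (‖z - 1‖ * (1 + ‖z - 1‖ ^ 2))⁻¹) + ENNReal.ofReal (5 * (‖z - 2‖ * (1 + ‖z - 2‖ ^ 2))⁻¹))) ?_) ?_
  · intro z
    have t1 : 1 ≤ ‖z - 0‖ + ‖z - 1‖ := by
      have := norm_sub_le (z - 0) (z - 1)
      rw [show z - 0 - (z - 1) = 1 by ring, norm_one] at this
      exact this
    have t2 : 1 ≤ ‖z - 1‖ + ‖z - 2‖ := by
      have := norm_sub_le (z - 1) (z - 2)
      rw [show z - 1 - (z - 2) = 1 by ring, norm_one] at this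
      exact this
    have t3 : 1 ≤ ‖z - 0‖ + ‖z - 2‖ := by
      have := norm_sub_le (z - 0) (z - 2)
      rw [show z - 0 - (z - 2) = 2 by ring, Complex.norm_ofNat] at this
      linarith
    have hn : ‖z * (z - 1) * (z - 2)‖ = ‖z - 0‖ * ‖z - 1‖ * ‖z - 2‖ := by
      rw [norm_mul, norm_mul, sub_zero]
    simp only [hn]
    have n0 := norm_nonneg (z - 0)
    have n1 := norm_nonneg (z - 1)
    have n2 := norm_nonneg (z - 2)
    rcases le_total ‖z - 0‖ ‖z - 1‖ with h1 | h1
    · rcases le_total ‖z - 0‖ ‖z - 2‖ with h2 | h2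
      · refine le_trans (ENNReal.ofReal_le_ofReal (key _ _ _ n0 h1 h2 (by linarith) (by linarith))) ?_
        exact le_self_add
      · rw [show ‖z - 0‖ * ‖z - 1‖ * ‖z - 2‖ = ‖z - 2‖ * ‖z - 0‖ * ‖z - 1‖ by ring]
        refine le_trans (ENNReal.ofReal_le_ofReal (key _ _ _ n2 h2 (h2.trans h1) (by linarith) (by linarith))) ?_
        exact le_trans le_add_self le_add_self
    · rcases le_total ‖z - 1‖ ‖z - 2‖ with h2 | h2
      · rw [show ‖z - 0‖ * ‖z - 1‖ * ‖z - 2‖ = ‖z - 1‖ * ‖z - 0‖ * ‖z - 2‖ by ring]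
        refine le_trans (ENNReal.ofReal_le_ofReal (key _ _ _ n1 h1 h2 (by linarith) (by linarith))) ?_
        exact le_trans le_self_add le_add_self
      · rw [show ‖z - 0‖ * ‖z - 1‖ * ‖z - 2‖ = ‖z - 2‖ * ‖z - 0‖ * ‖z - 1‖ by ring]
        refine le_trans (ENNReal.ofReal_le_ofReal (key _ _ _ n2 (h2.trans h1) h2 (by linarith) (by linarith))) ?_
        exact le_trans le_add_self le_add_self
  · rw [lintegral_add_left (by fun_prop), lintegral_add_left (by fun_prop)]
    exact ENNReal.add_lt_top.2 ⟨hj 0, ENNReal.add_lt_top.2 ⟨hj 1, hj 2⟩⟩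

lemma sphDist_coe (a b : ℂ) : sphDist (a : Sphere) (b : Sphere) =
    2 * dist a b / (Real.sqrt (1 + ‖a‖ ^ 2) * Real.sqrt (1 + ‖b‖ ^ 2)) := rfl

lemma sphDist_le_stereo (a b : ℂ) : sphDist (a : Sphere) (b : Sphere) ≤
    ‖2 * a / (1 + (‖a‖ : ℂ) ^ 2) - 2 * b / (1 + (‖b‖ : ℂ) ^ 2)‖ +
      |2 / (1 + ‖a‖ ^ 2) - 2 / (1 + ‖b‖ ^ 2)| := by
  rw [sphDist_coe]
  apply le_of_sq_le_sq _ (by positivity)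
  have hA : ∀ x y : ℝ, 0 ≤ x → 0 ≤ y → x ^ 2 + y ^ 2 ≤ (x + y) ^ 2 := by
    intro x y hx hy; nlinarith [mul_nonneg hx hy]
  refine le_trans (le_of_eq ?_) (hA _ _ (norm_nonneg _) (abs_nonneg _))
  rw [div_pow, mul_pow, mul_pow, Real.sq_sqrt (by positivity), Real.sq_sqrt (by positivity), sq_abs,
    dist_eq_norm, Complex.sq_norm (a - b)]
  have e1 : (2 * a / (1 + (‖a‖ : ℂ) ^ 2) - 2 * b / (1 + (‖b‖ : ℂ) ^ 2)) =
      ((2 / (1 + ‖a‖ ^ 2) : ℝ) : ℂ) * a - ((2 / (1 + ‖b‖ ^ 2) : ℝ) : ℂ) * b := by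
    push_cast; ring
  rw [e1]
  have ha : (1 + ‖a‖ ^ 2) = 1 + a.re ^ 2 + a.im ^ 2 := by
    rw [Complex.sq_norm, Complex.normSq_apply]; ring
  have hb : (1 + ‖b‖ ^ 2) = 1 + b.re ^ 2 + b.im ^ 2 := by
    rw [Complex.sq_norm, Complex.normSq_apply]; ring
  rw [ha, hb, Complex.sq_norm, Complex.normSq_apply, Complex.normSq_apply]
  simp only [Complex.sub_re, Complex.sub_im, Complex.re_ofReal_mul, Complex.im_ofReal_mul]
  have ha' : (1 + a.re ^ 2 + a.im ^ 2) ≠ 0 := by positivity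
  have hb' : (1 + b.re ^ 2 + b.im ^ 2) ≠ 0 := by positivity
  field_simp
  ring

lemma sph_mean {g : ℂ → ℂ} {K : Set ℂ} (hK : Convex ℝ K) {M : ℝ}
    (hg : ∀ t ∈ K, DifferentiableAt ℂ g t) (hM : ∀ t ∈ K, ‖deriv g t‖ ≤ M * (1 + ‖g t‖ ^ 2))
    {t t' : ℂ} (ht : t ∈ K) (ht' : t' ∈ K) :
    sphDist (g t : Sphere) (g t' : Sphere) ≤ 8 * M * ‖t - t'‖ := by
  let γ : ℝ → ℂ := fun s => t' + s * (t - t')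
  have hγK : ∀ s ∈ Set.Icc (0:ℝ) 1, γ s ∈ K := by
    intro s hs
    have := hK ht' ht (by linarith [hs.2] : 0 ≤ 1 - s) hs.1 (by ring)
    convert this using 1
    simp only [γ, Complex.real_smul]; push_cast; ring
  have hγ : ∀ s, HasDerivAt γ (t - t') s := by
    intro s
    have := ((hasDerivAt_id s).ofReal_comp.mul_const (t - t')).const_add t'
    rw [Complex.ofReal_one, one_mul] at this
    exact this
  have hu : ∀ s ∈ Set.Icc (0:ℝ) 1, HasDerivAt (fun s => g (γ s)) (deriv g (γ s) * (t - t')) s := by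
    intro s hs
    exact (hg _ (hγK s hs)).hasDerivAt.comp s (hγ s)
  have hγ0 : γ 0 = t' := by simp [γ]
  have hγ1 : γ 1 = t := by simp [γ]
  have hNn : ∀ z : ℂ, (1 + ‖z‖ ^ 2 : ℝ) ≠ 0 := fun z => by positivity
  -- derivative of the squared norm
  have hN : ∀ s ∈ Set.Icc (0:ℝ) 1, HasDerivAt (fun s => 1 + ‖g (γ s)‖ ^ 2)
      (2 * inner ℝ (g (γ s)) (deriv g (γ s) * (t - t'))) s := by
    intro s hs
    exact ((hu s hs).norm_sq).const_add 1
  have hNb : ∀ s ∈ Set.Icc (0:ℝ) 1, |2 * inner ℝ (g (γ s)) (deriv g (γ s) * (t - t'))| ≤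
      2 * (‖g (γ s)‖ * (M * (1 + ‖g (γ s)‖ ^ 2) * ‖t - t'‖)) := by
    intro s hs
    rw [abs_mul, abs_of_pos (by norm_num : (0:ℝ) < 2)]
    gcongr
    refine (abs_real_inner_le_norm _ _).trans ?_
    rw [norm_mul]
    gcongr
    exact hM _ (hγK s hs)
  have hM0 : 0 ≤ M := by
    have := (norm_nonneg _).trans (hM t ht)
    exact nonneg_of_mul_nonneg_left this (by positivity)
  have hinv : ∀ s ∈ Set.Icc (0:ℝ) 1, HasDerivAt (fun s => 2 / (1 + ‖g (γ s)‖ ^ 2))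
      (-(2 * (2 * inner ℝ (g (γ s)) (deriv g (γ s) * (t - t'))) / (1 + ‖g (γ s)‖ ^ 2) ^ 2)) s := by
    intro s hs
    have := (hasDerivAt_const s (2:ℝ)).fun_div (hN s hs) (hNn _)
    refine this.congr_deriv ?_
    ring
  have hinvb : ∀ s ∈ Set.Icc (0:ℝ) 1,
      |-(2 * (2 * inner ℝ (g (γ s)) (deriv g (γ s) * (t - t'))) / (1 + ‖g (γ s)‖ ^ 2) ^ 2)| *
        max 1 ‖g (γ s)‖ ≤ 4 * M * ‖t - t'‖ := by
    intro s hs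
    rw [abs_neg, abs_div, abs_mul, abs_of_pos (by norm_num : (0:ℝ) < 2),
      abs_of_pos (by positivity : 0 < (1 + ‖g (γ s)‖ ^ 2) ^ 2)]
    set x := ‖g (γ s)‖ with hx
    have hx0 : 0 ≤ x := norm_nonneg _
    have h1 : max 1 x * x ≤ 1 + x ^ 2 := by
      rcases le_total 1 x with h | h
      · rw [max_eq_right h]; nlinarith
      · rw [max_eq_left h]; nlinarith
    rw [div_mul_eq_mul_div, div_le_iff₀ (by positivity)]
    calc _ ≤ 2 * (2 * (x * (M * (1 + x ^ 2) * ‖t - t'‖))) * max 1 x := by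
          gcongr; exact hNb s hs
      _ = 4 * M * ‖t - t'‖ * (1 + x ^ 2) * (max 1 x * x) := by ring
      _ ≤ 4 * M * ‖t - t'‖ * (1 + x ^ 2) * (1 + x ^ 2) := by gcongr
      _ = _ := by ring
  have hB : |2 / (1 + ‖g t‖ ^ 2) - 2 / (1 + ‖g t'‖ ^ 2)| ≤ 2 * M * ‖t - t'‖ := by
    have := norm_image_sub_le_of_norm_deriv_le_segment_01'
      (f := fun s => 2 / (1 + ‖g (γ s)‖ ^ 2)) (C := 2 * M * ‖t - t'‖)
      (fun s hs => (hinv s hs).hasDerivWithinAt) (fun s hs => by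
        have hs : s ∈ Set.Icc (0:ℝ) 1 := ⟨hs.1, hs.2.le⟩
        rw [Real.norm_eq_abs, abs_neg, abs_div, abs_mul, abs_of_pos (by norm_num : (0:ℝ) < 2),
          abs_of_pos (by positivity : 0 < (1 + ‖g (γ s)‖ ^ 2) ^ 2), div_le_iff₀ (by positivity)]
        have h := hNb s hs
        set x := ‖g (γ s)‖ with hx
        have h1 : 2 * x ≤ 1 + x ^ 2 := by nlinarith [sq_nonneg (x - 1)]
        calc _ ≤ 2 * (2 * (x * (M * (1 + x ^ 2) * ‖t - t'‖))) := by gcongr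
          _ = 2 * M * ‖t - t'‖ * (1 + x ^ 2) * (2 * x) := by ring
          _ ≤ 2 * M * ‖t - t'‖ * (1 + x ^ 2) * (1 + x ^ 2) := by gcongr
          _ = _ := by ring)
    simpa [hγ0, hγ1] using this
  have hA : ‖2 * g t / (1 + (‖g t‖ : ℂ) ^ 2) - 2 * g t' / (1 + (‖g t'‖ : ℂ) ^ 2)‖ ≤
      6 * M * ‖t - t'‖ := by
    have := norm_image_sub_le_of_norm_deriv_le_segment_01'
      (f := fun s => ((2 / (1 + ‖g (γ s)‖ ^ 2) : ℝ) : ℂ) * g (γ s)) (C := 6 * M * ‖t - t'‖)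
      (fun s hs => (((hinv s hs).ofReal_comp).mul (hu s hs)).hasDerivWithinAt) (fun s hs => by
        have hs : s ∈ Set.Icc (0:ℝ) 1 := ⟨hs.1, hs.2.le⟩
        have h := hinvb s hs
        refine (norm_add_le _ _).trans ?_
        rw [norm_mul, norm_mul, norm_mul, Complex.norm_real, Complex.norm_real, Real.norm_eq_abs,
          Real.norm_eq_abs, abs_of_pos (by positivity : 0 < 2 / (1 + ‖g (γ s)‖ ^ 2))]
        have h2 : 2 / (1 + ‖g (γ s)‖ ^ 2) * (‖deriv g (γ s)‖ * ‖t - t'‖) ≤ 2 * M * ‖t - t'‖ := by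
          rw [div_mul_eq_mul_div, div_le_iff₀ (by positivity)]
          calc _ ≤ 2 * (M * (1 + ‖g (γ s)‖ ^ 2) * ‖t - t'‖) := by
                gcongr; exact hM _ (hγK s hs)
            _ = _ := by ring
        have h3 := mul_le_mul_of_nonneg_left (le_max_right 1 ‖g (γ s)‖) (abs_nonneg
          (-(2 * (2 * inner ℝ (g (γ s)) (deriv g (γ s) * (t - t'))) / (1 + ‖g (γ s)‖ ^ 2) ^ 2)))
        linarith)
    simp only [hγ0, hγ1] at this
    refine le_trans (le_of_eq ?_) this
    congr 1
    push_cast; ring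
  refine (sphDist_le_stereo _ _).trans ?_
  linarith

lemma area_bound {Ω K : Set ℂ} (hΩ : IsOpen Ω) (hK : IsCompact K) (hKc : Convex ℝ K)
    (hKΩ : K ⊆ Ω) {η : ℝ} (hη : 0 < η) : ∃ C : ℕ, ∀ L : Finset (ℂ → ℂ),
    (∀ g ∈ L, DifferentiableOn ℂ g Ω ∧ ∀ t ∈ Ω, g t ≠ 0 ∧ g t ≠ 1 ∧ g t ≠ 2) →
    (∀ g ∈ L, ∀ g' ∈ L, ∀ t ∈ Ω, ∀ t' ∈ Ω, g t = g' t' → g = g' ∧ t = t') →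
    (L.filter fun g => ∃ t ∈ K, ∃ t' ∈ K, η ≤ sphDist (g t : Sphere) (g t' : Sphere)).card ≤ C := by
  obtain ⟨r, hr, hrΩ⟩ := hK.exists_cthickening_subset_open hΩ hKΩ
  obtain ⟨R, hR⟩ := hK.isBounded.subset_closedBall 0
  set A := ∫⁻ z : ℂ, ENNReal.ofReal (‖z * (z - 1) * (z - 2)‖⁻¹) with hAdef
  have hA : A < ⊤ := finite_area
  -- choose `M` with `8 * M * (2 * R) < η`
  obtain ⟨M, hM0, hM⟩ : ∃ M : ℝ, 0 < M ∧ 8 * M * (2 * |R|) < η := by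
    refine ⟨η / (32 * (|R| + 1)), by positivity, ?_⟩
    have : 0 ≤ |R| := abs_nonneg _
    rw [mul_div_assoc', div_mul_eq_mul_div, div_lt_iff₀ (by positivity)]
    nlinarith
  set a : ENNReal := ENNReal.ofReal (2 * Real.pi * (r ^ 2 / 4) * (M ^ 2 / 6)) with ha
  have ha0 : a ≠ 0 := by
    rw [ha, Ne, ENNReal.ofReal_eq_zero, not_le]; positivity
  refine ⟨⌊(A / a).toReal⌋₊, ?_⟩
  intro L hL hdisj
  set L' := L.filter fun g => ∃ t ∈ K, ∃ t' ∈ K, η ≤ sphDist (g t : Sphere) (g t' : Sphere) with hL'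
  have hinj : ∀ g ∈ L, Set.InjOn g Ω := fun g hg t ht t' ht' h => (hdisj g hg g hg t ht t' ht' h).2
  have hvol : ∀ g ∈ L, ∫⁻ z in g '' Ω, ENNReal.ofReal (‖z * (z - 1) * (z - 2)‖⁻¹) =
      ∫⁻ z in Ω, ‖deriv g z ^ 2 / (g z * (g z - 1) * (g z - 2))‖ₑ := by
    intro g hg
    have hd : ∀ x ∈ Ω, HasDerivAt g (deriv g x) x := fun x hx =>
      ((hL g hg).1.differentiableAt (hΩ.mem_nhds hx)).hasDerivAt
    rw [lintegral_image_eq_lintegral_abs_det_fderiv_mul volume hΩ.measurableSet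
      (f' := fun x => (ContinuousLinearMap.toSpanSingleton ℂ (deriv g x)).restrictScalars ℝ)
      (fun x hx => ((hd x hx).hasFDerivAt.restrictScalars ℝ).hasFDerivWithinAt) (hinj g hg)]
    apply setLIntegral_congr_fun hΩ.measurableSet
    intro x hx
    have hdet : ((ContinuousLinearMap.toSpanSingleton ℂ (deriv g x)).restrictScalars ℝ).det =
        ‖deriv g x‖ ^ 2 := by
      rw [← Complex.normSq_eq_norm_sq, ← Algebra.norm_complex_apply, Algebra.norm_apply]
      rw [ContinuousLinearMap.det]
      congr 1
      ext <;> simp [mul_comm]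
    simp only [hdet]
    rw [← ofReal_norm, ← ENNReal.ofReal_mul (abs_nonneg _), norm_div, norm_pow, abs_of_nonneg (by positivity),
      div_eq_mul_inv]
  have hbig : ∀ g ∈ L', a ≤ ∫⁻ z in g '' Ω, ENNReal.ofReal (‖z * (z - 1) * (z - 2)‖⁻¹) := by
    intro g hg
    obtain ⟨hgL, t, ht, t', ht', hη'⟩ := Finset.mem_filter.1 hg
    rw [hvol g hgL]
    by_contra hlt
    rw [not_le] at hlt
    have hdΩ := (hL g hgL).1
    have hGd : DifferentiableOn ℂ (fun z => deriv g z ^ 2 / (g z * (g z - 1) * (g z - 2))) Ω := by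
      apply DifferentiableOn.div
      · exact (hdΩ.deriv hΩ).pow 2
      · exact (hdΩ.mul (hdΩ.sub_const 1)).mul (hdΩ.sub_const 2)
      · intro x hx
        obtain ⟨h0, h1, h2⟩ := (hL g hgL).2 x hx
        exact mul_ne_zero (mul_ne_zero h0 (sub_ne_zero.2 h1)) (sub_ne_zero.2 h2)
    have hbound : ∀ s ∈ K, ‖deriv g s‖ ≤ M * (1 + ‖g s‖ ^ 2) := by
      intro s hs
      have hb : Metric.ball s r ⊆ Ω := by
        refine Metric.ball_subset_closedBall.trans ?_
        exact (Metric.closedBall_subset_cthickening hs r).trans hrΩ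
      have h1 := (mean_area hr (hGd.mono hb)).trans (lintegral_mono_set hb)
      have h2 := h1.trans hlt.le
      rw [ha, ENNReal.ofReal_mul (p := 2 * Real.pi * (r ^ 2 / 4)) (by positivity)] at h2
      have h3 : ‖deriv g s ^ 2 / (g s * (g s - 1) * (g s - 2))‖ₑ ≤ ENNReal.ofReal (M ^ 2 / 6) := by
        refine (ENNReal.mul_le_mul_iff_right ?_ ENNReal.ofReal_ne_top).1 h2
        rw [Ne, ENNReal.ofReal_eq_zero, not_le]; positivity
      rw [← ofReal_norm, ENNReal.ofReal_le_ofReal_iff (by positivity), norm_div, norm_pow] at h3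
      obtain ⟨n0, n1, n2⟩ := (hL g hgL).2 s (hKΩ hs)
      have hpos : 0 < ‖g s * (g s - 1) * (g s - 2)‖ := norm_pos_iff.2
        (mul_ne_zero (mul_ne_zero n0 (sub_ne_zero.2 n1)) (sub_ne_zero.2 n2))
      rw [div_le_iff₀ hpos, norm_mul, norm_mul] at h3
      have k1 : ‖g s - 1‖ ≤ ‖g s‖ + 1 := by simpa using norm_sub_le (g s) 1
      have k2 : ‖g s - 2‖ ≤ ‖g s‖ + 2 := by simpa using norm_sub_le (g s) 2
      apply le_of_sq_le_sq _ (by positivity)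
      refine h3.trans ?_
      set x := ‖g s‖ with hx
      have hx0 : 0 ≤ x := norm_nonneg _
      calc M ^ 2 / 6 * (x * ‖g s - 1‖ * ‖g s - 2‖) ≤ M ^ 2 / 6 * (x * (x + 1) * (x + 2)) := by gcongr
        _ ≤ M ^ 2 / 6 * (6 * (1 + x ^ 2) ^ 2) := by
            have hxx : x * (x + 1) * (x + 2) ≤ 6 * (1 + x ^ 2) ^ 2 := by
              nlinarith [sq_nonneg (x - 1), sq_nonneg (x * (x - 1)), sq_nonneg (x ^ 2)]
            exact mul_le_mul_of_nonneg_left hxx (by positivity)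
        _ = _ := by ring
    have := sph_mean hKc (fun s hs => hdΩ.differentiableAt (hΩ.mem_nhds (hKΩ hs))) hbound ht ht'
    have hn : ‖t - t'‖ ≤ 2 * |R| := by
      have e1 := hR ht
      have e2 := hR ht'
      rw [mem_closedBall_zero_iff] at e1 e2
      linarith [norm_sub_le t t', le_abs_self R]
    have : 8 * M * ‖t - t'‖ ≤ 8 * M * (2 * |R|) := by gcongr
    linarith
  have hsum : (L'.card : ENNReal) * a ≤ A := by
    calc (L'.card : ENNReal) * a = ∑ g ∈ L', a := by rw [Finset.sum_const, nsmul_eq_mul]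
      _ ≤ ∑ g ∈ L', ∫⁻ z in g '' Ω, ENNReal.ofReal (‖z * (z - 1) * (z - 2)‖⁻¹) :=
          Finset.sum_le_sum hbig
      _ = ∫⁻ z in ⋃ g ∈ L', g '' Ω, ENNReal.ofReal (‖z * (z - 1) * (z - 2)‖⁻¹) := by
          rw [lintegral_biUnion_finset]
          · intro g hg g' hg' hne
            rw [Function.onFun, Set.disjoint_left]
            rintro _ ⟨t, ht, rfl⟩ ⟨t', ht', h⟩
            exact hne (hdisj g (Finset.mem_filter.1 hg).1 g' (Finset.mem_filter.1 hg').1 t ht t' ht' h.symm).1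
          · intro g hg
            have hgL := (Finset.mem_filter.1 hg).1
            exact hΩ.measurableSet.image_of_continuousOn_injOn (hL g hgL).1.continuousOn (hinj g hgL)
      _ ≤ A := setLIntegral_le_lintegral _ _
  have h1 : (L'.card : ENNReal) ≤ A / a :=
    ENNReal.le_div_iff_mul_le (Or.inl ha0) (Or.inl ENNReal.ofReal_ne_top) |>.2 hsum
  have h2 : A / a ≠ ⊤ := (ENNReal.div_lt_top hA.ne ha0).ne
  apply Nat.le_floor
  have := ENNReal.toReal_mono h2 h1
  simpa using this

/-- A disc chart: data used to connect two points in the complement of a finite set. -/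
def Chart (F : Set ℂ) (Ω K : Set ℂ) (ψ : ℂ → ℂ) : Prop :=
  IsOpen Ω ∧ Convex ℝ Ω ∧ IsCompact K ∧ Convex ℝ K ∧ K ⊆ Ω ∧ DifferentiableOn ℂ ψ Ω ∧
    Set.InjOn ψ Ω ∧ ∀ t ∈ Ω, ψ t ∉ F

def AreaB (Ω K : Set ℂ) (η : ℝ) (C : ℕ) : Prop :=
  ∀ L : Finset (ℂ → ℂ),
    (∀ g ∈ L, DifferentiableOn ℂ g Ω ∧ ∀ t ∈ Ω, g t ≠ 0 ∧ g t ≠ 1 ∧ g t ≠ 2) →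
    (∀ g ∈ L, ∀ g' ∈ L, ∀ t ∈ Ω, ∀ t' ∈ Ω, g t = g' t' → g = g' ∧ t = t') →
    (L.filter fun g => ∃ t ∈ K, ∃ t' ∈ K, η ≤ sphDist (g t : Sphere) (g t' : Sphere)).card ≤ C

lemma exists_chart {F : Set ℂ} (hF : F.Finite) {z z' : ℂ} (hz : z ∉ F) (hz' : z' ∉ F) :
    ∃ Ω K ψ, Chart F Ω K ψ ∧ ψ '' K ∈ 𝓝 z ∧ ψ '' K ∈ 𝓝 z' := by
  by_cases hzz : z = z'
  · subst hzz
    obtain ⟨δ, hδ, hb⟩ := Metric.isOpen_iff.1 hF.isClosed.isOpen_compl z hz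
    refine ⟨Metric.ball z δ, Metric.closedBall z (δ / 2), id, ⟨Metric.isOpen_ball, convex_ball _ _,
      isCompact_closedBall _ _, convex_closedBall _ _, Metric.closedBall_subset_ball (by linarith),
      differentiableOn_id, Function.injective_id.injOn, fun t ht => hb ht⟩, ?_, ?_⟩ <;>
    · rw [Set.image_id]; exact Metric.closedBall_mem_nhds _ (by linarith)
  · have hd : z' - z ≠ 0 := sub_ne_zero.2 (Ne.symm hzz)
    have hbadf : ((fun w => ((w - z) / (z' - z)).im /
        (((w - z) / (z' - z)).re * (1 - ((w - z) / (z' - z)).re))) '' F).Finite := hF.image _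
    obtain ⟨σ, ⟨hσ0, hσ1⟩, hσb⟩ := ((Set.Ioo_infinite (by norm_num : (0:ℝ) < 1/5)).sdiff hbadf).nonempty
    let ψ : ℂ → ℂ := fun t => z + (z' - z) * (t + Complex.I * σ * t * (1 - t))
    have hψ : ∀ t, HasStrictDerivAt ψ ((z' - z) * (1 + Complex.I * σ * (1 - 2 * t))) t := by
      intro t
      have h1 := hasStrictDerivAt_id t
      have h2 := (((h1.add ((h1.const_mul (Complex.I * σ)).mul (h1.const_sub 1))).const_mul (z' - z)).const_add z)
      refine h2.congr_deriv ?_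
      simp only [id]
      ring
    have hψd : Differentiable ℂ ψ := fun t => (hψ t).hasDerivAt.differentiableAt
    let S : Set ℂ := segment ℝ 0 1
    have hSc : IsCompact S := by
      have : S = (fun t : ℝ => (t : ℂ)) '' Set.Icc 0 1 := by
        ext x
        simp only [S, segment_eq_image, Set.mem_image]
        constructor <;> rintro ⟨t, ht, rfl⟩ <;> exact ⟨t, ht, by simp⟩
      rw [this]
      exact isCompact_Icc.image Complex.continuous_ofReal
    have hS : ∀ x ∈ S, ∃ t : ℝ, 0 ≤ t ∧ t ≤ 1 ∧ x = t := by
      intro x hx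
      simp only [S, segment_eq_image, Set.mem_image] at hx
      obtain ⟨t, ht, rfl⟩ := hx
      exact ⟨t, ht.1, ht.2, by simp⟩
    have hSU : S ⊆ ψ ⁻¹' Fᶜ := by
      intro x hx hxF
      obtain ⟨t, ht0, ht1, rfl⟩ := hS x hx
      apply hσb
      refine ⟨ψ t, hxF, ?_⟩
      have hc : (ψ t - z) / (z' - z) = (t : ℂ) + Complex.I * σ * t * (1 - t) := by
        simp only [ψ]; rw [add_sub_cancel_left, mul_div_cancel_left₀ _ hd]
      simp only [hc]
      have hre : ((t : ℂ) + Complex.I * σ * t * (1 - t)).re = t := by simp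
      have him : ((t : ℂ) + Complex.I * σ * t * (1 - t)).im = σ * t * (1 - t) := by simp
      rw [hre, him]
      have h0 : t ≠ 0 := by
        rintro rfl; apply hz; convert hxF using 1; simp [ψ]
      have h1 : t ≠ 1 := by
        rintro rfl; apply hz'; convert hxF using 1; simp [ψ]
      have h1' : 1 - t ≠ 0 := sub_ne_zero.2 h1.symm
      field_simp
    obtain ⟨δ0, hδ0, hsub0⟩ := hSc.exists_cthickening_subset_open
      (hF.isClosed.isOpen_compl.preimage hψd.continuous) hSU
    obtain ⟨δ, hδ, hδ1, hδ2⟩ : ∃ δ : ℝ, 0 < δ ∧ δ ≤ δ0 ∧ δ ≤ 1 :=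
      ⟨min δ0 1, by positivity, min_le_left _ _, min_le_right _ _⟩
    have hΩn : ∀ t ∈ Metric.thickening δ S, ‖t‖ < 2 := by
      intro t ht
      obtain ⟨s, hs, hts⟩ := Metric.mem_thickening_iff.1 ht
      obtain ⟨u, hu0, hu1, rfl⟩ := hS s hs
      have h2 : ‖(u : ℂ)‖ ≤ 1 := by rw [Complex.norm_real, Real.norm_eq_abs, abs_of_nonneg hu0]; exact hu1
      rw [dist_eq_norm] at hts
      have h3 : ‖t‖ ≤ ‖t - u‖ + ‖(u : ℂ)‖ := by simpa using norm_add_le (t - u) u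
      linarith
    have hKn : ∀ x ∈ S, ψ '' (Metric.cthickening (δ / 2) S) ∈ 𝓝 (ψ x) := by
      intro x hx
      have hder : (z' - z) * (1 + Complex.I * σ * (1 - 2 * x)) ≠ 0 := by
        apply mul_ne_zero hd
        obtain ⟨t, ht0, ht1, rfl⟩ := hS x hx
        intro h
        have := congrArg Complex.re h
        simp at this
      rw [← (hψ x).map_nhds_eq hder]
      apply Filter.image_mem_map
      refine Filter.mem_of_superset (Metric.isOpen_thickening.mem_nhds
        (Metric.self_subset_thickening (by linarith : 0 < δ / 2) S hx))
        (Metric.thickening_subset_cthickening _ _)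
    have hSconv : Convex ℝ S := convex_segment 0 1
    refine ⟨Metric.thickening δ S, Metric.cthickening (δ / 2) S, ψ, ⟨Metric.isOpen_thickening,
      hSconv.thickening _, hSc.cthickening, hSconv.cthickening _,
      Metric.cthickening_subset_thickening' hδ (by linarith) _, hψd.differentiableOn, ?_, ?_⟩, ?_, ?_⟩
    · intro t ht t' ht' he
      by_contra hne
      have h1 : (z' - z) * ((t - t') * (1 + Complex.I * σ * (1 - t - t'))) = 0 := by
        simp only [ψ] at he
        linear_combination he
      have h2 : 1 + Complex.I * σ * (1 - t - t') = 0 := by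
        rcases mul_eq_zero.1 h1 with h | h
        · exact absurd h hd
        rcases mul_eq_zero.1 h with h | h
        · exact absurd (sub_eq_zero.1 h) hne
        · exact h
      have h3 : ‖Complex.I * σ * (1 - t - t')‖ = 1 := by
        rw [show Complex.I * σ * (1 - t - t') = -1 by linear_combination h2]; simp
      rw [norm_mul, norm_mul, Complex.norm_I, one_mul, Complex.norm_real, Real.norm_eq_abs,
        abs_of_pos hσ0] at h3
      have h4 : ‖1 - t - t'‖ ≤ 5 := by
        have a1 := norm_sub_le (1 - t) t'
        have a2 := norm_sub_le 1 t
        rw [norm_one] at a2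
        linarith [hΩn t ht, hΩn t' ht']
      nlinarith [norm_nonneg (1 - t - t')]
    · intro t ht
      exact hsub0 (Metric.thickening_subset_cthickening_of_le hδ1 S ht)
    · have := hKn 0 (left_mem_segment ℝ 0 1)
      simpa [ψ] using this
    · have := hKn 1 (right_mem_segment ℝ 0 1)
      simpa [ψ] using this

lemma charts_uniform {F : Set ℂ} (hF : F.Finite) {G : Set ℂ} (hG : IsCompact G)
    (hGF : Disjoint G F) {η : ℝ} (hη : 0 < η) :
    ∃ C : ℕ, ∀ z ∈ G, ∀ z' ∈ G, ∃ Ω K ψ, Chart F Ω K ψ ∧ (∃ t ∈ K, ψ t = z) ∧ (∃ t ∈ K, ψ t = z') ∧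
      AreaB Ω K η C := by
  have main := (hG.prod hG).induction_on (p := fun s => ∃ C : ℕ, ∀ x ∈ s, ∃ Ω K ψ, Chart F Ω K ψ ∧
    (∃ t ∈ K, ψ t = x.1) ∧ (∃ t ∈ K, ψ t = x.2) ∧ AreaB Ω K η C) ?_ ?_ ?_ ?_
  · obtain ⟨C, h⟩ := main
    exact ⟨C, fun z hz z' hz' => h (z, z') ⟨hz, hz'⟩⟩
  · exact ⟨0, by simp⟩
  · rintro s t hst ⟨C, h⟩
    exact ⟨C, fun x hx => h x (hst hx)⟩
  · rintro s t ⟨C, h⟩ ⟨C', h'⟩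
    refine ⟨max C C', ?_⟩
    rintro x (hx | hx)
    · obtain ⟨Ω, K, ψ, h1, h2, h3, h4⟩ := h x hx
      exact ⟨Ω, K, ψ, h1, h2, h3, fun L a b => (h4 L a b).trans (le_max_left _ _)⟩
    · obtain ⟨Ω, K, ψ, h1, h2, h3, h4⟩ := h' x hx
      exact ⟨Ω, K, ψ, h1, h2, h3, fun L a b => (h4 L a b).trans (le_max_right _ _)⟩
  · rintro ⟨z, z'⟩ ⟨hz, hz'⟩
    obtain ⟨Ω, K, ψ, hc, h1, h2⟩ := exists_chart hF (Set.disjoint_left.1 hGF hz)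
      (Set.disjoint_left.1 hGF hz')
    obtain ⟨C, hC⟩ := area_bound hc.1 hc.2.2.1 hc.2.2.2.1 hc.2.2.2.2.1 hη
    refine ⟨(ψ '' K) ×ˢ (ψ '' K), mem_nhdsWithin_of_mem_nhds (prod_mem_nhds h1 h2), C, ?_⟩
    rintro ⟨x, y⟩ ⟨hx, hy⟩
    exact ⟨Ω, K, ψ, hc, hx, hy, hC⟩

def liftSpec (Ω : Set ℂ) (a : Fin N) (b : ℂ → ℂ) (L : Finset (ℂ → ℂ)) : Prop :=
  (∀ g ∈ L, DifferentiableOn ℂ g Ω ∧ ∀ t ∈ Ω, g t ≠ 0 ∧ g t ≠ 1 ∧ g t ≠ 2) ∧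
      ∀ t ∈ Ω, fiber (p a) (q a) (b t) = L.val.map (fun g => (g t : Sphere)) ∧
        (fiber (p a) (q a) (b t)).Nodup

def lifts (Ω : Set ℂ) (a : Fin N) (b : ℂ → ℂ) : Finset (ℂ → ℂ) :=
  if h : ∃ L, liftSpec p q Ω a b L then h.choose else ∅

def Fset : ℕ → Set Sphere
  | 0 => ∅
  | m + 1 => Vset p q ∪ ⋃ a, ratEval (p a) (q a) '' Fset m

def badN (Ω K : Set ℂ) (η : ℝ) (m' k : ℕ) (g : ℂ → ℂ) : Prop :=
  (∃ t ∈ Ω, (g t : Sphere) ∈ Vset p q) ∨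
    (m' ≤ k ∧ ∃ t ∈ K, ∃ t' ∈ K, η ≤ sphDist (g t : Sphere) (g t' : Sphere))

def Fam (Ω : Set ℂ) (m k : ℕ) (A : Finset (ℂ → ℂ)) : Prop :=
  (∀ g ∈ A, DifferentiableOn ℂ g Ω ∧ (1 ≤ k → ∀ t ∈ Ω, g t ≠ 0 ∧ g t ≠ 1 ∧ g t ≠ 2) ∧
    ∀ t ∈ Ω, (g t : Sphere) ∉ Fset p q (m - k)) ∧
  (∀ g ∈ A, ∀ g' ∈ A, ∀ t ∈ Ω, ∀ t' ∈ Ω, g t = g' t' → g = g' ∧ t = t')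

def cbad (m m' C k : ℕ) : ℕ := if k < m then 0 else (Vset p q).ncard + if m' ≤ k then C else 0

lemma lifts_spec (hg : Good p q) (a : Fin N) {Ω : Set ℂ} (hΩ : IsOpen Ω) (hΩc : Convex ℝ Ω)
    (hΩn : Ω.Nonempty) {b : ℂ → ℂ} (hb : DifferentiableOn ℂ b Ω)
    (hbV : ∀ t ∈ Ω, (b t : Sphere) ∉ Vset p q) : liftSpec p q Ω a b (lifts p q Ω a b) := by
  have h : ∃ L, liftSpec p q Ω a b L := exists_lifts p q hg a hΩ hΩc hΩn b hb hbV
  rw [lifts, dif_pos h]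
  exact h.choose_spec

lemma fam_bad (hg : Good p q) {Ω K : Set ℂ} (hKΩ : K ⊆ Ω) {η : ℝ} {m m' C k : ℕ} (hm : 1 ≤ m) (hmm : m ≤ m')
    (hC : AreaB Ω K η C) {A : Finset (ℂ → ℂ)} (hA : Fam p q Ω m k A) :
    (A.filter fun g => badN p q Ω K η m' k g).card ≤ cbad p q m m' C k := by
  unfold cbad
  split_ifs with hk hk'
  · rw [Nat.le_zero, Finset.card_eq_zero, Finset.filter_eq_empty_iff]
    rintro g hgA (⟨t, ht, hV⟩ | ⟨h, _⟩)
    · apply (hA.1 g hgA).2.2 t ht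
      obtain ⟨j, hj⟩ : ∃ j, m - k = j + 1 := ⟨m - k - 1, by omega⟩
      rw [hj]; exact Or.inl hV
    · omega
  all_goals
    have h1 : (A.filter fun g => ∃ t ∈ Ω, (g t : Sphere) ∈ Vset p q).card ≤ (Vset p q).ncard := by
      have hfin := Vset_finite p q hg
      rw [Set.ncard_eq_toFinset_card _ hfin]
      have hch : ∀ g ∈ (A.filter fun g => ∃ t ∈ Ω, (g t : Sphere) ∈ Vset p q), ∃ t ∈ Ω,
        (g t : Sphere) ∈ Vset p q := fun g hg => (Finset.mem_filter.1 hg).2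
      choose! τ hτ hτV using hch
      apply Finset.card_le_card_of_injOn (fun g => ((g (τ g) : ℂ) : Sphere))
      · intro g hg
        simpa using hτV g hg
      · intro g hg g' hg' he
        exact (hA.2 g (Finset.mem_filter.1 hg).1 g' (Finset.mem_filter.1 hg').1 _ (hτ g hg) _
          (hτ g' hg') (OnePoint.coe_injective he)).1
  · have h2 := hC A (fun g hgA => ⟨(hA.1 g hgA).1, (hA.1 g hgA).2.1 (by omega)⟩) hA.2
    refine le_trans ?_ (add_le_add h1 h2)
    refine le_trans (Finset.card_le_card ?_) (Finset.card_union_le _ _)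
    intro g hg
    rw [Finset.mem_filter] at hg
    rw [Finset.mem_union, Finset.mem_filter, Finset.mem_filter]
    rcases hg.2 with h | h
    · exact Or.inl ⟨hg.1, h⟩
    · exact Or.inr ⟨hg.1, h.2⟩
  · refine le_trans (Finset.card_le_card ?_) h1
    intro g hg
    rw [Finset.mem_filter] at hg ⊢
    rcases hg.2 with h | h
    · exact ⟨hg.1, h⟩
    · exact absurd h.1 hk'

lemma fam_step (hg : Good p q) (a : Fin N) {Ω K : Set ℂ} (hΩ : IsOpen Ω) (hΩc : Convex ℝ Ω)
    (hΩn : Ω.Nonempty) {η : ℝ} {m m' k : ℕ} {A : Finset (ℂ → ℂ)} (hA : Fam p q Ω m k A) :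
    Fam p q Ω m (k + 1)
      ((A.filter fun g => ¬ badN p q Ω K η m' k g).biUnion fun g => lifts p q Ω a g) := by
  have hsp : ∀ g ∈ A.filter (fun g => ¬ badN p q Ω K η m' k g),
      g ∈ A ∧ liftSpec p q Ω a g (lifts p q Ω a g) := by
    intro g h
    rw [Finset.mem_filter] at h
    refine ⟨h.1, lifts_spec p q hg a hΩ hΩc hΩn (hA.1 g h.1).1 ?_⟩
    intro t ht hV
    exact h.2 (Or.inl ⟨t, ht, hV⟩)
  have hR : ∀ g, liftSpec p q Ω a g (lifts p q Ω a g) → ∀ h ∈ lifts p q Ω a g, ∀ t ∈ Ω,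
      ratEval (p a) (q a) (h t : Sphere) = g t := by
    intro g hs h hh t ht
    apply (mem_fiber (hg.2.1 a) (hg.2.2.1 a) _ _).1
    rw [(hs.2 t ht).1]
    exact Multiset.mem_map.2 ⟨h, hh, rfl⟩
  constructor
  · intro h hh
    obtain ⟨g, hgf, hhl⟩ := Finset.mem_biUnion.1 hh
    obtain ⟨hgA, hs⟩ := hsp g hgf
    refine ⟨(hs.1 h hhl).1, fun _ => (hs.1 h hhl).2, ?_⟩
    intro t ht hF
    by_cases hk : k < m
    · apply (hA.1 g hgA).2.2 t ht
      rw [show m - k = (m - (k + 1)) + 1 by omega]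
      exact Or.inr (Set.mem_iUnion.2 ⟨a, _, hF, hR g hs h hhl t ht⟩)
    · rw [show m - (k + 1) = 0 by omega] at hF
      exact hF
  · intro h hh h' hh' t ht t' ht' he
    obtain ⟨g, hgf, hhl⟩ := Finset.mem_biUnion.1 hh
    obtain ⟨hgA, hs⟩ := hsp g hgf
    obtain ⟨g', hgf', hhl'⟩ := Finset.mem_biUnion.1 hh'
    obtain ⟨hgA', hs'⟩ := hsp g' hgf'
    have e1 := hR g hs h hhl t ht
    have e2 := hR g' hs' h' hhl' t' ht'
    rw [he, e2] at e1
    obtain ⟨rfl, rfl⟩ := hA.2 g hgA g' hgA' t ht t' ht' (OnePoint.coe_injective e1.symm)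
    refine ⟨?_, rfl⟩
    have hnd := (hs.2 t ht).2
    rw [(hs.2 t ht).1] at hnd
    exact Multiset.inj_on_of_nodup_map hnd h hhl h' hhl' (by rw [he])

/-- The cumulative contribution of the bad nodes. -/
def betaN (Ω K : Set ℂ) (η S : ℝ) (M : ℕ → ℝ) (m' : ℕ) : ℕ → ℕ → (ℂ → ℂ) → ℝ
  | 0, k, g => if badN p q Ω K η m' k g then M 0 else 0
  | j + 1, k, g => if badN p q Ω K η m' k g then M (j + 1) else
      Real.exp S * ∑ a, ∑ h ∈ lifts p q Ω a g, betaN Ω K η S M m' j (k + 1) h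

lemma betaN_nonneg {Ω K : Set ℂ} {η S : ℝ} {M : ℕ → ℝ} {m' : ℕ} (hM : ∀ j, 0 ≤ M j) (j k : ℕ)
    (g : ℂ → ℂ) : 0 ≤ betaN p q Ω K η S M m' j k g := by
  induction j generalizing k g with
  | zero => rw [betaN]; split_ifs <;> simp [hM]
  | succ j ih =>
    rw [betaN]; split_ifs
    · exact hM _
    · apply mul_nonneg (Real.exp_pos _).le
      exact Finset.sum_nonneg fun a _ => Finset.sum_nonneg fun h _ => ih _ _

lemma beta_sum (hg : Good p q) {Ω K : Set ℂ} (hΩ : IsOpen Ω) (hΩc : Convex ℝ Ω)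
    (hΩn : Ω.Nonempty) (hKΩ : K ⊆ Ω) {η S : ℝ} {M : ℕ → ℝ} {m m' C : ℕ} (hM : ∀ j, 0 ≤ M j)
    (hm : 1 ≤ m) (hmm : m ≤ m') (hC : AreaB Ω K η C) (j k : ℕ) (A : Finset (ℂ → ℂ))
    (hA : Fam p q Ω m k A) :
    ∑ g ∈ A, betaN p q Ω K η S M m' j k g ≤ ∑ i ∈ Finset.range (j + 1),
      (N : ℝ) ^ i * Real.exp (i * S) * cbad p q m m' C (k + i) * M (j - i) := by
  have hsplit : ∀ (φ : (ℂ → ℂ) → ℝ) (c : ℝ), 0 ≤ c → (∀ g ∈ A, badN p q Ω K η m' k g → φ g = c) →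
      ∑ g ∈ A, φ g ≤ cbad p q m m' C k * c +
        ∑ g ∈ A.filter (fun g => ¬ badN p q Ω K η m' k g), φ g := by
    intro φ c hc h
    rw [← Finset.sum_filter_add_sum_filter_not A (fun g => badN p q Ω K η m' k g)]
    gcongr
    rw [Finset.sum_congr rfl (g := fun _ => c) (fun g hg => h g (Finset.mem_filter.1 hg).1
      (Finset.mem_filter.1 hg).2), Finset.sum_const, nsmul_eq_mul]
    gcongr
    exact fam_bad p q hg hKΩ hm hmm hC hA
  induction j generalizing k A with
  | zero =>
    refine (hsplit _ (M 0) (hM 0) (fun g _ hb => by rw [betaN, if_pos hb])).trans ?_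
    rw [Finset.sum_eq_zero (s := A.filter _)]
    · simp
    · intro g hg; rw [betaN, if_neg (Finset.mem_filter.1 hg).2]
  | succ j ih =>
    refine (hsplit _ (M (j + 1)) (hM _) (fun g _ hb => by rw [betaN, if_pos hb])).trans ?_
    rw [Finset.sum_range_succ']
    have h1 : ∑ g ∈ A.filter (fun g => ¬ badN p q Ω K η m' k g), betaN p q Ω K η S M m' (j + 1) k g =
        Real.exp S * ∑ a, ∑ h ∈ ((A.filter fun g => ¬ badN p q Ω K η m' k g).biUnion
          fun g => lifts p q Ω a g), betaN p q Ω K η S M m' j (k + 1) h := by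
      have : ∀ a, ∑ h ∈ ((A.filter fun g => ¬ badN p q Ω K η m' k g).biUnion
          fun g => lifts p q Ω a g), betaN p q Ω K η S M m' j (k + 1) h =
          ∑ g ∈ A.filter (fun g => ¬ badN p q Ω K η m' k g), ∑ h ∈ lifts p q Ω a g,
            betaN p q Ω K η S M m' j (k + 1) h := by
        intro a
        apply Finset.sum_biUnion
        intro g hgf g' hgf' hne
        rw [Function.onFun, Finset.disjoint_left]
        intro h hh hh'
        apply hne
        obtain ⟨t, ht⟩ := hΩn
        have hh1 := (Finset.mem_filter.1 hgf)
        have hh2 := (Finset.mem_filter.1 hgf')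
        have s1 := lifts_spec p q hg a hΩ hΩc ⟨t, ht⟩ (hA.1 g hh1.1).1 (fun t ht hV => hh1.2 (Or.inl ⟨t, ht, hV⟩))
        have s2 := lifts_spec p q hg a hΩ hΩc ⟨t, ht⟩ (hA.1 g' hh2.1).1 (fun t ht hV => hh2.2 (Or.inl ⟨t, ht, hV⟩))
        have e1 : ratEval (p a) (q a) (h t : Sphere) = g t := by
          apply (mem_fiber (hg.2.1 a) (hg.2.2.1 a) _ _).1
          rw [(s1.2 t ht).1]
          exact Multiset.mem_map.2 ⟨h, hh, rfl⟩
        have e2 : ratEval (p a) (q a) (h t : Sphere) = g' t := by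
          apply (mem_fiber (hg.2.1 a) (hg.2.2.1 a) _ _).1
          rw [(s2.2 t ht).1]
          exact Multiset.mem_map.2 ⟨h, hh', rfl⟩
        rw [e1] at e2
        exact (hA.2 g hh1.1 g' hh2.1 t ht t ht (OnePoint.coe_injective e2)).1
      simp only [this]
      rw [Finset.sum_comm, Finset.mul_sum]
      apply Finset.sum_congr rfl
      intro g hg
      rw [betaN, if_neg (Finset.mem_filter.1 hg).2]
    rw [h1]
    have h2 : ∀ a ∈ (Finset.univ : Finset (Fin N)), ∑ h ∈ ((A.filter fun g => ¬ badN p q Ω K η m' k g).biUnion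
          fun g => lifts p q Ω a g), betaN p q Ω K η S M m' j (k + 1) h ≤
          ∑ i ∈ Finset.range (j + 1),
      (N : ℝ) ^ i * Real.exp (i * S) * cbad p q m m' C (k + 1 + i) * M (j - i) := by
      intro a _
      have hF := fam_step p q hg a (K := K) (η := η) (m' := m') hΩ hΩc hΩn hA
      refine ih (k + 1) _ hF ?_
      intro φ c hc h
      rw [← Finset.sum_filter_add_sum_filter_not _ (fun g => badN p q Ω K η m' (k + 1) g)]
      gcongr
      rw [Finset.sum_congr rfl (g := fun _ => c) (fun g hg => h g (Finset.mem_filter.1 hg).1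
        (Finset.mem_filter.1 hg).2), Finset.sum_const, nsmul_eq_mul]
      gcongr
      exact fam_bad p q hg hKΩ hm hmm hC hF
    have h3 := Finset.sum_le_sum h2
    rw [Finset.sum_const, Finset.card_univ, Fintype.card_fin, nsmul_eq_mul] at h3
    have h4 := mul_le_mul_of_nonneg_left h3 (Real.exp_pos S).le
    rw [add_comm]
    refine add_le_add (h4.trans (le_of_eq ?_)) (le_of_eq (by simp))
    rw [Finset.mul_sum, Finset.mul_sum]
    apply Finset.sum_congr rfl
    intro i hi
    have e1 : Real.exp (((i + 1 : ℕ) : ℝ) * S) = Real.exp S * Real.exp (i * S) := by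
      rw [← Real.exp_add]; congr 1; push_cast; ring
    rw [e1, show k + (i + 1) = k + 1 + i by ring, show j + 1 - (i + 1) = j - i by omega, pow_succ]
    ring

lemma LSum_lift (hg : Good p q) {Ω : Set ℂ} (fe : SymX N → ℝ) {g : ℂ → ℂ}
    (hs : ∀ a, liftSpec p q Ω a g (lifts p q Ω a g)) (j : ℕ) (w : ℕ → Fin N) {t : ℂ} (ht : t ∈ Ω) :
    LSum p q fe (j + 1) (w, (g t : Sphere)) = ∑ a, ∑ h ∈ lifts p q Ω a g,
      Real.exp (fe (consW a w, (h t : Sphere))) * LSum p q fe j (consW a w, (h t : Sphere)) := by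
  rw [LSum_succ p q hg, preimT]
  rw [show ∀ (φ : SymX N → ℝ) (s : Fin N → Multiset (SymX N)), (Multiset.map φ (∑ v, s v)).sum =
    ∑ v, ((s v).map φ).sum from fun φ s =>
      map_sum (Multiset.sumAddMonoidHom.comp (Multiset.mapAddMonoidHom φ)) s Finset.univ]
  apply Finset.sum_congr rfl
  intro a _
  simp only []
  rw [((hs a).2 t ht).1, Multiset.map_map, Multiset.map_map]
  rfl

lemma shiftDist_le {w w' : ℕ → Fin N} {k : ℕ} (h : ∀ i < k, w i = w' i) :
    shiftDist w w' ≤ (2 : ℝ)⁻¹ ^ k := by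
  unfold shiftDist
  split_ifs with hex
  · apply pow_le_pow_of_le_one (by norm_num) (by norm_num)
    have : k ≤ Nat.find hex := by
      by_contra hlt
      exact Nat.find_spec hex (h _ (not_le.1 hlt))
    omega
  · positivity

lemma tree_ind (hg : Good p q) {Ω K : Set ℂ} (hΩ : IsOpen Ω) (hΩc : Convex ℝ Ω)
    (hΩn : Ω.Nonempty) (hKΩ : K ⊆ Ω) {fe : SymX N → ℝ} {η S B ε : ℝ} {M : ℕ → ℝ} {m' : ℕ}
    (hM : ∀ j, ∀ x ∈ juliaSet p q, LSum p q fe j x ≤ M j)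
    (hS : ∀ x ∈ juliaSet p q, fe x ≤ S) (hB : ∀ x ∈ juliaSet p q, |fe x| ≤ B)
    (hB0 : 0 ≤ B) (hε : 0 ≤ ε)
    (hfd : ∀ x ∈ juliaSet p q, ∀ y ∈ juliaSet p q, dX x y ≤ η → |fe x - fe y| ≤ ε)
    (hm' : (2 : ℝ)⁻¹ ^ m' ≤ η) {t t' : ℂ} (ht : t ∈ K) (ht' : t' ∈ K) (j k : ℕ) (g : ℂ → ℂ)
    (hgd : DifferentiableOn ℂ g Ω) (w w' : ℕ → Fin N) (hw : ∀ i < k, w i = w' i)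
    (hx : (w, (g t : Sphere)) ∈ juliaSet p q) (hy : (w', (g t' : Sphere)) ∈ juliaSet p q) :
    Real.exp (-(2 * B * ((m' - k : ℕ) : ℝ) + ε * j)) *
      (LSum p q fe j (w', (g t' : Sphere)) - betaN p q Ω K η S M m' j k g) ≤
        LSum p q fe j (w, (g t : Sphere)) := by
  have hM0 : ∀ j, 0 ≤ M j := fun j => (LSum_nonneg p q fe j _).trans (hM j _ hx)
  induction j generalizing k g w w' with
  | zero =>
    rw [LSum_zero, LSum_zero]
    have h1 := betaN_nonneg p q (Ω := Ω) (K := K) (η := η) (S := S) (m' := m') hM0 0 k g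
    have h2 : Real.exp (-(2 * B * ((m' - k : ℕ) : ℝ) + ε * (0:ℕ))) ≤ 1 := by
      rw [Real.exp_le_one_iff]
      have : 0 ≤ 2 * B * ((m' - k : ℕ) : ℝ) := by positivity
      simp; linarith
    have h3 := Real.exp_pos (-(2 * B * ((m' - k : ℕ) : ℝ) + ε * (0:ℕ)))
    nlinarith
  | succ j ih =>
    by_cases hbad : badN p q Ω K η m' k g
    · rw [betaN, if_pos hbad]
      have h1 := hM (j + 1) _ hy
      refine le_trans ?_ (LSum_nonneg p q fe _ _)
      exact mul_nonpos_of_nonneg_of_nonpos (Real.exp_pos _).le (by linarith)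
    have hs : ∀ a, liftSpec p q Ω a g (lifts p q Ω a g) := fun a =>
      lifts_spec p q hg a hΩ hΩc hΩn hgd (fun t ht hV => hbad (Or.inl ⟨t, ht, hV⟩))
    rw [betaN, if_neg hbad, LSum_lift p q hg fe hs j w (hKΩ ht), LSum_lift p q hg fe hs j w' (hKΩ ht'),
      Finset.mul_sum, ← Finset.sum_sub_distrib, Finset.mul_sum]
    apply Finset.sum_le_sum
    intro a _
    rw [Finset.mul_sum, ← Finset.sum_sub_distrib, Finset.mul_sum]
    apply Finset.sum_le_sum
    intro h hh
    have hJ : ∀ (w : ℕ → Fin N) (t : ℂ), t ∈ Ω → (w, (g t : Sphere)) ∈ juliaSet p q →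
        (consW a w, (h t : Sphere)) ∈ juliaSet p q := by
      intro w t ht hx
      apply julia_preimT hg hx
      rw [preimT, Multiset.mem_sum]
      refine ⟨a, Finset.mem_univ _, Multiset.mem_map.2 ⟨h t, ?_, rfl⟩⟩
      simp only []
      rw [((hs a).2 t ht).1]
      exact Multiset.mem_map.2 ⟨h, hh, rfl⟩
    have hx' := hJ w t (hKΩ ht) hx
    have hy' := hJ w' t' (hKΩ ht') hy
    have hw' : ∀ i < k + 1, consW a w i = consW a w' i := by
      intro i hi
      cases i with
      | zero => rfl
      | succ i => rw [consW_succ, consW_succ]; exact hw i (by omega)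
    have IH := ih (k + 1) h ((hs a).1 h hh).1 (consW a w) (consW a w') hw' hx' hy'
    set Lx := LSum p q fe j (consW a w, (h t : Sphere))
    set Ly := LSum p q fe j (consW a w', (h t' : Sphere))
    set fx := fe (consW a w, (h t : Sphere))
    set fy := fe (consW a w', (h t' : Sphere))
    set β := betaN p q Ω K η S M m' j (k + 1) h with hβ
    have hβ0 : 0 ≤ β := betaN_nonneg p q hM0 _ _ _
    have hLx : 0 ≤ Lx := LSum_nonneg p q _ _ _
    have hfyS : Real.exp fy ≤ Real.exp S := Real.exp_le_exp.2 (hS _ hy')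
    have h0 : Real.exp fy * Ly - Real.exp S * β ≤ Real.exp fy * (Ly - β) := by nlinarith
    refine (mul_le_mul_of_nonneg_left h0 (Real.exp_pos _).le).trans ?_
    by_cases hneg : Ly - β ≤ 0
    · have : Real.exp fy * (Ly - β) ≤ 0 := mul_nonpos_of_nonneg_of_nonpos (Real.exp_pos _).le hneg
      refine le_trans (mul_nonpos_of_nonneg_of_nonpos (Real.exp_pos _).le this) ?_
      positivity
    rw [not_le] at hneg
    have hnb : ¬ badN p q Ω K η m' (k + 1) h := by
      intro hb
      have : β = M j := by
        rw [hβ]; cases j <;> rw [betaN, if_pos hb]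
      have := hM j _ hy'
      linarith
    have hdiff : fy ≤ fx + (2 * B * ((m' - k : ℕ) : ℝ) - 2 * B * ((m' - (k + 1) : ℕ) : ℝ) + ε) := by
      by_cases hk : m' ≤ k + 1
      · have hd : dX (consW a w, (h t : Sphere)) (consW a w', (h t' : Sphere)) ≤ η := by
          apply max_le
          · refine (shiftDist_le hw').trans (le_trans ?_ hm')
            exact pow_le_pow_of_le_one (by norm_num) (by norm_num) hk
          · by_contra hlt
            exact hnb (Or.inr ⟨hk, t, ht, t', ht', (not_le.1 hlt).le⟩)
        have h1 := hfd _ hx' _ hy' hd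
        have h2 : 0 ≤ 2 * B * ((m' - k : ℕ) : ℝ) := by positivity
        rw [show m' - (k + 1) = 0 by omega]
        have h3 := (abs_le.1 h1).1
        simp only [fx, fy]
        push_cast
        linarith
      · have e1 : ((m' - k : ℕ) : ℝ) = ((m' - (k + 1) : ℕ) : ℝ) + 1 := by
          rw [show m' - k = m' - (k + 1) + 1 by omega]; push_cast; ring
        rw [e1]
        have h1 := (abs_le.1 (hB _ hx')).1
        have h2 := (abs_le.1 (hB _ hy')).2
        simp only [fx, fy]
        linarith
    calc Real.exp (-(2 * B * ((m' - k : ℕ) : ℝ) + ε * (j + 1 : ℕ))) * (Real.exp fy * (Ly - β))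
        = Real.exp (-(2 * B * ((m' - k : ℕ) : ℝ) + ε * (j + 1 : ℕ)) + fy) * (Ly - β) := by
          rw [Real.exp_add]; ring
      _ ≤ Real.exp (fx + -(2 * B * ((m' - (k + 1) : ℕ) : ℝ) + ε * j)) * (Ly - β) := by
          refine mul_le_mul_of_nonneg_right (Real.exp_le_exp.2 ?_) hneg.le
          rw [Nat.cast_add, Nat.cast_one]
          linarith
      _ = Real.exp fx * (Real.exp (-(2 * B * ((m' - (k + 1) : ℕ) : ℝ) + ε * j)) * (Ly - β)) := by
          rw [Real.exp_add]; ring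
      _ ≤ _ := by gcongr

lemma tree_compare (hg : Good p q) {Ω K : Set ℂ} {ψ : ℂ → ℂ} {m m' C : ℕ}
    (hch : Chart {z : ℂ | (z : Sphere) ∈ Fset p q m} Ω K ψ)
    {fe : SymX N → ℝ} {η S B ε : ℝ} {M : ℕ → ℝ} (hC : AreaB Ω K η C) (hm : 1 ≤ m) (hmm : m ≤ m')
    (hM : ∀ j, ∀ x ∈ juliaSet p q, LSum p q fe j x ≤ M j)
    (hS : ∀ x ∈ juliaSet p q, fe x ≤ S) (hB : ∀ x ∈ juliaSet p q, |fe x| ≤ B)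
    (hB0 : 0 ≤ B) (hε : 0 ≤ ε)
    (hfd : ∀ x ∈ juliaSet p q, ∀ y ∈ juliaSet p q, dX x y ≤ η → |fe x - fe y| ≤ ε)
    (hm' : (2 : ℝ)⁻¹ ^ m' ≤ η) {t t' : ℂ} (ht : t ∈ K) (ht' : t' ∈ K) (n : ℕ)
    (w w' : ℕ → Fin N) (hx : (w, (ψ t : Sphere)) ∈ juliaSet p q)
    (hy : (w', (ψ t' : Sphere)) ∈ juliaSet p q) :
    Real.exp (-(2 * B * m' + ε * n)) *
      (LSum p q fe n (w', (ψ t' : Sphere)) - ∑ i ∈ Finset.range (n + 1),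
      (N : ℝ) ^ i * Real.exp (i * S) * cbad p q m m' C i * M (n - i)) ≤
        LSum p q fe n (w, (ψ t : Sphere)) := by
  obtain ⟨hΩ, hΩc, hK, hKc, hKΩ, hψd, hψi, hψF⟩ := hch
  have hΩn : Ω.Nonempty := ⟨t, hKΩ ht⟩
  have hM0 : ∀ j, 0 ≤ M j := fun j => (LSum_nonneg p q fe j _).trans (hM j _ hx)
  have h1 := tree_ind p q hg hΩ hΩc hΩn hKΩ hM hS hB hB0 hε hfd hm' ht ht' n 0 ψ hψd w w'
    (by simp) hx hy
  refine le_trans ?_ h1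
  have hfam : Fam p q Ω m 0 {ψ} := by
    constructor
    · intro g hg
      rw [Finset.mem_singleton] at hg
      subst hg
      exact ⟨hψd, fun h => by omega, fun t ht => hψF t ht⟩
    · intro g hg g' hg' s hs s' hs' he
      rw [Finset.mem_singleton] at hg hg'
      subst hg; subst hg'
      exact ⟨rfl, hψi hs hs' he⟩
  have h2 := beta_sum p q hg hΩ hΩc hΩn hKΩ (S := S) hM0 hm hmm hC n 0 {ψ} hfam
  rw [Finset.sum_singleton] at h2
  simp only [zero_add] at h2
  rw [Nat.sub_zero]
  gcongr

lemma sphDist_bounds (z w : Sphere) : 0 ≤ sphDist z w ∧ sphDist z w ≤ 2 := by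
  have hs : ∀ a : ℂ, 1 ≤ Real.sqrt (1 + ‖a‖ ^ 2) := fun a => by
    rw [Real.one_le_sqrt]; nlinarith [sq_nonneg ‖a‖]
  have h2 : ∀ a : ℂ, 0 ≤ 2 / Real.sqrt (1 + ‖a‖ ^ 2) ∧ 2 / Real.sqrt (1 + ‖a‖ ^ 2) ≤ 2 := fun a =>
    ⟨by positivity, div_le_self (by norm_num) (hs a)⟩
  induction z using OnePoint.rec with
  | infty =>
    induction w using OnePoint.rec with
    | infty => exact ⟨le_rfl, zero_le_two⟩
    | coe b => exact h2 b
  | coe a =>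
    induction w using OnePoint.rec with
    | infty => exact h2 a
    | coe b =>
      rw [sphDist_coe]
      have ha := hs a
      have hb := hs b
      refine ⟨by positivity, ?_⟩
      rw [div_le_iff₀ (by positivity)]
      have h3 : dist a b ≤ ‖a‖ + ‖b‖ := by rw [dist_eq_norm]; exact norm_sub_le _ _
      have h4 : ‖a‖ + ‖b‖ ≤ Real.sqrt (1 + ‖a‖ ^ 2) * Real.sqrt (1 + ‖b‖ ^ 2) := by
        rw [← Real.sqrt_mul (by positivity)]
        apply Real.le_sqrt_of_sq_le
        nlinarith [sq_nonneg (‖a‖ * ‖b‖ - 1)]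
      nlinarith

lemma dX_bounds (x y : SymX N) : 0 ≤ dX x y ∧ dX x y ≤ 2 := by
  have h := sphDist_bounds x.2 y.2
  refine ⟨h.1.trans (le_max_right _ _), max_le ?_ h.2⟩
  have := shiftDist_le (w := x.1) (w' := y.1) (k := 0) (by simp)
  rw [pow_zero] at this
  linarith

lemma holder_facts {f : ↥(juliaSet p q) → ℝ} (hf : HolderOnJ p q f) :
    (∃ B, 0 ≤ B ∧ ∀ x ∈ juliaSet p q, |jextend p q f x| ≤ B) ∧
    ∀ ε > 0, ∃ η > 0, ∀ x ∈ juliaSet p q, ∀ y ∈ juliaSet p q, dX x y ≤ η →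
      |jextend p q f x - jextend p q f y| ≤ ε := by
  obtain ⟨C, hC, α, hα, h⟩ := hf
  constructor
  · rcases (juliaSet p q).eq_empty_or_nonempty with he | ⟨x0, hx0⟩
    · exact ⟨0, le_rfl, fun x hx => by rw [he] at hx; exact hx.elim⟩
    · refine ⟨|f ⟨x0, hx0⟩| + C * 2 ^ α, by positivity, ?_⟩
      intro x hx
      rw [jextend, dif_pos hx]
      have h1 := h ⟨x, hx⟩ ⟨x0, hx0⟩
      have h2 : dX x x0 ^ α ≤ 2 ^ α :=
        Real.rpow_le_rpow (dX_bounds _ _).1 (dX_bounds _ _).2 hα.1.le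
      have h3 : |f ⟨x, hx⟩| ≤ |f ⟨x0, hx0⟩| + |f ⟨x, hx⟩ - f ⟨x0, hx0⟩| := by
        have := abs_add_le (f ⟨x0, hx0⟩) (f ⟨x, hx⟩ - f ⟨x0, hx0⟩)
        rwa [add_sub_cancel] at this
      have h4 : C * dX x x0 ^ α ≤ C * 2 ^ α := by gcongr
      simp only at h1
      linarith
  · intro ε hε
    refine ⟨(ε / C) ^ α⁻¹, Real.rpow_pos_of_pos (by positivity) _, ?_⟩
    intro x hx y hy hd
    rw [jextend, dif_pos hx, jextend, dif_pos hy]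
    refine (h ⟨x, hx⟩ ⟨y, hy⟩).trans ?_
    have h2 : dX x y ^ α ≤ ((ε / C) ^ α⁻¹) ^ α :=
      Real.rpow_le_rpow (dX_bounds _ _).1 hd hα.1.le
    rw [Real.rpow_inv_rpow (by positivity) hα.1.ne', le_div_iff₀ hC] at h2
    simp only
    linarith

lemma LSum_lower (hg : Good p q) {fe : SymX N → ℝ} {B : ℝ}
    (hB : ∀ x ∈ juliaSet p q, |fe x| ≤ B) (n : ℕ) : ∀ x ∈ juliaSet p q,
    Real.exp (-B * n) ≤ LSum p q fe n x := by
  induction n with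
  | zero => intro x _; simp [LSum_zero]
  | succ n ih =>
    intro x hx
    rw [LSum_succ p q hg]
    obtain ⟨y, hy⟩ := exists_preimT p q hg x
    have hyJ := julia_preimT hg hx hy
    have h1 : Real.exp (fe y) * LSum p q fe n y ≤
        ((preimT p q x).map fun y => Real.exp (fe y) * LSum p q fe n y).sum := by
      apply Multiset.single_le_sum
      · intro a ha
        obtain ⟨b, _, rfl⟩ := Multiset.mem_map.1 ha
        exact mul_nonneg (Real.exp_pos _).le (LSum_nonneg p q _ _ _)
      · exact Multiset.mem_map.2 ⟨y, hy, rfl⟩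
    refine le_trans ?_ h1
    have h2 := (abs_le.1 (hB y hyJ)).1
    calc Real.exp (-B * (n + 1 : ℕ)) = Real.exp (-B) * Real.exp (-B * n) := by
          rw [← Real.exp_add]; congr 1; push_cast; ring
      _ ≤ _ := by
        gcongr
        exact ih y hyJ

lemma LSum_upper (hg : Good p q) {fe : SymX N → ℝ} {S : ℝ}
    (hS : ∀ x ∈ juliaSet p q, fe x ≤ S) (n : ℕ) : ∀ x ∈ juliaSet p q,
    LSum p q fe n x ≤ (Dtot p q * Real.exp S) ^ n := by
  induction n with
  | zero => intro x _; simp [LSum_zero]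
  | succ n ih =>
    intro x hx
    rw [LSum_succ p q hg]
    refine (sum_le_card_mul _ _ (Real.exp S * (Dtot p q * Real.exp S) ^ n) ?_).trans ?_
    · intro y hy
      have hyJ := julia_preimT hg hx hy
      have := ih y hyJ
      have := hS y hyJ
      have := LSum_nonneg p q fe n y
      gcongr
    · rw [card_preimT]
      apply le_of_eq; ring

def MM (fe : SymX N → ℝ) (n : ℕ) : ℝ := ⨆ x : ↥(juliaSet p q), LSum p q fe n x

lemma MM_bdd (hg : Good p q) {fe : SymX N → ℝ} {S : ℝ}
    (hS : ∀ x ∈ juliaSet p q, fe x ≤ S) (n : ℕ) :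
    BddAbove (Set.range fun x : ↥(juliaSet p q) => LSum p q fe n x) := by
  refine ⟨(Dtot p q * Real.exp S) ^ n, ?_⟩
  rintro _ ⟨x, rfl⟩
  exact LSum_upper p q hg hS n x x.2

lemma LSum_le_MM (hg : Good p q) {fe : SymX N → ℝ} {S : ℝ}
    (hS : ∀ x ∈ juliaSet p q, fe x ≤ S) (n : ℕ) : ∀ x ∈ juliaSet p q,
    LSum p q fe n x ≤ MM p q fe n := fun x hx =>
  le_ciSup (MM_bdd p q hg hS n) ⟨x, hx⟩

lemma sum_map_le {α : Type*} (s : Multiset α) (g h : α → ℝ) (H : ∀ a ∈ s, g a ≤ h a) :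
    (s.map g).sum ≤ (s.map h).sum := Multiset.sum_map_le_sum_map _ _ H

lemma MM_sub (hg : Good p q) (hne : (juliaSet p q).Nonempty) {fe : SymX N → ℝ} {S : ℝ}
    (hS : ∀ x ∈ juliaSet p q, fe x ≤ S) (m n : ℕ) :
    MM p q fe (m + n) ≤ MM p q fe m * MM p q fe n := by
  have : Nonempty ↥(juliaSet p q) := hne.to_subtype
  apply ciSup_le
  rintro ⟨x, hx⟩
  simp only
  rw [LSum_add p q hg]
  have h1 : ((preimTn p q m x).map fun y => Real.exp (birk p q fe m y) * LSum p q fe n y).sum ≤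
      ((preimTn p q m x).map fun y => Real.exp (birk p q fe m y) * MM p q fe n).sum := by
    apply sum_map_le
    intro y hy
    gcongr
    exact LSum_le_MM p q hg hS n y (julia_preimTn hg hx hy)
  refine h1.trans ?_
  rw [Multiset.sum_map_mul_right]
  have h2 : 0 ≤ MM p q fe n := (LSum_nonneg p q fe n x).trans (LSum_le_MM p q hg hS n x hx)
  exact mul_le_mul_of_nonneg_right (LSum_le_MM p q hg hS m x hx) h2

lemma MM_zero (hne : (juliaSet p q).Nonempty) (fe : SymX N → ℝ) : MM p q fe 0 = 1 := by
  have : Nonempty ↥(juliaSet p q) := hne.to_subtype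
  simp [MM, LSum_zero]

lemma Fset_finite (hg : Good p q) (m : ℕ) : (Fset p q m).Finite := by
  induction m with
  | zero => exact Set.finite_empty
  | succ m ih =>
    rw [Fset]
    exact (Vset_finite p q hg).union (Set.finite_iUnion fun a => ih.image _)

lemma Fset_card (hg : Good p q) (m : ℕ) :
    (Fset p q m).ncard ≤ (Vset p q).ncard * (N + 1) ^ m := by
  induction m with
  | zero => simp [Fset]
  | succ m ih =>
    rw [Fset]
    have h1 : (⋃ a, ratEval (p a) (q a) '' Fset p q m).ncard ≤ N * (Fset p q m).ncard := by
      have hfin := Fset_finite p q hg m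
      have e : (⋃ a, ratEval (p a) (q a) '' Fset p q m) =
          ((Finset.univ.biUnion fun a : Fin N => hfin.toFinset.image (ratEval (p a) (q a)) : Finset Sphere) : Set Sphere) := by
        ext z; simp
      rw [e, Set.ncard_coe_finset]
      refine (Finset.card_biUnion_le_card_mul _ _ (Fset p q m).ncard ?_).trans (by simp)
      intro a _
      rw [Set.ncard_eq_toFinset_card _ hfin]
      exact Finset.card_image_le
    have h2 := Set.ncard_union_le (Vset p q) (⋃ a, ratEval (p a) (q a) '' Fset p q m)
    have h3 : 1 ≤ (N + 1) ^ m := Nat.one_le_pow _ _ (by omega)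
    calc _ ≤ (Vset p q).ncard + N * ((Vset p q).ncard * (N + 1) ^ m) := by nlinarith
      _ ≤ _ := by rw [pow_succ]; nlinarith [Nat.zero_le (Vset p q).ncard]

lemma seq_facts {M : ℕ → ℝ} (h0 : M 0 = 1) {B : ℝ} (hlow : ∀ n : ℕ, Real.exp (-B * n) ≤ M n)
    (hsub : ∀ m n, M (m + n) ≤ M m * M n) :
    ∃ P' : ℝ, (∀ n : ℕ, Real.exp (n * P') ≤ M n) ∧
      (∀ δ > 0, ∃ C > 0, ∀ n : ℕ, M n ≤ C * Real.exp (n * (P' + δ))) ∧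
      (∀ δ > 0, ∀ n0 : ℕ, ∃ n ≥ n0, ∀ k : ℕ, k ≤ n → M (n - k) ≤ Real.exp (-(k * (P' - δ))) * M n) := by
  have hpos : ∀ n, 0 < M n := fun n => (Real.exp_pos _).trans_le (hlow n)
  have hsa : Subadditive (fun n => Real.log (M n)) := by
    intro m n
    rw [← Real.log_mul (hpos m).ne' (hpos n).ne']
    exact Real.log_le_log (hpos _) (hsub m n)
  have hll : ∀ n : ℕ, -B * n ≤ Real.log (M n) := fun n => by
    rw [Real.le_log_iff_exp_le (hpos n)]; exact hlow n
  have hbdd : BddBelow (Set.range fun n : ℕ => Real.log (M n) / n) := by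
    refine ⟨min 0 (-B), ?_⟩
    rintro _ ⟨n, rfl⟩
    rcases Nat.eq_zero_or_pos n with rfl | hn
    · simp
    · have : (0:ℝ) < n := by exact_mod_cast hn
      exact (min_le_right _ _).trans ((le_div_iff₀ this).2 (hll n))
  have hlim := hsa.tendsto_lim hbdd
  have hle : ∀ n : ℕ, n * hsa.lim ≤ Real.log (M n) := by
    intro n
    rcases Nat.eq_zero_or_pos n with rfl | hn
    · simp [h0]
    · have h1 := hsa.lim_le_div hbdd hn.ne'
      have : (0:ℝ) < n := by exact_mod_cast hn
      rw [le_div_iff₀ this] at h1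
      linarith
  refine ⟨hsa.lim, ?_, ?_, ?_⟩
  · intro n
    rw [← Real.le_log_iff_exp_le (hpos n)]; exact hle n
  · intro δ hδ
    have h1 : ∀ᶠ n : ℕ in atTop, Real.log (M n) / n < hsa.lim + δ :=
      hlim.eventually (gt_mem_nhds (by linarith))
    obtain ⟨n0, hn0⟩ := eventually_atTop.1 (h1.and (eventually_gt_atTop 0))
    refine ⟨1 + ∑ i ∈ Finset.range n0, M i / Real.exp (i * (hsa.lim + δ)), ?_, ?_⟩
    · have : 0 ≤ ∑ i ∈ Finset.range n0, M i / Real.exp (i * (hsa.lim + δ)) :=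
        Finset.sum_nonneg fun i _ => div_nonneg (hpos i).le (Real.exp_pos _).le
      linarith
    · intro n
      rw [← div_le_iff₀ (Real.exp_pos _)]
      by_cases hn : n < n0
      · have := Finset.single_le_sum (f := fun i : ℕ => M i / Real.exp (i * (hsa.lim + δ)))
          (fun i _ => div_nonneg (hpos i).le (Real.exp_pos _).le) (Finset.mem_range.2 hn)
        linarith
      · have h2 := hn0 n (not_lt.1 hn)
        have h3 : (0:ℝ) < n := by exact_mod_cast h2.2
        have h4 := (div_lt_iff₀ h3).1 h2.1
        have h5 : 0 ≤ ∑ i ∈ Finset.range n0, M i / Real.exp (i * (hsa.lim + δ)) :=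
          Finset.sum_nonneg fun i _ => div_nonneg (hpos i).le (Real.exp_pos _).le
        have h6 : M n / Real.exp (n * (hsa.lim + δ)) ≤ 1 := by
          rw [div_le_one (Real.exp_pos _), ← Real.log_le_iff_le_exp (hpos n)]
          linarith
        linarith
  · intro δ hδ n0
    have hu : Tendsto (fun n : ℕ => Real.log (M n) - n * (hsa.lim - δ)) atTop atTop := by
      refine tendsto_atTop_mono (f := fun n : ℕ => (n : ℝ) * δ) ?_
        (tendsto_natCast_atTop_atTop.atTop_mul_const hδ)
      intro n
      have := hle n
      nlinarith
    obtain ⟨n, hn, h⟩ := Filter.high_scores hu n0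
    refine ⟨n, hn, ?_⟩
    intro k hk
    rcases Nat.eq_zero_or_pos k with rfl | hk0
    · simp
    have h1 := h (n - k) (by omega)
    rw [Nat.cast_sub hk] at h1
    rw [← Real.exp_log (hpos (n-k)), ← Real.exp_log (hpos n), ← Real.exp_add, Real.exp_le_exp]
    linarith

lemma params {κ N A V Kc : ℝ} (hκ : 0 < κ) (hN : 1 ≤ N) (hA : 0 ≤ A) (hV : 0 ≤ V) (hK : 0 ≤ Kc)
    (Cd : ℝ → ℝ) (hCd : ∀ δ > 0, 0 < Cd δ) :
    ∃ δ > 0, δ ≤ κ / 4 ∧ ∃ m : ℕ, 1 ≤ m ∧ ∃ k : ℕ,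
      Real.exp (-(k * (κ - δ))) * (A * (N + 1) ^ m) * Kc ≤ 1 / 4 ∧
      N ^ k * (A * (N + 1) ^ m) * Kc < (N + 1) ^ k ∧
      V * Real.exp (-(m * (κ / 2))) * (1 - Real.exp (-(κ / 2)))⁻¹ * Cd δ * Real.exp (2 * k * δ)
        ≤ 1 / 16 := by
  have hN0 : 0 < N := by linarith
  have t1 : Tendsto (fun r : ℕ => (Real.exp (-(κ / 2))) ^ r * (N + 1)) atTop (𝓝 (0 * (N + 1))) :=
    (tendsto_pow_atTop_nhds_zero_of_lt_one (Real.exp_pos _).le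
      (by rw [Real.exp_lt_one_iff]; linarith)).mul_const _
  have t2 : Tendsto (fun r : ℕ => (N / (N + 1)) ^ r * (N + 1)) atTop (𝓝 (0 * (N + 1))) :=
    (tendsto_pow_atTop_nhds_zero_of_lt_one (by positivity)
      (by rw [div_lt_one (by linarith)]; linarith)).mul_const _
  rw [zero_mul] at t1 t2
  obtain ⟨r, ⟨hr1, hr2⟩, hr0⟩ := ((t1.eventually (gt_mem_nhds (by norm_num : (0:ℝ) < 1/2))).and
    (t2.eventually (gt_mem_nhds (by norm_num : (0:ℝ) < 1/2)))).and (eventually_gt_atTop 0) |>.exists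
  have hr0' : (0:ℝ) < r := by exact_mod_cast hr0
  set δ := min (κ / 4) (κ / (8 * r)) with hδ
  have hδ0 : 0 < δ := lt_min (by linarith) (by positivity)
  have hδ1 : δ ≤ κ / 4 := min_le_left _ _
  have hδ2 : r * δ ≤ κ / 8 := by
    have : δ ≤ κ / (8 * r) := min_le_right _ _
    calc r * δ ≤ r * (κ / (8 * r)) := by gcongr
      _ = κ / 8 := by field_simp
  refine ⟨δ, hδ0, hδ1, ?_⟩
  have t3 : Tendsto (fun m : ℕ => ((1:ℝ)/2) ^ m * (A * Kc)) atTop (𝓝 (0 * (A * Kc))) :=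
    (tendsto_pow_atTop_nhds_zero_of_lt_one (by norm_num) (by norm_num)).mul_const _
  have t4 : Tendsto (fun m : ℕ => (Real.exp (-(κ / 4))) ^ m *
      (V * (1 - Real.exp (-(κ / 2)))⁻¹ * Cd δ)) atTop
      (𝓝 (0 * (V * (1 - Real.exp (-(κ / 2)))⁻¹ * Cd δ))) :=
    (tendsto_pow_atTop_nhds_zero_of_lt_one (Real.exp_pos _).le
      (by rw [Real.exp_lt_one_iff]; linarith)).mul_const _
  rw [zero_mul] at t3 t4
  obtain ⟨m, ⟨hm1, hm2⟩, hm0⟩ := ((t3.eventually (gt_mem_nhds (by norm_num : (0:ℝ) < 1/4))).and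
    (t4.eventually (gt_mem_nhds (by norm_num : (0:ℝ) < 1/16)))).and (eventually_gt_atTop 0) |>.exists
  have hm0' : (0:ℝ) < m := by exact_mod_cast hm0
  have hE : 0 < 1 - Real.exp (-(κ / 2)) := by
    have : Real.exp (-(κ / 2)) < 1 := by rw [Real.exp_lt_one_iff]; linarith
    linarith
  refine ⟨m, hm0, r * m, ?_, ?_, ?_⟩
  · refine le_trans ?_ hm1.le
    have h1 : Real.exp (-(((r * m : ℕ) : ℝ) * (κ - δ))) ≤ (Real.exp (-(κ / 2)) ^ r) ^ m := by
      rw [← pow_mul, ← Real.exp_nat_mul, Real.exp_le_exp]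
      have : (0:ℝ) ≤ ((r * m : ℕ) : ℝ) := by positivity
      nlinarith
    calc Real.exp (-(((r * m : ℕ) : ℝ) * (κ - δ))) * (A * (N + 1) ^ m) * Kc
        ≤ (Real.exp (-(κ / 2)) ^ r) ^ m * (A * (N + 1) ^ m) * Kc := by gcongr
      _ = (Real.exp (-(κ / 2)) ^ r * (N + 1)) ^ m * (A * Kc) := by rw [mul_pow]; ring
      _ ≤ _ := by gcongr
  · have h2 : ((N / (N + 1)) ^ r * (N + 1)) ^ m * (A * Kc) < 1 := by
      refine lt_of_le_of_lt ?_ (hm1.trans (by norm_num))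
      gcongr
    have h3 : (0:ℝ) < (N + 1) ^ (r * m) := by positivity
    calc N ^ (r * m) * (A * (N + 1) ^ m) * Kc
        = (((N / (N + 1)) ^ r * (N + 1)) ^ m * (A * Kc)) * (N + 1) ^ (r * m) := by
          rw [mul_pow, div_pow, div_pow, ← pow_mul, ← pow_mul]
          field_simp
      _ < 1 * (N + 1) ^ (r * m) := by gcongr
      _ = _ := one_mul _
  · refine le_trans ?_ hm2.le
    have h1 : Real.exp (-(m * (κ / 2))) * Real.exp (2 * ((r * m : ℕ) : ℝ) * δ) ≤
        Real.exp (-(κ / 4)) ^ m := by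
      rw [← Real.exp_add, ← Real.exp_nat_mul, Real.exp_le_exp]
      push_cast
      nlinarith
    have h2 := hCd δ hδ0
    calc _ = (Real.exp (-(m * (κ / 2))) * Real.exp (2 * ((r * m : ℕ) : ℝ) * δ)) *
          (V * (1 - Real.exp (-(κ / 2)))⁻¹ * Cd δ) := by ring
      _ ≤ _ := by
        apply mul_le_mul_of_nonneg_right h1
        positivity

lemma geom_tail {κ : ℝ} (hκ : 0 < κ) (m n : ℕ) :
    ∑ i ∈ Finset.range n, (if i < m then 0 else Real.exp (-(i * (κ / 2)))) ≤
      Real.exp (-(m * (κ / 2))) * (1 - Real.exp (-(κ / 2)))⁻¹ := by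
  have hlt : Real.exp (-(κ / 2)) < 1 := by rw [Real.exp_lt_one_iff]; linarith
  have hE : ∀ i : ℕ, Real.exp (-(i * (κ / 2))) = Real.exp (-(κ / 2)) ^ i := by
    intro i
    rw [← Real.exp_nat_mul]; congr 1; ring
  simp_rw [hE]
  set x := Real.exp (-(κ / 2)) with hx
  have hx0 : 0 < x := Real.exp_pos _
  have h1 : 0 < 1 - x := by linarith
  have key : ∀ n, m ≤ n → ∑ i ∈ Finset.range n, (if i < m then 0 else x ^ i) ≤ x ^ m * (1 - x)⁻¹ - x ^ n * (1 - x)⁻¹ := by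
    intro n hn
    induction n, hn using Nat.le_induction with
    | base =>
      rw [Finset.sum_eq_zero]
      · linarith
      · intro i hi
        rw [if_pos (Finset.mem_range.1 hi)]
    | succ n hn ih =>
      rw [Finset.sum_range_succ, if_neg (by omega)]
      have : x ^ n = x ^ n * (1 - x)⁻¹ - x ^ (n + 1) * (1 - x)⁻¹ := by
        field_simp; ring
      linarith
  have h2 := key (n + m) (by omega)
  have h3 : 0 ≤ x ^ (n + m) * (1 - x)⁻¹ := by positivity
  refine le_trans (Finset.sum_le_sum_of_subset_of_nonneg (t := Finset.range (n + m)) ?_ ?_) (by linarith)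
  · apply Finset.range_mono; omega
  · intro i _ _
    split_ifs <;> positivity

lemma bad_sum {M : ℕ → ℝ} (hpos : ∀ n, 0 < M n) {P' δ S κ Cd V C : ℝ} (hN : 1 ≤ N)
    (hκ0 : 0 < κ) (hκ : κ = P' - S - Real.log N) (hδ : δ ≤ κ / 4) {m m' n k : ℕ}
    (hkn : k ≤ n) (hrec : ∀ j : ℕ, j ≤ n → M (n - j) ≤ Real.exp (-(j * (P' - δ))) * M n)
    (hMk : M k ≤ Cd * Real.exp (k * (P' + δ))) (hV0 : 0 ≤ V) (hC0 : 0 ≤ C)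
    (hV : V * Real.exp (-(m * (κ / 2))) * (1 - Real.exp (-(κ / 2)))⁻¹ * Cd * Real.exp (2 * k * δ)
        ≤ 1 / 16)
    (hC : C * Real.exp (-(m' * (κ / 2))) * (1 - Real.exp (-(κ / 2)))⁻¹ * Cd * Real.exp (2 * k * δ)
        ≤ 1 / 16) {cb : ℕ → ℝ}
    (hcb : ∀ i, cb i ≤ (if i < m then 0 else V) + (if i < m' then 0 else C)) :
    ∑ i ∈ Finset.range (n - k + 1), (N : ℝ) ^ i * Real.exp (i * S) * cb i * M (n - k - i) ≤
      1 / 8 * (M n / M k) := by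
  have hN0 : (0:ℝ) < N := by exact_mod_cast hN
  have hterm : ∀ i ∈ Finset.range (n - k + 1),
      (N : ℝ) ^ i * Real.exp (i * S) * cb i * M (n - k - i) ≤
      Real.exp (-(k * (P' - δ))) * M n * (V * (if i < m then 0 else Real.exp (-(i * (κ / 2)))) +
        C * (if i < m' then 0 else Real.exp (-(i * (κ / 2))))) := by
    intro i hi
    have hi' : k + i ≤ n := by have := Finset.mem_range.1 hi; omega
    have h1 := hrec (k + i) hi'
    rw [show n - (k + i) = n - k - i by omega] at h1
    have hNi : (N : ℝ) ^ i = Real.exp (i * Real.log N) := by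
      rw [Real.exp_nat_mul, Real.exp_log hN0]
    set cc := (if i < m then 0 else V) + (if i < m' then 0 else C) with hcc
    have hcc0 : 0 ≤ cc := by rw [hcc]; split_ifs <;> linarith
    have h2 : (N : ℝ) ^ i * Real.exp (i * S) * Real.exp (-((k + i : ℕ) * (P' - δ))) ≤
        Real.exp (-(k * (P' - δ))) * Real.exp (-(i * (κ / 2))) := by
      rw [hNi, ← Real.exp_add, ← Real.exp_add, ← Real.exp_add, Real.exp_le_exp]
      push_cast
      have hi0 : (0:ℝ) ≤ i := Nat.cast_nonneg i
      have : (i:ℝ) * Real.log N + i * S - i * (P' - δ) = - (i * (κ - δ)) := by rw [hκ]; ring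
      have : (i:ℝ) * (κ / 2) ≤ i * (κ - δ) := by gcongr; linarith
      nlinarith
    calc (N : ℝ) ^ i * Real.exp (i * S) * cb i * M (n - k - i)
        ≤ (N : ℝ) ^ i * Real.exp (i * S) * cc * (Real.exp (-((k + i : ℕ) * (P' - δ))) * M n) := by
          have := hpos (n - k - i)
          gcongr
          exact hcb i
      _ = ((N : ℝ) ^ i * Real.exp (i * S) * Real.exp (-((k + i : ℕ) * (P' - δ)))) * (cc * M n) := by ring
      _ ≤ (Real.exp (-(k * (P' - δ))) * Real.exp (-(i * (κ / 2)))) * (cc * M n) := by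
          have := hpos n
          gcongr
      _ = _ := by
          rw [hcc]; split_ifs <;> ring
  refine (Finset.sum_le_sum hterm).trans ?_
  rw [← Finset.mul_sum, Finset.sum_add_distrib, ← Finset.mul_sum, ← Finset.mul_sum]
  have g1 := geom_tail hκ0 m (n - k + 1)
  have g2 := geom_tail hκ0 m' (n - k + 1)
  set s1 := ∑ i ∈ Finset.range (n - k + 1), (if i < m then 0 else Real.exp (-(i * (κ / 2))))
  set s2 := ∑ i ∈ Finset.range (n - k + 1), (if i < m' then 0 else Real.exp (-(i * (κ / 2))))
  set G := (1 - Real.exp (-(κ / 2)))⁻¹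
  have hn := hpos n
  have hk := hpos k
  have hE : Real.exp (2 * k * δ) = Real.exp (-(k * (P' - δ))) * Real.exp (k * (P' + δ)) := by
    rw [← Real.exp_add]; congr 1; ring
  rw [mul_div_assoc', le_div_iff₀ hk]
  have hs : V * s1 + C * s2 ≤ V * (Real.exp (-(m * (κ / 2))) * G) + C * (Real.exp (-(m' * (κ / 2))) * G) := by
    gcongr
  have hs0 : 0 ≤ V * s1 + C * s2 := by
    have : 0 ≤ s1 := Finset.sum_nonneg fun i _ => by split_ifs <;> positivity
    have : 0 ≤ s2 := Finset.sum_nonneg fun i _ => by split_ifs <;> positivity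
    positivity
  calc Real.exp (-(k * (P' - δ))) * M n * (V * s1 + C * s2) * M k
      ≤ Real.exp (-(k * (P' - δ))) * M n * (V * s1 + C * s2) * (Cd * Real.exp (k * (P' + δ))) := by
        gcongr
    _ = Real.exp (-(k * (P' - δ))) * M n * (Cd * Real.exp (k * (P' + δ))) * (V * s1 + C * s2) := by ring
    _ ≤ Real.exp (-(k * (P' - δ))) * M n * (Cd * Real.exp (k * (P' + δ))) *
        (V * (Real.exp (-(m * (κ / 2))) * G) + C * (Real.exp (-(m' * (κ / 2))) * G)) := by
        have : 0 < Cd * Real.exp (k * (P' + δ)) := hk.trans_le hMk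
        gcongr
    _ = M n * (V * Real.exp (-(m * (κ / 2))) * G * Cd * Real.exp (2 * k * δ) +
        C * Real.exp (-(m' * (κ / 2))) * G * Cd * Real.exp (2 * k * δ)) := by rw [hE]; ring
    _ ≤ M n * (1 / 16 + 1 / 16) := by gcongr
    _ = _ := by ring

lemma birk_bd (hg : Good p q) {fe : SymX N → ℝ} {c S : ℝ}
    (hS : ∀ x ∈ juliaSet p q, c ≤ fe x ∧ fe x ≤ S) (k : ℕ) :
    ∀ x ∈ juliaSet p q, ∀ y ∈ preimTn p q k x, k * c ≤ birk p q fe k y ∧ birk p q fe k y ≤ k * S := by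
  induction k with
  | zero => intro x _ y _; simp [birk]
  | succ k ih =>
    intro x hx y hy
    rw [preimTn, Multiset.mem_bind] at hy
    obtain ⟨y1, hy1, hy⟩ := hy
    have hJ := julia_preimT hg hx hy1
    have h1 := ih y1 hJ y hy
    have h2 : birk p q fe (k + 1) y = birk p q fe k y + fe y1 := by
      rw [add_comm k 1, birk_add, (mem_preimTn hg).1 hy]
      simp [birk]
    have h3 := hS y1 hJ
    rw [h2]
    push_cast
    constructor <;> linarith [h1.1, h1.2, h3.1, h3.2]

lemma pull_down (hg : Good p q) {fe : SymX N → ℝ} {B : ℝ}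
    (hB : ∀ x ∈ juliaSet p q, |fe x| ≤ B) (k n : ℕ) {x y : SymX N} (hx : x ∈ juliaSet p q)
    (hy : y ∈ preimTn p q k x) : Real.exp (-(k * B)) * LSum p q fe n y ≤ LSum p q fe (k + n) x := by
  rw [LSum_add p q hg]
  have h1 : Real.exp (birk p q fe k y) * LSum p q fe n y ≤
      ((preimTn p q k x).map fun y => Real.exp (birk p q fe k y) * LSum p q fe n y).sum := by
    apply Multiset.single_le_sum
    · intro a ha
      obtain ⟨b, _, rfl⟩ := Multiset.mem_map.1 ha
      exact mul_nonneg (Real.exp_pos _).le (LSum_nonneg p q _ _ _)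
    · exact Multiset.mem_map.2 ⟨y, hy, rfl⟩
  refine le_trans ?_ h1
  have h2 := (birk_bd p q hg (c := -B) (S := B) (fun x hx => abs_le.1 (hB x hx)) k x hx y hy).1
  have := LSum_nonneg p q fe n y
  gcongr
  linarith

lemma sum_ite_card {α : Type*} (s : Multiset α) (Q : α → Prop) (c : ℝ) :
    (s.map fun a => if Q a then c else 0).sum = (s.filter Q).card * c := by
  induction s using Multiset.induction_on with
  | empty => simp
  | cons a s ih =>
    rw [Multiset.map_cons, Multiset.sum_cons, ih, Multiset.filter_cons]
    by_cases h : Q a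
    · simp [h]; ring
    · simp [h]

lemma good_desc (hg : Good p q) {fe : SymX N → ℝ} {c S : ℝ}
    (hS : ∀ x ∈ juliaSet p q, c ≤ fe x ∧ fe x ≤ S) (k n : ℕ) {O : Set Sphere} {r Z Mn Mk : ℝ}
    {y : SymX N} (hy : y ∈ juliaSet p q) (hMk0 : 0 < Mk) (hr : ((preimTn p q k y).filter fun y => y.2 ∈ O).card ≤ r)
    (hZ : ∀ x ∈ juliaSet p q, LSum p q fe n x ≤ Z) (hZ' : r * (Real.exp (k * S) * Z) ≤ 1 / 4 * Mn)
    (hMk : LSum p q fe k y ≤ Mk) (hMn0 : 0 < Mn) (hMn : 1 / 2 * Mn < LSum p q fe (k + n) y) :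
    ∃ y' ∈ preimTn p q k y, y'.2 ∉ O ∧ 1 / 4 * (Mn / Mk) < LSum p q fe n y' := by
  by_contra hcon
  push Not at hcon
  rw [LSum_add p q hg] at hMn
  have hZ0 : 0 ≤ Z := (LSum_nonneg p q fe n y).trans (hZ y hy)
  have h1 : ((preimTn p q k y).map fun y => Real.exp (birk p q fe k y) * LSum p q fe n y).sum ≤
    ((preimTn p q k y).map fun y => Real.exp (birk p q fe k y) * (1 / 4 * (Mn / Mk)) +
      if y.2 ∈ O then Real.exp (k * S) * Z else 0).sum := by
    apply sum_map_le
    intro y' hy'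
    have hb := (birk_bd p q hg hS k y hy y' hy').2
    by_cases hO : y'.2 ∈ O
    · rw [if_pos hO]
      have : Real.exp (birk p q fe k y') * LSum p q fe n y' ≤ Real.exp (k * S) * Z := by
        have := LSum_nonneg p q fe n y'
        gcongr
        exact hZ _ (julia_preimTn hg hy hy')
      have : 0 ≤ Real.exp (birk p q fe k y') * (1 / 4 * (Mn / Mk)) := by positivity
      linarith
    · rw [if_neg hO, add_zero]
      gcongr
      exact hcon y' hy' hO
  rw [Multiset.sum_map_add, Multiset.sum_map_mul_right, sum_ite_card] at h1
  have h2 : ((preimTn p q k y).map fun y => Real.exp (birk p q fe k y)).sum ≤ Mk := hMk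
  have h3 : ((preimTn p q k y).map fun y => Real.exp (birk p q fe k y)).sum * (1 / 4 * (Mn / Mk)) ≤
      Mk * (1 / 4 * (Mn / Mk)) := by gcongr
  have h4 : Mk * (1 / 4 * (Mn / Mk)) = 1 / 4 * Mn := by field_simp
  have h5 : (((preimTn p q k y).filter fun y => y.2 ∈ O).card : ℝ) * (Real.exp (k * S) * Z) ≤
    r * (Real.exp (k * S) * Z) := by gcongr
  linarith

lemma good_compact {O : Set Sphere} (hO : IsOpen O) (hinf : (OnePoint.infty : Sphere) ∈ O) :
    IsCompact {z : ℂ | (z : Sphere) ∉ O} := by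
  have h1 : IsCompact (Oᶜ : Set Sphere) := hO.isClosed_compl.isCompact
  rw [OnePoint.isOpenEmbedding_coe.isEmbedding.isInducing.isCompact_iff]
  convert h1 using 1
  ext z
  constructor
  · rintro ⟨a, ha, rfl⟩
    exact ha
  · intro hz
    induction z using OnePoint.rec with
    | infty => exact (hz hinf).elim
    | coe a => exact ⟨a, hz, rfl⟩

lemma core (hg : Good p q) (hA1 : NoSuperAttract p q) (hne : (juliaSet p q).Nonempty)
    {fe : SymX N → ℝ} {S B P' : ℝ} (hS : ∀ x ∈ juliaSet p q, fe x ≤ S)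
    (hB : ∀ x ∈ juliaSet p q, |fe x| ≤ B) (hB0 : 0 ≤ B)
    (hu : ∀ ε > 0, ∃ η > 0, ∀ x ∈ juliaSet p q, ∀ y ∈ juliaSet p q, dX x y ≤ η → |fe x - fe y| ≤ ε)
    (h1 : ∀ n : ℕ, Real.exp (n * P') ≤ MM p q fe n)
    (h2 : ∀ δ > 0, ∃ C > 0, ∀ n : ℕ, MM p q fe n ≤ C * Real.exp (n * (P' + δ)))
    (h3 : ∀ δ > 0, ∀ n0 : ℕ, ∃ n ≥ n0, ∀ k : ℕ, k ≤ n →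
      MM p q fe (n - k) ≤ Real.exp (-(k * (P' - δ))) * MM p q fe n)
    (hκ : S + Real.log N < P') : ∀ ε > 0, ∃ n : ℕ, 1 ≤ n ∧ ∀ x ∈ juliaSet p q,
      Real.exp (n * (P' - ε)) ≤ LSum p q fe n x := by
  intro ε hε
  have hN : 1 ≤ N := hg.1
  have hN' : (1:ℝ) ≤ N := by exact_mod_cast hN
  have hMpos : ∀ n, 0 < MM p q fe n := fun n => (Real.exp_pos _).trans_le (h1 n)
  have hM := LSum_le_MM p q hg hS
  set κ := P' - S - Real.log N with hκd
  have hκ0 : 0 < κ := by rw [hκd]; linarith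
  choose! Cd hCd0 hCd using h2
  set V : ℝ := ((Vset p q).ncard : ℝ) with hV
  obtain ⟨δ, hδ0, hδ, m, hm, k, pa, pb, pc⟩ := params (κ := κ) (N := N) (A := V + 1) (V := V)
    (Kc := KK p q hg) hκ0 hN' (by positivity) (by positivity) (by positivity) Cd hCd0
  set F' : Finset Sphere := insert OnePoint.infty (Fset_finite p q hg m).toFinset with hF'
  have hF'card : (F'.card : ℝ) ≤ (V + 1) * (N + 1) ^ m := by
    have e1 : F'.card ≤ (Fset p q m).ncard + 1 := by
      rw [Set.ncard_eq_toFinset_card _ (Fset_finite p q hg m)]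
      exact Finset.card_insert_le _ _
    have e2 := Fset_card p q hg m
    have e3 : F'.card ≤ ((Vset p q).ncard + 1) * (N + 1) ^ m := by
      have : 1 ≤ (N + 1) ^ m := Nat.one_le_pow _ _ (by omega)
      nlinarith
    rw [hV]
    exact_mod_cast e3
  obtain ⟨O, hO, hFO, hOcard⟩ := exists_O p q hg hA1 F' k
  set r : ℝ := N ^ k * ((V + 1) * (N + 1) ^ m) * KK p q hg with hr
  have hr0 : 0 ≤ r := by positivity
  have hOr : ∀ x ∈ juliaSet p q, (((preimTn p q k x).filter fun y => y.2 ∈ O).card : ℝ) ≤ r := by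
    intro x hx
    have : (((preimTn p q k x).filter fun y => y.2 ∈ O).card : ℝ) ≤ N ^ k * F'.card * KK p q hg := by
      exact_mod_cast hOcard x hx
    refine this.trans ?_
    rw [hr]
    gcongr
  have hpre : ∀ x ∈ juliaSet p q, ∃ y ∈ preimTn p q k x, y.2 ∉ O := by
    intro x hx
    by_contra hcon
    push Not at hcon
    have e1 := hOr x hx
    rw [Multiset.filter_eq_self.2 hcon, card_preimTn] at e1
    have e2 : ((N:ℝ) + 1) ^ k ≤ ((Dtot p q ^ k : ℕ) : ℝ) := by
      push_cast
      gcongr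
      exact_mod_cast Dtot_ge p q hg
    linarith
  have hcomp := good_compact hO (hFO _ (Finset.mem_insert_self _ _))
  have hFfin : {z : ℂ | (z : Sphere) ∈ Fset p q m}.Finite :=
    (Fset_finite p q hg m).preimage OnePoint.coe_injective.injOn
  have hdisj : Disjoint {z : ℂ | (z : Sphere) ∉ O} {z : ℂ | (z : Sphere) ∈ Fset p q m} := by
    rw [Set.disjoint_left]
    intro z hz hz'
    exact hz (hFO _ (Finset.mem_insert_of_mem ((Set.Finite.mem_toFinset _).2 hz')))
  obtain ⟨η, hη, hfd⟩ := hu (ε / 2) (by linarith)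
  obtain ⟨C, hC⟩ := charts_uniform hFfin hcomp hdisj hη
  obtain ⟨m', hmm, hm'η, hm'C⟩ : ∃ m' : ℕ, m ≤ m' ∧ (2 : ℝ)⁻¹ ^ m' ≤ η ∧
      C * Real.exp (-(m' * (κ / 2))) * (1 - Real.exp (-(κ / 2)))⁻¹ * Cd δ * Real.exp (2 * k * δ)
        ≤ 1 / 16 := by
    have t1 : Tendsto (fun j : ℕ => (2:ℝ)⁻¹ ^ j) atTop (𝓝 0) :=
      tendsto_pow_atTop_nhds_zero_of_lt_one (by norm_num) (by norm_num)
    have t2 : Tendsto (fun j : ℕ => (Real.exp (-(κ / 2))) ^ j *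
        (C * (1 - Real.exp (-(κ / 2)))⁻¹ * Cd δ * Real.exp (2 * k * δ))) atTop
        (𝓝 (0 * (C * (1 - Real.exp (-(κ / 2)))⁻¹ * Cd δ * Real.exp (2 * k * δ)))) :=
      (tendsto_pow_atTop_nhds_zero_of_lt_one (Real.exp_pos _).le
        (by rw [Real.exp_lt_one_iff]; linarith)).mul_const _
    rw [zero_mul] at t2
    obtain ⟨j, ⟨hj1, hj2⟩, hj0⟩ := ((t1.eventually (gt_mem_nhds hη)).and
      (t2.eventually (gt_mem_nhds (by norm_num : (0:ℝ) < 1/16)))).and (eventually_ge_atTop m) |>.exists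
    refine ⟨j, hj0, hj1.le, ?_⟩
    refine le_trans (le_of_eq ?_) hj2.le
    rw [← Real.exp_nat_mul, show -((j:ℝ) * (κ / 2)) = j * -(κ / 2) by ring]
    ring
  set Q := Real.log (8 * MM p q fe k) + k * B + 2 * B * m' with hQ
  obtain ⟨n0, hn0⟩ := exists_nat_ge (Q / (ε / 2))
  obtain ⟨n, hn, hrec⟩ := h3 δ hδ0 (max n0 (k + 1))
  have hkn : k ≤ n := by have := le_max_right n0 (k + 1); omega
  have hn1 : 1 ≤ n := by have := le_max_right n0 (k + 1); omega
  have hnQ : Q ≤ n * (ε / 2) := by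
    rw [div_le_iff₀ (by linarith)] at hn0
    refine hn0.trans ?_
    have : n0 ≤ n := (le_max_left _ _).trans hn
    gcongr
  refine ⟨n, hn1, ?_⟩
  obtain ⟨j, rfl⟩ : ∃ j, n = k + j := ⟨n - k, by omega⟩
  have hkj : k + j - k = j := by omega
  have hbad := bad_sum (N := N) hMpos (P' := P') (δ := δ) (S := S) (κ := κ) (Cd := Cd δ) (V := V) (C := C)
    hN hκ0 hκd hδ (m := m) (m' := m') hkn hrec (hCd δ hδ0 k) (by positivity) (by positivity) pc hm'C
    (cb := fun i => (cbad p q m m' C i : ℝ)) (by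
      intro i
      simp only [cbad, hV]
      split_ifs <;> first | omega | (push_cast; simp))
  rw [hkj] at hbad
  have hMj := hrec k hkn
  rw [hkj] at hMj
  have hMn := hMpos (k + j)
  have hMk := hMpos k
  -- a good point
  obtain ⟨y, hy, hyL⟩ : ∃ y ∈ juliaSet p q, 1 / 2 * MM p q fe (k + j) < LSum p q fe (k + j) y := by
    have : Nonempty ↥(juliaSet p q) := hne.to_subtype
    have hlt : 1 / 2 * MM p q fe (k + j) < MM p q fe (k + j) := by linarith
    obtain ⟨y, hy⟩ := exists_lt_of_lt_ciSup hlt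
    exact ⟨y, y.2, hy⟩
  have hZ' : r * (Real.exp (k * S) * MM p q fe j) ≤ 1 / 4 * MM p q fe (k + j) := by
    have e0 : (N:ℝ) ^ k * Real.exp (k * S) * Real.exp (-(k * (P' - δ))) = Real.exp (-(k * (κ - δ))) := by
      have hNi : (N : ℝ) ^ k = Real.exp (k * Real.log N) := by
        rw [Real.exp_nat_mul, Real.exp_log (by linarith)]
      rw [hNi, ← Real.exp_add, ← Real.exp_add, hκd]
      congr 1; ring
    calc r * (Real.exp (k * S) * MM p q fe j)
        ≤ r * (Real.exp (k * S) * (Real.exp (-(k * (P' - δ))) * MM p q fe (k + j))) := by gcongr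
      _ = ((N:ℝ) ^ k * Real.exp (k * S) * Real.exp (-(k * (P' - δ)))) *
          ((V + 1) * (N + 1) ^ m) * KK p q hg * MM p q fe (k + j) := by rw [hr]; ring
      _ ≤ 1 / 4 * MM p q fe (k + j) := by rw [e0]; gcongr
  obtain ⟨y', hy', hyO, hyL'⟩ := good_desc p q hg (c := -B) (S := S)
    (fun x hx => ⟨(abs_le.1 (hB x hx)).1, hS x hx⟩) k j (O := O) hy hMk (hOr y hy) (hM j) hZ' (hM k y hy) hMn hyL
  have hy'J := julia_preimTn hg hy hy'
  intro x hx
  obtain ⟨x', hx', hxO⟩ := hpre x hx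
  have hx'J := julia_preimTn hg hx hx'
  obtain ⟨wx, zx⟩ := x'
  obtain ⟨wy, zy⟩ := y'
  induction zx using OnePoint.rec with
  | infty => exact (hxO (hFO _ (Finset.mem_insert_self _ _))).elim
  | coe zx =>
  induction zy using OnePoint.rec with
  | infty => exact (hyO (hFO _ (Finset.mem_insert_self _ _))).elim
  | coe zy =>
  obtain ⟨Ω, K, ψ, hch, ⟨t, ht, rfl⟩, ⟨t', ht', rfl⟩, hab⟩ := hC zx hxO zy hyO
  have hcmp := tree_compare p q hg hch hab hm hmm (M := MM p q fe) hM hS hB hB0 (ε := ε / 2)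
    (by linarith) hfd hm'η ht ht' j wx wy hx'J hy'J
  have hpd := pull_down p q hg hB k j hx hx'
  refine le_trans ?_ hpd
  have hb1 : 1 / 8 * (MM p q fe (k + j) / MM p q fe k) ≤ LSum p q fe j (wy, (ψ t' : Sphere)) -
    ∑ i ∈ Finset.range (j + 1),
      (N : ℝ) ^ i * Real.exp (i * S) * cbad p q m m' C i * MM p q fe (j - i) := by
    linarith
  have hb2 : Real.exp (-(2 * B * m' + ε / 2 * j)) * (1 / 8 * (MM p q fe (k + j) / MM p q fe k)) ≤
      LSum p q fe j (wx, (ψ t : Sphere)) :=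
    (mul_le_mul_of_nonneg_left hb1 (Real.exp_pos _).le).trans hcmp
  refine le_trans ?_ (mul_le_mul_of_nonneg_left hb2 (Real.exp_pos _).le)
  have hb3 : 1 / 8 * (MM p q fe (k + j) / MM p q fe k) =
      Real.exp (-Real.log (8 * MM p q fe k)) * MM p q fe (k + j) := by
    rw [Real.exp_neg, Real.exp_log (by positivity)]
    field_simp
  rw [hb3]
  calc Real.exp ((k + j : ℕ) * (P' - ε)) ≤ Real.exp (-(k * B)) * (Real.exp (-(2 * B * m' + ε / 2 * j)) *
        (Real.exp (-Real.log (8 * MM p q fe k)) * Real.exp ((k + j : ℕ) * P'))) := by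
        rw [← Real.exp_add, ← Real.exp_add, ← Real.exp_add, Real.exp_le_exp]
        rw [hQ] at hnQ
        have : ε / 2 * (j:ℝ) ≤ ((k + j : ℕ) : ℝ) * (ε / 2) := by
          push_cast
          have : (0:ℝ) ≤ k * (ε / 2) := by positivity
          linarith
        linarith
    _ ≤ _ := by
        have := h1 (k + j)
        gcongr

lemma iterate_lower (hg : Good p q) {fe : SymX N → ℝ} {c : ℝ} {n : ℕ}
    (h : ∀ x ∈ juliaSet p q, Real.exp (n * c) ≤ LSum p q fe n x) (j : ℕ) :
    ∀ r : ℕ, ∀ d : ℝ, (∀ x ∈ juliaSet p q, d ≤ LSum p q fe r x) → 0 ≤ d → ∀ x ∈ juliaSet p q,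
      Real.exp ((j * n : ℕ) * c) * d ≤ LSum p q fe (j * n + r) x := by
  induction j with
  | zero => intro r d hd _ x hx; simpa using hd x hx
  | succ j ih =>
    intro r d hd hd0 x hx
    have h2 : ∀ x ∈ juliaSet p q, Real.exp (n * c) * d ≤ LSum p q fe (n + r) x := by
      intro x hx
      rw [LSum_add p q hg]
      refine le_trans (mul_le_mul_of_nonneg_right (h x hx) hd0) ?_
      rw [LSum, ← Multiset.sum_map_mul_right]
      apply sum_map_le
      intro y hy
      gcongr
      exact hd y (julia_preimTn hg hx hy)
    have h3 := ih (n + r) _ h2 (by positivity) x hx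
    rw [show (j + 1) * n + r = j * n + (n + r) by ring]
    refine le_trans (le_of_eq ?_) h3
    rw [← mul_assoc, ← Real.exp_add]
    congr 2
    push_cast; ring

lemma ev_const_div (c : ℝ) {ε : ℝ} (hε : 0 < ε) : ∀ᶠ n : ℕ in atTop, c ≤ n * ε ∧ 0 < n :=
  ((tendsto_natCast_atTop_atTop.atTop_mul_const hε).eventually_ge_atTop c).and (eventually_gt_atTop 0)

lemma pressure_main (hg : Good p q) (hA1 : NoSuperAttract p q)
    (f : ↥(juliaSet p q) → ℝ) (hf : HolderOnJ p q f)
    (hP : pressure p q (jextend p q f) > (⨆ x : ↥(juliaSet p q), f x) + Real.log N) :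
    ∀ x ∈ juliaSet p q,
      Tendsto (fun n : ℕ => (n : ℝ)⁻¹ * Real.log (LSum p q (jextend p q f) n x)) atTop
        (𝓝 (pressure p q (jextend p q f))) := by
  intro x0 hx0
  have hne : (juliaSet p q).Nonempty := ⟨x0, hx0⟩
  have hnt : Nonempty ↥(juliaSet p q) := hne.to_subtype
  obtain ⟨⟨B, hB0, hB⟩, hu⟩ := holder_facts p q hf
  set fe := jextend p q f with hfe
  set S := ⨆ x : ↥(juliaSet p q), f x with hSd
  have hS : ∀ x ∈ juliaSet p q, fe x ≤ S := by
    intro x hx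
    rw [hfe, jextend, dif_pos hx]
    refine le_ciSup (f := f) ⟨B, ?_⟩ ⟨x, hx⟩
    rintro _ ⟨⟨y, hy⟩, rfl⟩
    have := hB y hy
    rw [hfe, jextend, dif_pos hy] at this
    exact (abs_le.1 this).2
  have hlow : ∀ n : ℕ, Real.exp (-B * n) ≤ MM p q fe n := fun n =>
    (LSum_lower p q hg hB n x0 hx0).trans (LSum_le_MM p q hg hS n x0 hx0)
  obtain ⟨P', h1, h2, h3⟩ := seq_facts (MM_zero p q hne fe) hlow (MM_sub p q hg hne hS)
  have hLpos : ∀ n : ℕ, ∀ x ∈ juliaSet p q, 0 < LSum p q fe n x := fun n x hx =>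
    (Real.exp_pos _).trans_le (LSum_lower p q hg hB n x hx)
  have hupper : ∀ x ∈ juliaSet p q, ∀ ε > 0, ∀ᶠ n : ℕ in atTop,
      (n : ℝ)⁻¹ * Real.log (LSum p q fe n x) ≤ P' + ε := by
    intro x hx ε hε
    obtain ⟨C, hC0, hC⟩ := h2 (ε / 2) (by linarith)
    filter_upwards [ev_const_div (Real.log C) (half_pos hε)] with n hn
    have hn0 : (0:ℝ) < n := by exact_mod_cast hn.2
    rw [inv_mul_le_iff₀ hn0]
    have e1 : Real.log (LSum p q fe n x) ≤ Real.log C + n * (P' + ε / 2) := by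
      rw [← Real.log_exp (n * (P' + ε / 2)), ← Real.log_mul hC0.ne' (Real.exp_pos _).ne']
      exact Real.log_le_log (hLpos n x hx) ((LSum_le_MM p q hg hS n x hx).trans (hC n))
    nlinarith [hn.1]
  have hcob : ∀ x ∈ juliaSet p q, ∀ n : ℕ, -B ≤ (n : ℝ)⁻¹ * Real.log (LSum p q fe n x) := by
    intro x hx n
    rcases Nat.eq_zero_or_pos n with rfl | hn
    · simpa using hB0
    have hn0 : (0:ℝ) < n := by exact_mod_cast hn
    rw [le_inv_mul_iff₀ hn0, Real.le_log_iff_exp_le (hLpos n x hx)]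
    refine le_trans (le_of_eq ?_) (LSum_lower p q hg hB n x hx)
    congr 1; ring
  have hPP' : pressure p q fe ≤ P' := by
    apply ciSup_le
    rintro ⟨x, hx⟩
    apply le_of_forall_pos_le_add
    intro ε hε
    apply limsup_le_of_le
    · exact (isBoundedUnder_of ⟨-B, hcob x hx⟩ : IsBoundedUnder (· ≥ ·) atTop _).isCoboundedUnder_le
    · exact hupper x hx ε hε
  have hcore := core p q hg hA1 hne hS hB hB0 hu h1 h2 h3 (by linarith)
  have hlower : ∀ x ∈ juliaSet p q, ∀ ε > 0, ∀ᶠ n : ℕ in atTop,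
      P' - ε ≤ (n : ℝ)⁻¹ * Real.log (LSum p q fe n x) := by
    intro x hx ε hε
    obtain ⟨k, hk, hk'⟩ := hcore (ε / 2) (by linarith)
    filter_upwards [ev_const_div (k * |P' - ε / 2| + B * k) (half_pos hε)] with n hn
    have hn0 : (0:ℝ) < n := by exact_mod_cast hn.2
    rw [le_inv_mul_iff₀ hn0, Real.le_log_iff_exp_le (hLpos n x hx)]
    have hr : n % k < k := Nat.mod_lt _ hk
    have hdec : n / k * k + n % k = n := Nat.div_add_mod' n k
    have e1 := iterate_lower p q hg hk' (n / k) (n % k) (Real.exp (-B * k)) (by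
      intro y hy
      refine le_trans ?_ (LSum_lower p q hg hB (n % k) y hy)
      rw [Real.exp_le_exp]
      have : ((n % k : ℕ) : ℝ) ≤ k := by exact_mod_cast hr.le
      nlinarith) (Real.exp_pos _).le x hx
    rw [hdec] at e1
    refine le_trans ?_ e1
    rw [← Real.exp_add, Real.exp_le_exp]
    have e2 : ((n / k * k : ℕ) : ℝ) = n - (n % k : ℕ) := by
      rw [eq_sub_iff_add_eq]; exact_mod_cast hdec
    rw [e2]
    have e3 : ((n % k : ℕ) : ℝ) * (P' - ε / 2) ≤ k * |P' - ε / 2| := by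
      have : ((n % k : ℕ) : ℝ) ≤ k := by exact_mod_cast hr.le
      calc ((n % k : ℕ) : ℝ) * (P' - ε / 2) ≤ ((n % k : ℕ) : ℝ) * |P' - ε / 2| := by
            gcongr; exact le_abs_self _
        _ ≤ _ := by gcongr
    have := hn.1
    nlinarith
  have hlim : ∀ x ∈ juliaSet p q,
      Tendsto (fun n : ℕ => (n : ℝ)⁻¹ * Real.log (LSum p q fe n x)) atTop (𝓝 P') := by
    intro x hx
    rw [tendsto_order]
    constructor
    · intro a ha
      filter_upwards [hlower x hx ((P' - a) / 2) (by linarith)] with n hn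
      linarith
    · intro a ha
      filter_upwards [hupper x hx ((a - P') / 2) (by linarith)] with n hn
      linarith
  have hEq : pressure p q fe = P' := by
    unfold pressure
    have : ∀ x : ↥(juliaSet p q), limsup (fun n : ℕ => (n : ℝ)⁻¹ * Real.log (LSum p q fe n ↑x)) atTop = P' :=
      fun x => (hlim x x.2).limsup_eq
    simp [this]
  rw [hEq]
  exact hlim x0 hx0

theorem pressure_as_limit
    (hg : Good p q) (hA1 : NoSuperAttract p q)
    (f : ↥(juliaSet p q) → ℝ) (hf : HolderOnJ p q f)
    (hP : pressure p q (jextend p q f) > (⨆ x : ↥(juliaSet p q), f x) + Real.log N) :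
    ∀ x ∈ juliaSet p q,
      Tendsto (fun n : ℕ => (n : ℝ)⁻¹ * Real.log (LSum p q (jextend p q f) n x)) atTop
        (𝓝 (pressure p q (jextend p q f))) := by
  exact pressure_main p q hg hA1 f hf hP

end SkewRational
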